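/- Let f be a nonzero modular form of weight k > 0 for SL_2(Z) all of whose Fourier coefficients are algebraic numbers, and let r ≥ 1 be an integer. If the r-th derivative f^{(r)} of f has a zero of order e ≥ 2 at a point a ∈ H, then f has a zero of order e + r at a. -/

import Mathlib

/-- The upper half-plane, as a subset of `ℂ`. -/
def UpperHalf : Set ℂ := {z : ℂ | 0 < z.im}

/-- The value at `(x, y, w)` of the `t`-th iterate, applied to `X ^ i * Y ^ j * W ^ k`, of the
derivation with `X ↦ Y`, `Y ↦ 6 X ^ 2 - A`, `W ↦ - X - B`. -/
def derivVal {R : Type*} [CommRing R] (A B x y w : R) : ℕ → ℕ → ℕ → ℕ → R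
  | 0, i, j, k => x ^ i * y ^ j * w ^ k
  | t + 1, i, j, k => i * derivVal A B x y w t (i - 1) (j + 1) k +
      j * (6 * derivVal A B x y w t (i + 2) (j - 1) k - A * derivVal A B x y w t i (j - 1) k) -
      k * (derivVal A B x y w t (i + 1) j (k - 1) + B * derivVal A B x y w t i j (k - 1))

theorem map_derivVal {R S : Type*} [CommRing R] [CommRing S] (φ : R →+* S) (A B x y w : R)
    (t i j k : ℕ) :
    φ (derivVal A B x y w t i j k) = derivVal (φ A) (φ B) (φ x) (φ y) (φ w) t i j k := by
  induction t generalizing i j k with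
  | zero => simp [derivVal]
  | succ t ih =>
    have h6 : φ 6 = 6 := map_ofNat φ 6
    simp [derivVal, ih, h6]

theorem norm_derivVal_le {A B x y w : ℂ} {C : ℝ} (hC : 1 ≤ C) (hA : ‖A‖ ≤ C) (hB : ‖B‖ ≤ C)
    (hx : ‖x‖ ≤ C) (hy : ‖y‖ ≤ C) (hw : ‖w‖ ≤ C) (t i j k : ℕ) :
    ‖derivVal A B x y w t i j k‖ ≤ C ^ (i + j + k + t) * (7 * ((i + j + k + t : ℕ) : ℝ)) ^ t := by
  have hC0 : (0 : ℝ) ≤ C := by linarith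
  induction t generalizing i j k with
  | zero =>
    simp only [derivVal, norm_mul, norm_pow, add_zero, pow_zero, mul_one, pow_add]
    gcongr
  | succ t ih =>
    set d := i + j + k with hd
    set M : ℝ := C ^ (d + (t + 1)) * (7 * ((d + (t + 1) : ℕ) : ℝ)) ^ t with hM
    have hM0 : 0 ≤ M := by positivity
    have key : ∀ i' j' k' : ℕ, i' + j' + k' ≤ d + 1 → ‖derivVal A B x y w t i' j' k'‖ ≤ M := by
      intro i' j' k' h
      refine (ih i' j' k').trans ?_
      rw [hM]
      have h1 : i' + j' + k' + t ≤ d + (t + 1) := by omega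
      have h2 : ((i' + j' + k' + t : ℕ) : ℝ) ≤ ((d + (t + 1) : ℕ) : ℝ) := by exact_mod_cast h1
      gcongr
    have key2 : ∀ (D : ℂ), ‖D‖ ≤ C → ∀ i' j' k' : ℕ, i' + j' + k' + 1 ≤ d →
        ‖D * derivVal A B x y w t i' j' k'‖ ≤ M := by
      intro D hD i' j' k' h
      rw [norm_mul]
      refine (mul_le_mul hD (ih i' j' k') (norm_nonneg _) hC0).trans ?_
      rw [hM, ← mul_assoc, ← pow_succ']
      have h1 : i' + j' + k' + t + 1 ≤ d + (t + 1) := by omega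
      have h2 : ((i' + j' + k' + t : ℕ) : ℝ) ≤ ((d + (t + 1) : ℕ) : ℝ) := by
        exact_mod_cast (by omega)
      gcongr
    have e1 : ‖(i : ℂ) * derivVal A B x y w t (i - 1) (j + 1) k‖ ≤ i * M := by
      rcases i with _ | i
      · simp
      rw [norm_mul, Complex.norm_natCast]
      gcongr
      exact key _ _ _ (by omega)
    have e2 : ‖(j : ℂ) * (6 * derivVal A B x y w t (i + 2) (j - 1) k -
        A * derivVal A B x y w t i (j - 1) k)‖ ≤ j * (7 * M) := by
      rcases j with _ | j
      · simp
      rw [norm_mul, Complex.norm_natCast]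
      gcongr
      refine (norm_sub_le _ _).trans ?_
      have := key (i + 2) (j + 1 - 1) k (by omega)
      have h' := key2 A hA i (j + 1 - 1) k (by omega)
      rw [norm_mul]
      norm_num at this h' ⊢
      linarith
    have e3 : ‖(k : ℂ) * (derivVal A B x y w t (i + 1) j (k - 1) +
        B * derivVal A B x y w t i j (k - 1))‖ ≤ k * (2 * M) := by
      rcases k with _ | k
      · simp
      rw [norm_mul, Complex.norm_natCast]
      gcongr
      refine (norm_add_le _ _).trans ?_
      have := key (i + 1) j (k + 1 - 1) (by omega)
      have h' := key2 B hB i j (k + 1 - 1) (by omega)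
      linarith
    rw [derivVal]
    refine (norm_sub_le _ _).trans ((add_le_add_left (norm_add_le _ _) _).trans ?_)
    have hfin : C ^ (d + (t + 1)) * (7 * ((d + (t + 1) : ℕ) : ℝ)) ^ (t + 1)
        = M * (7 * ((d + (t + 1) : ℕ) : ℝ)) := by rw [hM]; ring
    rw [hfin]
    have : ((d + (t + 1) : ℕ) : ℝ) = i + j + k + t + 1 := by rw [hd]; push_cast; ring
    rw [this]
    have hi : (0 : ℝ) ≤ i := by positivity
    have hk : (0 : ℝ) ≤ k := by positivity
    have ht : (0 : ℝ) ≤ t := by positivity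
    nlinarith [mul_nonneg hi hM0, mul_nonneg hk hM0, mul_nonneg ht hM0]

/-- Along a solution of the differential system, iterated derivatives are given by `derivVal`. -/
theorem iteratedDeriv_eq_derivVal {P P₁ H : ℂ → ℂ} {c A B : ℂ} (U : Set ℂ) (hU : IsOpen U)
    (hP : ∀ z ∈ U, HasDerivAt P (c⁻¹ * P₁ z) z)
    (hP₁ : ∀ z ∈ U, HasDerivAt P₁ (c⁻¹ * (6 * P z ^ 2 - A)) z)
    (hH : ∀ z ∈ U, HasDerivAt H (c⁻¹ * (- P z - B)) z)
    (t i j k : ℕ) : ∀ z ∈ U, iteratedDeriv t (fun z ↦ P z ^ i * P₁ z ^ j * H z ^ k) z =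
      c⁻¹ ^ t * derivVal A B (P z) (P₁ z) (H z) t i j k ∧
      HasDerivAt (fun z ↦ derivVal A B (P z) (P₁ z) (H z) t i j k)
        (c⁻¹ * derivVal A B (P z) (P₁ z) (H z) (t + 1) i j k) z := by
  have hder : ∀ t i j k, ∀ z ∈ U, HasDerivAt (fun z ↦ derivVal A B (P z) (P₁ z) (H z) t i j k)
        (c⁻¹ * derivVal A B (P z) (P₁ z) (H z) (t + 1) i j k) z := by
    intro t
    induction t with
    | zero =>
      intro i j k z hz
      have := (((hP z hz).pow i).mul ((hP₁ z hz).pow j)).mul ((hH z hz).pow k)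
      simp only [derivVal]
      convert! this using 1
      simp only [Pi.mul_apply, Pi.pow_apply]
      ring
    | succ t ih =>
      intro i j k z hz
      have h := ((ih (i - 1) (j + 1) k z hz).const_mul (i : ℂ)).add
        ((((ih (i + 2) (j - 1) k z hz).const_mul 6).sub
          ((ih i (j - 1) k z hz).const_mul A)).const_mul (j : ℂ)) |>.sub
        (((ih (i + 1) j (k - 1) z hz).add ((ih i j (k - 1) z hz).const_mul B)).const_mul (k : ℂ))
      rw [derivVal]
      convert! h using 1
      ring
  intro z hz
  refine ⟨?_, hder t i j k z hz⟩
  induction t generalizing z with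
  | zero => simp [derivVal]
  | succ t ih =>
    rw [iteratedDeriv_succ]
    have : iteratedDeriv t (fun z ↦ P z ^ i * P₁ z ^ j * H z ^ k) =ᶠ[nhds z]
        fun z ↦ c⁻¹ ^ t * derivVal A B (P z) (P₁ z) (H z) t i j k := by
      filter_upwards [hU.mem_nhds hz] with w hw using ih w hw
    rw [this.deriv_eq, ((hder t i j k z hz).const_mul (c⁻¹ ^ t)).deriv, pow_succ]
    ring

section

open Complex Filter Topology

/-- The function `π cot (π z)`. -/
noncomputable def cotPi (z : ℂ) : ℂ := Real.pi * cot (Real.pi * z)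

/-- The function `∑ π cot (π (z + m τ))`, the sum being over `m : ℤ` in symmetric order. -/
noncomputable def cotSum (τ z : ℂ) : ℂ :=
  cotPi z + ∑' m : ℕ, (cotPi (z + (m + 1 : ℕ) * τ) + cotPi (z - (m + 1 : ℕ) * τ))

theorem cotPi_neg (z : ℂ) : cotPi (-z) = - cotPi z := by
  simp [cotPi, cot, div_neg]

theorem cotPi_add_one (z : ℂ) : cotPi (z + 1) = cotPi z := by
  simp [cotPi, cot, mul_add, Complex.sin_add_pi, Complex.cos_add_pi]

theorem differentiableAt_cotPi {z : ℂ} (h : sin (Real.pi * z) ≠ 0) :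
    DifferentiableAt ℂ cotPi z := by
  unfold cotPi cot
  fun_prop (disch := exact h)

theorem sin_pi_mul_ne_zero_of_im_ne_zero {z : ℂ} (h : z.im ≠ 0) : sin (Real.pi * z) ≠ 0 := by
  rw [Complex.sin_ne_zero_iff]
  intro k hk
  have hp : (Real.pi : ℂ) ≠ 0 := by exact_mod_cast Real.pi_ne_zero
  have : z = k := by
    apply mul_left_cancel₀ hp; rw [hk]; ring
  exact h (by simp [this])

theorem norm_cotPi_add_le {y : ℝ} (hy : 0 < y) {w : ℂ} {m : ℕ} (hm : 1 ≤ m)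
    (h : m * y / 4 ≤ w.im) :
    ‖cotPi w + Real.pi * I‖ ≤
      2 * Real.pi / (1 - Real.exp (-(Real.pi * y / 2))) * Real.exp (-(Real.pi * y / 2)) ^ m := by
  set ρ := Real.exp (-(Real.pi * y / 2)) with hρ
  have hp := Real.pi_pos
  have hρ0 : 0 < ρ := Real.exp_pos _
  have hρ1 : ρ < 1 := by rw [hρ, Real.exp_lt_one_iff]; have := mul_pos hp hy; linarith
  set X := exp (2 * Real.pi * I * w) with hX
  have hXn : ‖X‖ ≤ ρ ^ m := by
    rw [hX, Complex.norm_exp, hρ, ← Real.exp_nat_mul]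
    apply Real.exp_le_exp.2
    simp
    nlinarith
  have hXρ : ‖X‖ ≤ ρ := hXn.trans (pow_le_of_le_one hρ0.le hρ1.le (by omega))
  have hne : 1 - X ≠ 0 := by
    intro h0
    have : X = 1 := by linear_combination -h0
    rw [this] at hXρ; simp at hXρ; linarith
  have hlow : 1 - ρ ≤ ‖1 - X‖ := by
    have := norm_sub_norm_le (1 : ℂ) X
    simp at this; linarith
  have e : cotPi w + Real.pi * I = -(2 * Real.pi * I) * X / (1 - X) := by
    rw [cotPi, Complex.cot_pi_eq_exp_ratio, ← hX]
    field_simp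
    have : I ^ 2 = -1 := I_sq
    ring_nf; rw [this]; ring
  rw [e, norm_div, norm_mul]
  have : ‖-(2 * (Real.pi : ℂ) * I)‖ = 2 * Real.pi := by simp [abs_of_pos hp]
  rw [this, mul_div_right_comm]
  have : 0 < 1 - ρ := by linarith
  gcongr

theorem exists_summable_bound_cotPi {τ : ℂ} (hτ : 0 < τ.im) :
    ∃ u : ℕ → ℝ, Summable u ∧ ∀ m : ℕ, ∀ z : ℂ,
    |z.im| ≤ 3 / 4 * ((m + 1) * τ.im) →
    ‖cotPi (z + (m + 1 : ℕ) * τ) + Real.pi * I‖ ≤ u m ∧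
    ‖cotPi (z - (m + 1 : ℕ) * τ) - Real.pi * I‖ ≤ u m := by
  refine ⟨fun m ↦ 2 * Real.pi / (1 - Real.exp (-(Real.pi * τ.im / 2))) *
    Real.exp (-(Real.pi * τ.im / 2)) ^ (m + 1), ?_, ?_⟩
  · apply Summable.mul_left
    rw [summable_nat_add_iff 1]
    apply summable_geometric_of_lt_one (Real.exp_pos _).le
    rw [Real.exp_lt_one_iff]; have := mul_pos Real.pi_pos hτ; linarith
  · intro m z hz
    rw [abs_le] at hz
    constructor
    · apply norm_cotPi_add_le hτ (by omega)
      have : (z + (m + 1 : ℕ) * τ).im = z.im + (m + 1) * τ.im := by simp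
      rw [this]; push_cast; linarith [hz.1]
    · have : cotPi (z - (m + 1 : ℕ) * τ) - Real.pi * I =
          -(cotPi ((m + 1 : ℕ) * τ - z) + Real.pi * I) := by
        rw [← neg_sub ((m + 1 : ℕ) * τ) z, cotPi_neg]; ring
      rw [this, norm_neg]
      apply norm_cotPi_add_le hτ (by omega)
      have : ((m + 1 : ℕ) * τ - z).im = (m + 1) * τ.im - z.im := by simp
      rw [this]; push_cast; linarith [hz.2]

theorem eventually_abs_im_le {τ : ℂ} (hτ : 0 < τ.im) (z : ℂ) :
    ∀ᶠ m : ℕ in atTop, |z.im| ≤ 3 / 4 * (((m : ℝ) + 1) * τ.im) := by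
  have : Tendsto (fun m : ℕ ↦ 3 / 4 * (((m : ℝ) + 1) * τ.im)) atTop atTop :=
    Tendsto.const_mul_atTop (by norm_num)
      ((tendsto_natCast_atTop_atTop.atTop_add tendsto_const_nhds).atTop_mul_const hτ)
  exact this.eventually_ge_atTop _

theorem summable_cotPi_pair {τ : ℂ} (hτ : 0 < τ.im) (z : ℂ) :
    Summable fun m : ℕ ↦ cotPi (z + (m + 1 : ℕ) * τ) + cotPi (z - (m + 1 : ℕ) * τ) := by
  obtain ⟨u, hu, hb⟩ := exists_summable_bound_cotPi hτ
  apply Summable.of_norm_bounded_eventually_nat (hu.add hu)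
  filter_upwards [eventually_abs_im_le hτ z] with m hm
  have h := hb m z hm
  calc _ = ‖(cotPi (z + (m + 1 : ℕ) * τ) + Real.pi * I) +
      (cotPi (z - (m + 1 : ℕ) * τ) - Real.pi * I)‖ := by congr 1; ring
    _ ≤ _ := (norm_add_le _ _).trans (add_le_add h.1 h.2)

theorem tendsto_cotPi_add {τ : ℂ} (hτ : 0 < τ.im) (z : ℂ) :
    Tendsto (fun m : ℕ ↦ cotPi (z + (m + 1 : ℕ) * τ)) atTop (𝓝 (-(Real.pi * I))) ∧
    Tendsto (fun m : ℕ ↦ cotPi (z - (m + 1 : ℕ) * τ)) atTop (𝓝 (Real.pi * I)) := by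
  obtain ⟨u, hu, hb⟩ := exists_summable_bound_cotPi hτ
  constructor
  · rw [tendsto_iff_norm_sub_tendsto_zero]
    apply squeeze_zero_norm' _ hu.tendsto_atTop_zero
    filter_upwards [eventually_abs_im_le hτ z] with m hm
    simpa using (hb m z hm).1
  · rw [tendsto_iff_norm_sub_tendsto_zero]
    apply squeeze_zero_norm' _ hu.tendsto_atTop_zero
    filter_upwards [eventually_abs_im_le hτ z] with m hm
    simpa using (hb m z hm).2

theorem cotSum_add_one {τ : ℂ} (z : ℂ) : cotSum τ (z + 1) = cotSum τ z := by
  unfold cotSum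
  simp only [add_right_comm z 1, add_sub_right_comm z 1, cotPi_add_one]

theorem cotSum_neg {τ : ℂ} (z : ℂ) : cotSum τ (-z) = - cotSum τ z := by
  unfold cotSum
  rw [cotPi_neg, neg_add, ← tsum_neg]
  congr 1
  refine tsum_congr fun m ↦ ?_
  rw [show -z + (m + 1 : ℕ) * τ = -(z - (m + 1 : ℕ) * τ) by ring,
    show -z - (m + 1 : ℕ) * τ = -(z + (m + 1 : ℕ) * τ) by ring, cotPi_neg, cotPi_neg]
  ring

theorem tendsto_cotSum {τ : ℂ} (hτ : 0 < τ.im) (z : ℂ) :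
    Tendsto (fun M : ℕ ↦ cotPi z + ∑ m ∈ Finset.range M,
    (cotPi (z + (m + 1 : ℕ) * τ) + cotPi (z - (m + 1 : ℕ) * τ))) atTop (𝓝 (cotSum τ z)) :=
  ((summable_cotPi_pair hτ z).hasSum.tendsto_sum_nat).const_add _

theorem cotSum_add_self {τ : ℂ} (hτ : 0 < τ.im) (z : ℂ) :
    cotSum τ (z + τ) = cotSum τ z - 2 * Real.pi * I := by
  have key : ∀ M : ℕ, (cotPi (z + τ) + ∑ m ∈ Finset.range M,
      (cotPi (z + τ + (m + 1 : ℕ) * τ) + cotPi (z + τ - (m + 1 : ℕ) * τ))) -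
      (cotPi z + ∑ m ∈ Finset.range M,
      (cotPi (z + (m + 1 : ℕ) * τ) + cotPi (z - (m + 1 : ℕ) * τ))) =
      cotPi (z + (M + 1 : ℕ) * τ) - cotPi (z - M * τ) := by
    intro M
    induction M with
    | zero => simp
    | succ M ih =>
      rw [Finset.sum_range_succ, Finset.sum_range_succ]
      have e1 : z + τ + (M + 1 : ℕ) * τ = z + (M + 1 + 1 : ℕ) * τ := by push_cast; ring
      have e2 : z + τ - (M + 1 : ℕ) * τ = z - M * τ := by push_cast; ring
      rw [e1, e2]
      linear_combination ih
  have l1 := (tendsto_cotSum hτ (z + τ)).sub (tendsto_cotSum hτ z)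
  simp only [key] at l1
  have l2 := (tendsto_cotPi_add hτ z).1.sub ((tendsto_cotPi_add hτ (z + τ)).2)
  have e3 : ∀ M : ℕ, z + τ - (M + 1 : ℕ) * τ = z - M * τ := fun M ↦ by push_cast; ring
  simp only [e3] at l2
  linear_combination tendsto_nhds_unique l1 l2

/-- Near the real axis `cotSum` differs from `cotPi` by a holomorphic function. -/
theorem differentiableOn_cotSum_sub {τ : ℂ} (hτ : 0 < τ.im) : DifferentiableOn ℂ
    (fun z ↦ ∑' m : ℕ, (cotPi (z + (m + 1 : ℕ) * τ) + cotPi (z - (m + 1 : ℕ) * τ)))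
    {z | |z.im| < 3 / 4 * τ.im} ∧
    ∀ z : ℂ, |z.im| < 3 / 4 * τ.im →
    HasSum (fun m : ℕ ↦ deriv cotPi (z + (m + 1 : ℕ) * τ) + deriv cotPi (z - (m + 1 : ℕ) * τ))
    (deriv (fun z ↦ ∑' m : ℕ, (cotPi (z + (m + 1 : ℕ) * τ) + cotPi (z - (m + 1 : ℕ) * τ))) z) := by
  obtain ⟨u, hu, hb⟩ := exists_summable_bound_cotPi hτ
  have hopen : IsOpen {z : ℂ | |z.im| < 3 / 4 * τ.im} :=
    isOpen_lt (by fun_prop) (by fun_prop)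
  have hle : ∀ (m : ℕ) (z : ℂ), z ∈ {z : ℂ | |z.im| < 3 / 4 * τ.im} →
      |z.im| ≤ 3 / 4 * ((m + 1) * τ.im) := by
    intro m z hz
    simp only [Set.mem_ofPred_eq] at hz
    have : (0 : ℝ) ≤ m := by positivity
    nlinarith
  have hbd : ∀ (m : ℕ) (z : ℂ), z ∈ {z : ℂ | |z.im| < 3 / 4 * τ.im} →
      ‖cotPi (z + (m + 1 : ℕ) * τ) + cotPi (z - (m + 1 : ℕ) * τ)‖ ≤ u m + u m := by
    intro m z hz
    have h := hb m z (hle m z hz)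
    calc _ = ‖(cotPi (z + (m + 1 : ℕ) * τ) + Real.pi * I) +
        (cotPi (z - (m + 1 : ℕ) * τ) - Real.pi * I)‖ := by congr 1; ring
      _ ≤ _ := (norm_add_le _ _).trans (add_le_add h.1 h.2)
  have hd : ∀ (m : ℕ) (z : ℂ), z ∈ {z : ℂ | |z.im| < 3 / 4 * τ.im} →
      DifferentiableAt ℂ cotPi (z + (m + 1 : ℕ) * τ) ∧
      DifferentiableAt ℂ cotPi (z - (m + 1 : ℕ) * τ) := by
    intro m z hz
    simp only [Set.mem_ofPred_eq, abs_lt] at hz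
    have hm : (0 : ℝ) ≤ m := by positivity
    constructor <;> apply differentiableAt_cotPi <;> apply sin_pi_mul_ne_zero_of_im_ne_zero
    · have : (z + (m + 1 : ℕ) * τ).im = z.im + (m + 1) * τ.im := by simp
      rw [this]; nlinarith
    · have : (z - (m + 1 : ℕ) * τ).im = z.im - (m + 1) * τ.im := by simp
      rw [this]; nlinarith
  have hder : ∀ (m : ℕ) (z : ℂ), z ∈ {z : ℂ | |z.im| < 3 / 4 * τ.im} →
      HasDerivAt (fun z ↦ cotPi (z + (m + 1 : ℕ) * τ) + cotPi (z - (m + 1 : ℕ) * τ))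
      (deriv cotPi (z + (m + 1 : ℕ) * τ) + deriv cotPi (z - (m + 1 : ℕ) * τ)) z := by
    intro m z hz
    exact ((hd m z hz).1.hasDerivAt.comp_add_const z _).add
      ((hd m z hz).2.hasDerivAt.comp_sub_const z _)
  have hdiff : ∀ m : ℕ, DifferentiableOn ℂ
      (fun z ↦ cotPi (z + (m + 1 : ℕ) * τ) + cotPi (z - (m + 1 : ℕ) * τ))
      {z | |z.im| < 3 / 4 * τ.im} :=
    fun m z hz ↦ (hder m z hz).differentiableAt.differentiableWithinAt
  refine ⟨differentiableOn_tsum_of_summable_norm (hu.add hu) hdiff hopen hbd, fun z hz ↦ ?_⟩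
  have := hasSum_deriv_of_summable_norm (hu.add hu) hdiff hopen hbd hz
  simpa only [fun m ↦ (hder m z hz).deriv] using this

end

section

open Complex Filter Topology
open scoped UpperHalfPlane

/-- The pair of periods `(1, τ)`. -/
noncomputable def tauPair (τ : ℍ) : PeriodPair where
  ω₁ := 1
  ω₂ := τ
  indep := by
    rw [LinearIndependent.pair_iff]
    intro s t h
    have him := congrArg Complex.im h
    have ht : t = 0 := by
      simpa [τ.im_ne_zero] using him
    subst ht
    simpa using h

theorem mem_tauPair_lattice {τ : ℍ} {z : ℂ} :
    z ∈ (tauPair τ).lattice ↔ ∃ m n : ℤ, z = m + n * τ := by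
  rw [PeriodPair.mem_lattice]
  simp only [tauPair, mul_one, eq_comm]

theorem notMem_tauPair_lattice_of_im {τ : ℍ} {z : ℂ} (h : ∀ n : ℤ, (z - n * τ).im ≠ 0) :
    z ∉ (tauPair τ).lattice := by
  rw [mem_tauPair_lattice]
  rintro ⟨m, n, rfl⟩
  exact h n (by simp)

theorem deriv_cotPi_of_im_pos {w : ℂ} (h : 0 < w.im) :
    deriv cotPi w = - ∑' n : ℤ, 1 / (w + n) ^ 2 := by
  have hw : w ∈ UpperHalfPlane.upperHalfPlaneSet := h
  have h1 := iteratedDerivWithin_cot_pi_mul_eq_mul_tsum_div_pow le_rfl hw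
  rw [iteratedDerivWithin_one,
    derivWithin_of_isOpen UpperHalfPlane.isOpen_upperHalfPlaneSet hw] at h1
  have e : cotPi = fun x : ℂ ↦ (Real.pi : ℂ) * cot (Real.pi * x) := rfl
  rw [e, h1]
  simp

theorem deriv_cotPi_neg (w : ℂ) : deriv cotPi (-w) = deriv cotPi w := by
  have h : (fun z ↦ cotPi (-z)) = fun z ↦ - cotPi z := funext cotPi_neg
  have h1 := deriv_comp_neg (f := cotPi) w
  rw [h, deriv.fun_neg] at h1
  linear_combination h1

theorem deriv_cotPi_of_im_ne_zero {w : ℂ} (h : w.im ≠ 0) :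
    deriv cotPi w = - ∑' n : ℤ, 1 / (w + n) ^ 2 := by
  rcases lt_or_gt_of_ne h with h | h
  · rw [← deriv_cotPi_neg, deriv_cotPi_of_im_pos (by simpa using h),
      ← (Equiv.neg ℤ).tsum_eq]
    congr 1
    refine tsum_congr fun n ↦ ?_
    rw [← neg_sq]
    simp
    ring
  · exact deriv_cotPi_of_im_pos h

theorem hasSum_weierstrassP_rows {τ : ℍ} {z : ℂ} (h : ∀ n : ℤ, (z - n * τ).im ≠ 0) :
    HasSum (fun n : ℤ ↦ - deriv cotPi (z - n * τ) - EisensteinSeries.e2Summand n τ)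
      ((tauPair τ).weierstrassP z) := by
  have h0 := (tauPair τ).hasSum_weierstrassP z
  rw [← (tauPair τ).latticeEquivProd.symm.toEquiv.hasSum_iff] at h0
  rw [← (Equiv.prodComm ℤ ℤ).hasSum_iff] at h0
  refine h0.prod_fiberwise fun n ↦ ?_
  have hs1 : Summable fun m : ℤ ↦ 1 / (z - n * τ + m) ^ 2 := by
    refine (EisensteinSeries.linear_right_summable (z - n * τ) 1 (k := 2) le_rfl).congr fun m ↦ ?_
    simp
  have hs2 := EisensteinSeries.e2Summand_summable n τ
  have hs1' := hs1.hasSum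
  rw [← (Equiv.neg ℤ).hasSum_iff] at hs1'
  have := hs1'.sub hs2.hasSum
  rw [← neg_eq_iff_eq_neg.2 (deriv_cotPi_of_im_ne_zero (h n))] at this
  rw [EisensteinSeries.e2Summand]
  convert! this using 1
  funext m
  have h1 : ((tauPair τ).latticeEquivProd.symm (m, n) : ℂ) = m + n * τ := by
    rw [PeriodPair.latticeEquiv_symm_apply]; simp [tauPair]
  simp only [Function.comp_apply, Equiv.prodComm_apply, Prod.swap_prod_mk,
    LinearEquiv.coe_toEquiv, Equiv.neg_apply, EisensteinSeries.eisSummand]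
  rw [h1]
  simp only [Int.cast_neg, Matrix.cons_val_zero, Matrix.cons_val_one, zpow_neg, one_div]
  norm_cast
  congr 3
  · push_cast; ring
  · ring

theorem sum_Icc_neg_eq (f : ℤ → ℂ) (M : ℕ) : ∑ m ∈ Finset.Icc (-(M : ℤ)) M, f m =
    f 0 + ∑ m ∈ Finset.range M, (f (m + 1 : ℕ) + f (-(m + 1 : ℕ))) := by
  induction M with
  | zero => simp
  | succ M ih =>
    rw [Finset.sum_range_succ, ← add_assoc, ← ih, Nat.cast_add, Nat.cast_one,
      Finset.Icc_succ_succ, Finset.sum_union (by simp), Finset.sum_pair (by lia)]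
    ring

theorem deriv_cotSum_of_im {τ : ℍ} {z : ℂ} (h0 : 0 < z.im) (h1 : z.im < 3 / 4 * τ.im) :
    deriv (cotSum τ) z = - (tauPair τ).weierstrassP z - EisensteinSeries.G2 τ := by
  have him : ∀ n : ℤ, (z - n * τ).im ≠ 0 := by
    intro n
    have hy := τ.im_pos
    have : (z - n * τ).im = z.im - n * τ.im := by simp
    rw [this]
    intro h
    rcases le_or_gt n 0 with hn | hn
    · have : (n : ℝ) ≤ 0 := by exact_mod_cast hn
      nlinarith
    · have : (1 : ℝ) ≤ n := by exact_mod_cast hn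
      nlinarith
  have hz : |z.im| < 3 / 4 * τ.im := by rwa [abs_of_pos h0]
  have hopen : IsOpen {z : ℂ | |z.im| < 3 / 4 * τ.im} :=
    isOpen_lt (by fun_prop) (by fun_prop)
  obtain ⟨hd, hs⟩ := differentiableOn_cotSum_sub τ.im_pos
  have t1 := ((hs z hz).tendsto_sum_nat).const_add (deriv cotPi z)
  have e : deriv (cotSum τ) z = deriv cotPi z + deriv (fun z ↦ ∑' m : ℕ,
      (cotPi (z + (m + 1 : ℕ) * τ) + cotPi (z - (m + 1 : ℕ) * τ))) z := by
    apply deriv_add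
    · exact differentiableAt_cotPi (sin_pi_mul_ne_zero_of_im_ne_zero h0.ne')
    · exact hd.differentiableAt (hopen.mem_nhds hz)
  have t2 : HasSum (fun n : ℤ ↦ - deriv cotPi (z - n * τ) - EisensteinSeries.e2Summand n τ)
      ((tauPair τ).weierstrassP z) (SummationFilter.symmetricIcc ℤ) :=
    (hasSum_weierstrassP_rows him).mono_left SummationFilter.LeAtTop.le_atTop
  have t3 := (EisensteinSeries.summable_e2Summand_symmetricIcc τ).hasSum
  have t4 := t2.add t3
  simp only [sub_add_cancel] at t4
  rw [SummationFilter.hasSum_symmetricIcc_iff] at t4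
  simp only [sum_Icc_neg_eq] at t4
  have t5 := t4.neg
  rw [e]
  have := tendsto_nhds_unique t1 (t5.congr fun M ↦ ?_)
  · rw [this, EisensteinSeries.G2]; ring
  · simp only [neg_add, ← Finset.sum_neg_distrib, neg_neg]
    simp
    refine Finset.sum_congr rfl fun m _ ↦ ?_
    rw [add_comm, show z - (-1 + -(m : ℂ)) * τ = z + (m + 1) * τ by ring]

theorem cotSum_add_int_mul {τ : ℂ} (hτ : 0 < τ.im) (n : ℤ) (z : ℂ) :
    cotSum τ (z + n * τ) = cotSum τ z - 2 * Real.pi * I * n := by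
  induction n using Int.induction_on generalizing z with
  | zero => simp
  | succ n ih =>
    push_cast at ih ⊢
    rw [show z + ((n : ℂ) + 1) * τ = z + n * τ + τ by ring, cotSum_add_self hτ, ih]
    ring
  | pred n ih =>
    push_cast at ih ⊢
    have := cotSum_add_self hτ (z + (-(n : ℂ) - 1) * τ)
    rw [show z + (-(n : ℂ) - 1) * τ + τ = z + -(n : ℂ) * τ by ring, ih] at this
    linear_combination -this

theorem exists_int_abs_im_sub_le {τ : ℂ} (hτ : 0 < τ.im) (z : ℂ) :
    ∃ n : ℤ, |(z - n * τ).im| ≤ τ.im / 2 := by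
  refine ⟨round (z.im / τ.im), ?_⟩
  have h := abs_sub_round (z.im / τ.im)
  have e : (z - (round (z.im / τ.im) : ℤ) * τ).im =
      (z.im / τ.im - round (z.im / τ.im)) * τ.im := by
    simp; field_simp
  rw [e, abs_mul, abs_of_pos hτ]
  nlinarith

theorem differentiableAt_cotSum {τ : ℍ} {z : ℂ} (hz : z ∉ (tauPair τ).lattice) :
    DifferentiableAt ℂ (cotSum τ) z := by
  obtain ⟨n, hn⟩ := exists_int_abs_im_sub_le τ.im_pos z
  have hopen : IsOpen {z : ℂ | |z.im| < 3 / 4 * τ.im} :=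
    isOpen_lt (by fun_prop) (by fun_prop)
  have hmem : z - n * τ ∈ {z : ℂ | |z.im| < 3 / 4 * τ.im} := by
    have := τ.im_pos
    simp only [Set.mem_ofPred_eq]
    refine hn.trans_lt ?_
    show τ.im / 2 < _
    linarith
  have h1 : DifferentiableAt ℂ (cotSum τ) (z - n * τ) := by
    apply DifferentiableAt.add
    · apply differentiableAt_cotPi
      rw [Complex.sin_ne_zero_iff]
      intro k hk
      apply hz
      rw [mem_tauPair_lattice]
      refine ⟨k, n, ?_⟩
      have hp : (Real.pi : ℂ) ≠ 0 := by exact_mod_cast Real.pi_ne_zero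
      have : z - n * τ = k := by
        apply mul_left_cancel₀ hp; rw [hk]; ring
      linear_combination this
    · exact (differentiableOn_cotSum_sub τ.im_pos).1.differentiableAt (hopen.mem_nhds hmem)
  have e : cotSum τ = fun w ↦ cotSum τ (w - n * τ) - 2 * Real.pi * I * n := by
    funext w
    rw [← cotSum_add_int_mul τ.im_pos]
    congr 1; ring
  rw [e]
  exact (h1.comp z (differentiableAt_id.sub_const _)).sub_const _

theorem hasDerivAt_cotSum {τ : ℍ} {z : ℂ} (hz : z ∉ (tauPair τ).lattice) :
    HasDerivAt (cotSum τ) (- (tauPair τ).weierstrassP z - EisensteinSeries.G2 τ) z := by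
  have hopen : IsOpen ((tauPair τ).lattice : Set ℂ)ᶜ := (tauPair τ).isClosed_lattice.isOpen_compl
  have hcount : ((tauPair τ).lattice : Set ℂ).Countable := by
    have : Countable (tauPair τ).lattice :=
      (tauPair τ).latticeEquivProd.toEquiv.injective.countable
    exact Set.to_countable _
  have hconn : IsPreconnected ((tauPair τ).lattice : Set ℂ)ᶜ :=
    (hcount.isConnected_compl_of_one_lt_rank
      (by rw [← Module.finrank_eq_rank, Complex.finrank_real_complex]; norm_num)).isPreconnected
  have h1 : AnalyticOnNhd ℂ (deriv (cotSum τ)) ((tauPair τ).lattice : Set ℂ)ᶜ := by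
    apply AnalyticOnNhd.deriv
    apply DifferentiableOn.analyticOnNhd _ hopen
    exact fun w hw ↦ (differentiableAt_cotSum hw).differentiableWithinAt
  have h2 : AnalyticOnNhd ℂ (fun z ↦ - (tauPair τ).weierstrassP z - EisensteinSeries.G2 τ)
      ((tauPair τ).lattice : Set ℂ)ᶜ :=
    (tauPair τ).analyticOnNhd_weierstrassP.neg.sub analyticOnNhd_const
  have hy := τ.im_pos
  have hV : IsOpen {w : ℂ | 0 < w.im ∧ w.im < 3 / 4 * τ.im} := by
    have a : IsOpen {w : ℂ | 0 < w.im} := isOpen_lt (by fun_prop) (by fun_prop)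
    have b : IsOpen {w : ℂ | w.im < 3 / 4 * τ.im} := isOpen_lt (by fun_prop) (by fun_prop)
    exact a.inter b
  have hmem : (τ.im / 2 : ℝ) * I ∈ {w : ℂ | 0 < w.im ∧ w.im < 3 / 4 * τ.im} := by
    simp; constructor <;> linarith
  have hnot : (τ.im / 2 : ℝ) * I ∈ ((tauPair τ).lattice : Set ℂ)ᶜ := by
    apply notMem_tauPair_lattice_of_im
    intro n
    simp
    intro h
    have h2 : (2 * n : ℝ) = 1 := by
      apply mul_right_cancel₀ hy.ne'
      linarith
    norm_cast at h2
    omega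
  have := h1.eqOn_of_preconnected_of_eventuallyEq h2 hconn hnot (by
    filter_upwards [hV.mem_nhds hmem] with w hw using deriv_cotSum_of_im hw.1 hw.2) hz
  simp only at this
  rw [← this]
  exact (differentiableAt_cotSum hz).hasDerivAt

theorem cotSum_pole {τ : ℂ} (hτ : 0 < τ.im) : ∃ g : ℂ → ℂ, AnalyticAt ℂ g 0 ∧
    ∀ᶠ z in 𝓝[≠] 0, cotSum τ z * sin (Real.pi * z) = g z := by
  have hopen : IsOpen {z : ℂ | |z.im| < 3 / 4 * τ.im} :=
    isOpen_lt (by fun_prop) (by fun_prop)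
  have h0 : (0 : ℂ) ∈ {z : ℂ | |z.im| < 3 / 4 * τ.im} := by simpa using hτ
  have han := (differentiableOn_cotSum_sub hτ).1.analyticAt (hopen.mem_nhds h0)
  refine ⟨fun z ↦ Real.pi * cos (Real.pi * z) + (∑' m : ℕ, (cotPi (z + (m + 1 : ℕ) * τ) +
    cotPi (z - (m + 1 : ℕ) * τ))) * sin (Real.pi * z), ?_, ?_⟩
  · refine AnalyticAt.add (by fun_prop) (han.mul (by fun_prop))
  · have : ∀ᶠ z in 𝓝[≠] (0 : ℂ), sin (Real.pi * z) ≠ 0 := by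
      have h := (Complex.hasDerivAt_sin ((Real.pi : ℂ) * 0)).comp (0 : ℂ)
        ((hasDerivAt_id (0 : ℂ)).const_mul (Real.pi : ℂ))
      have := h.eventually_ne (c := 0) (by simp [Real.pi_ne_zero])
      simpa [Function.comp_def] using! this
    filter_upwards [this] with z hz
    rw [cotSum, add_mul, cotPi, cot]
    congr 1
    field_simp

end

section

open Complex Filter Topology

/-- The function obtained from `f` by removing all its removable singularities. -/
theorem exists_analytic_extension (f : ℂ → ℂ) :
    ∃ F : ℂ → ℂ, ∀ z g, AnalyticAt ℂ g z → f =ᶠ[𝓝[≠] z] g → F =ᶠ[𝓝 z] g := by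
  refine ⟨fun z ↦ limUnder (𝓝[≠] z) f, fun z g hg hfg ↦ ?_⟩
  have key : ∀ w, ContinuousAt g w → f =ᶠ[𝓝[≠] w] g → limUnder (𝓝[≠] w) f = g w := by
    intro w hw hfw
    apply Tendsto.limUnder_eq
    exact (hw.tendsto.mono_left nhdsWithin_le_nhds).congr' hfw.symm
  have h1 : ∀ᶠ w in 𝓝[≠] z, f =ᶠ[𝓝[≠] w] g := by
    filter_upwards [eventually_eventually_nhdsWithin.2 hfg, self_mem_nhdsWithin] with w hw hwz
    have hne : ({z}ᶜ : Set ℂ) ∈ 𝓝 w := isOpen_compl_singleton.mem_nhds hwz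
    rw [nhdsWithin_eq_nhds.2 hne] at hw
    exact hw.filter_mono nhdsWithin_le_nhds
  have h2 : ∀ᶠ w in 𝓝 z, w = z ∨ f =ᶠ[𝓝[≠] w] g := by
    rw [eventually_nhdsWithin_iff] at h1
    filter_upwards [h1] with w hw
    by_cases hwz : w = z
    · exact Or.inl hwz
    · exact Or.inr (hw hwz)
  filter_upwards [h2, hg.eventually_analyticAt] with w hw hgw
  rcases hw with rfl | hw
  · exact key _ hg.continuousAt hfg
  · exact key _ hgw.continuousAt hw

/-- `P` is elliptic and `H` quasi-elliptic with respect to the lattice `ℤ + ℤ τ`, with poles of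
order at most two and one respectively, on the lattice only. -/
structure QuasiElliptic (τ κ : ℂ) (P H : ℂ → ℂ) : Prop where
  im_pos : 0 < τ.im
  analyticAt_P : ∀ z, (∀ m n : ℤ, z ≠ m + n * τ) → AnalyticAt ℂ P z
  analyticAt_H : ∀ z, (∀ m n : ℤ, z ≠ m + n * τ) → AnalyticAt ℂ H z
  P_add_one : ∀ z, P (z + 1) = P z
  P_add_tau : ∀ z, P (z + τ) = P z
  H_add_one : ∀ z, H (z + 1) = H z
  H_add_tau : ∀ z, H (z + τ) = H z + κ
  pole_P : ∃ g : ℂ → ℂ, AnalyticAt ℂ g 0 ∧ ∀ᶠ z in 𝓝[≠] 0, P z * sin (Real.pi * z) ^ 2 = g z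
  pole_H : ∃ g : ℂ → ℂ, AnalyticAt ℂ g 0 ∧ ∀ᶠ z in 𝓝[≠] 0, H z * sin (Real.pi * z) = g z

theorem apply_add_int_mul {f : ℂ → ℂ} {ω κ : ℂ} (h : ∀ z, f (z + ω) = f z + κ) (n : ℤ) (z : ℂ) :
    f (z + n * ω) = f z + n * κ := by
  induction n using Int.induction_on generalizing z with
  | zero => simp
  | succ n ih =>
    push_cast at ih ⊢
    rw [show z + ((n : ℂ) + 1) * ω = z + n * ω + ω by ring, h, ih]
    ring
  | pred n ih =>
    push_cast at ih ⊢
    have := h (z + (-(n : ℂ) - 1) * ω)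
    rw [show z + (-(n : ℂ) - 1) * ω + ω = z + -(n : ℂ) * ω by ring, ih] at this
    linear_combination -this

namespace QuasiElliptic

variable {τ κ : ℂ} {P H : ℂ → ℂ}

theorem P_add (h : QuasiElliptic τ κ P H) (z : ℂ) (m n : ℤ) : P (z + (m + n * τ)) = P z := by
  have h1 := apply_add_int_mul (f := P) (ω := 1) (κ := 0) (by simp [h.P_add_one]) m (z + n * τ)
  have h2 := apply_add_int_mul (f := P) (ω := τ) (κ := 0) (by simp [h.P_add_tau]) n z
  rw [h2] at h1
  rw [show z + (m + n * τ) = z + n * τ + m * 1 by ring, h1]; ring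

theorem H_add (h : QuasiElliptic τ κ P H) (z : ℂ) (m n : ℤ) :
    H (z + (m + n * τ)) = H z + n * κ := by
  have h1 := apply_add_int_mul (f := H) (ω := 1) (κ := 0) (by simp [h.H_add_one]) m (z + n * τ)
  have h2 := apply_add_int_mul (f := H) (ω := τ) (κ := κ) h.H_add_tau n z
  rw [h2] at h1
  rw [show z + (m + n * τ) = z + n * τ + m * 1 by ring, h1]; ring

theorem ne_of_im (h : QuasiElliptic τ κ P H) {z : ℂ} {N : ℤ}
    (hz : N * τ.im < z.im) (hz' : z.im < (N + 1) * τ.im) (m n : ℤ) : z ≠ m + n * τ := by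
  rintro rfl
  have := h.im_pos
  simp at hz hz'
  have h1 : (N : ℝ) < n := lt_of_mul_lt_mul_right hz this.le
  have h2 : (n : ℝ) < N + 1 := lt_of_mul_lt_mul_right hz' this.le
  norm_cast at h1 h2
  omega

/-- Uniform bounds on the horizontal lines halfway between the rows of poles. -/
theorem exists_bound_on_line (h : QuasiElliptic τ κ P H) : ∃ C : ℝ, 1 ≤ C ∧ ∀ (z : ℂ) (N : ℤ),
    z.im = (N + 1 / 2) * τ.im → ‖P z‖ ≤ C ∧ ‖H z‖ ≤ C * (|(N : ℝ)| + 1) := by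
  have hy := h.im_pos
  set γ : ℝ → ℂ := fun x ↦ x + (1 / 2) * τ with hγ
  have hγim : ∀ x, (γ x).im = τ.im / 2 := by intro x; simp [hγ]; ring
  have hγc : Continuous γ := by fun_prop
  have hoff : ∀ x, ∀ m n : ℤ, γ x ≠ m + n * τ := by
    intro x
    apply h.ne_of_im (N := 0) <;> rw [hγim] <;> simp <;> linarith
  have hP : Continuous fun x ↦ P (γ x) := by
    rw [continuous_iff_continuousAt]
    exact fun x ↦ (h.analyticAt_P _ (hoff x)).continuousAt.comp hγc.continuousAt
  have hH : Continuous fun x ↦ H (γ x) := by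
    rw [continuous_iff_continuousAt]
    exact fun x ↦ (h.analyticAt_H _ (hoff x)).continuousAt.comp hγc.continuousAt
  obtain ⟨C1, hC1⟩ := (isCompact_Icc (a := (0 : ℝ)) (b := 1)).exists_bound_of_continuousOn
    hP.continuousOn
  obtain ⟨C2, hC2⟩ := (isCompact_Icc (a := (0 : ℝ)) (b := 1)).exists_bound_of_continuousOn
    hH.continuousOn
  refine ⟨max 1 (max C1 (max C2 ‖κ‖)), le_max_left _ _, fun z N hz ↦ ?_⟩
  set C := max 1 (max C1 (max C2 ‖κ‖)) with hC
  have c1 : C1 ≤ C := by simp [hC]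
  have c2 : C2 ≤ C := by simp [hC]
  have c3 : ‖κ‖ ≤ C := by simp [hC]
  set u : ℝ := (z - (1 / 2) * τ - N * τ).re with hu
  have hzu : z = γ (Int.fract u) + ((⌊u⌋ : ℤ) + N * τ) := by
    have : ((Int.fract u : ℝ) : ℂ) = u - (⌊u⌋ : ℤ) := by
      rw [← Int.self_sub_floor]; push_cast; rfl
    rw [hγ]
    simp only [this]
    have hu2 : (u : ℂ) = z - (1 / 2) * τ - N * τ := by
      apply Complex.ext
      · rw [hu]; simp
      · simp [hz]; ring
    rw [hu2]; ring
  have hmem : Int.fract u ∈ Set.Icc (0 : ℝ) 1 := ⟨Int.fract_nonneg _, (Int.fract_lt_one _).le⟩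
  constructor
  · rw [hzu, h.P_add]
    exact (hC1 _ hmem).trans c1
  · rw [hzu, h.H_add]
    refine (norm_add_le _ _).trans ?_
    rw [norm_mul]
    have e : ‖(N : ℂ)‖ = |(N : ℝ)| := by rw [Complex.norm_intCast]
    rw [e]
    have := hC2 _ hmem
    have h3 := mul_le_mul_of_nonneg_left c3 (abs_nonneg (N : ℝ))
    linarith

end QuasiElliptic

end

section

open Complex Filter Topology

theorem norm_le_of_norm_le_on_strip {f : ℂ → ℂ} {b B : ℝ} (hb : 0 < b)
    (hf : ∀ z : ℂ, |z.im| ≤ b → ∃ g : ℂ → ℂ, AnalyticAt ℂ g z ∧ f =ᶠ[𝓝[≠] z] g)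
    (hper : ∀ z, f (z + 2) = f z)
    (hbd : ∀ z : ℂ, |z.im| = b → ContinuousAt f z ∧ ‖f z‖ ≤ B)
    {z₀ : ℂ} (hz₀ : |z₀.im| ≤ b) {g : ℂ → ℂ} (hg : AnalyticAt ℂ g z₀) (hfg : f =ᶠ[𝓝[≠] z₀] g) :
    ‖g z₀‖ ≤ B := by
  obtain ⟨F, hF⟩ := exists_analytic_extension f
  have hFan : ∀ z : ℂ, |z.im| ≤ b → AnalyticAt ℂ F z := by
    intro z hz
    obtain ⟨g, hg, hfg⟩ := hf z hz
    exact hg.congr (hF z g hg hfg).symm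
  have hFper : ∀ z : ℂ, |z.im| ≤ b → F (z + 2) = F z := by
    intro z hz
    obtain ⟨g, hg, hfg⟩ := hf (z + 2) (by simpa using hz)
    have h1 := (hF _ g hg hfg).self_of_nhds
    have h2 : f =ᶠ[𝓝[≠] z] fun w ↦ g (w + 2) := by
      have ht : Tendsto (fun w : ℂ ↦ w + 2) (𝓝[≠] z) (𝓝[≠] (z + 2)) := by
        apply tendsto_nhdsWithin_of_tendsto_nhds_of_eventually_within
        · exact ((continuous_id.add continuous_const).tendsto z).mono_left nhdsWithin_le_nhds
        · filter_upwards [self_mem_nhdsWithin] with w hw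
          simpa using hw
      filter_upwards [ht.eventually hfg] with w hw
      rw [← hw, hper]
    have h3 : AnalyticAt ℂ (fun w ↦ g (w + 2)) z := by
      apply AnalyticAt.comp (f := fun w : ℂ ↦ w + 2) hg
      fun_prop
    rw [h1, (hF _ _ h3 h2).self_of_nhds]
  have hFbd : ∀ z : ℂ, |z.im| = b → ‖F z‖ ≤ B := by
    intro z hz
    obtain ⟨hc, hB⟩ := hbd z hz
    obtain ⟨g, hg, hfg⟩ := hf z hz.le
    have h1 : F z = g z := (hF z g hg hfg).self_of_nhds
    have h2 : f z = g z := by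
      refine tendsto_nhds_unique_of_eventuallyEq (hc.tendsto.mono_left nhdsWithin_le_nhds)
        (hg.continuousAt.tendsto.mono_left nhdsWithin_le_nhds) hfg
    rwa [h1, ← h2]
  have hbound : ∃ C, ∀ z : ℂ, |z.im| ≤ b → ‖F z‖ ≤ C := by
    have hK : IsCompact (Set.Icc (0 : ℝ) 2 ×ℂ Set.Icc (-b) b) :=
      isCompact_Icc.reProdIm isCompact_Icc
    obtain ⟨C, hC⟩ := hK.exists_bound_of_continuousOn (f := F) (fun z hz ↦
      (hFan z (abs_le.2 hz.2)).continuousAt.continuousWithinAt)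
    refine ⟨C, fun z hz ↦ ?_⟩
    have hshift : ∀ n : ℤ, F (z + n * 2) = F z := by
      intro n
      induction n using Int.induction_on with
      | zero => simp
      | succ n ih =>
        rw [← ih, ← hFper (z + ((n : ℤ) : ℂ) * 2) (by simpa using hz)]; congr 1; push_cast; ring
      | pred n ih =>
        rw [← ih, ← hFper (z + ((-n - 1 : ℤ) : ℂ) * 2) (by simpa using hz)]
        congr 1; push_cast; ring
    rw [← hshift (-⌊z.re / 2⌋)]
    apply hC
    rw [mem_reProdIm]
    constructor
    · have h1 := Int.floor_le (z.re / 2)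
      have h2 := Int.lt_floor_add_one (z.re / 2)
      simp
      constructor <;> linarith
    · simpa using abs_le.1 hz
  obtain ⟨C, hC⟩ := hbound
  rw [← (hF z₀ g hg hfg).self_of_nhds]
  have hcl : closure (Complex.im ⁻¹' Set.Ioo (-b) b) ⊆ {z : ℂ | |z.im| ≤ b} := by
    apply closure_minimal
    · intro z hz
      exact abs_le.2 ⟨hz.1.le, hz.2.le⟩
    · exact isClosed_le (continuous_abs.comp continuous_im) continuous_const
  refine PhragmenLindelof.horizontal_strip (a := -b) (b := b) ?_ ⟨0, ?_, 0, ?_⟩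
    (fun z hz ↦ hFbd z (by rw [hz, abs_neg, abs_of_pos hb]))
    (fun z hz ↦ hFbd z (by rw [hz, abs_of_pos hb])) (abs_le.1 hz₀).1 (abs_le.1 hz₀).2
  · refine DifferentiableOn.diffContOnCl fun z hz ↦ ?_
    exact (hFan z (hcl hz)).differentiableAt.differentiableWithinAt
  · have := Real.pi_pos
    have : 0 < b - -b := by linarith
    positivity
  · apply Asymptotics.IsBigO.of_bound C
    filter_upwards [mem_inf_of_right (mem_principal_self _)] with z hz
    simpa using hC z (abs_le.2 ⟨hz.1.le, hz.2.le⟩)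

theorem exists_eventually_eq_sub_pow_mul {f : ℂ → ℂ} {z₀ : ℂ} (hf : AnalyticAt ℂ f z₀) {t : ℕ}
    (h : ∀ s < t, iteratedDeriv s f z₀ = 0) : ∃ g : ℂ → ℂ, AnalyticAt ℂ g z₀ ∧
      (∀ᶠ z in 𝓝 z₀, f z = (z - z₀) ^ t * g z) ∧ iteratedDeriv t f z₀ = t.factorial * g z₀ := by
  have hf' : AnalyticAt ℂ (fun z ↦ f (z₀ + z)) 0 := by
    apply AnalyticAt.comp (f := fun w : ℂ ↦ z₀ + w) (by simpa using hf)
    fun_prop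
  obtain ⟨F, hF, hFe⟩ := hf'.exists_eventuallyEq_sum_add_pow_mul (t + 1)
  have hFz : AnalyticAt ℂ (fun z ↦ F (z - z₀)) z₀ := by
    apply AnalyticAt.comp (f := fun w : ℂ ↦ w - z₀) (by simpa using hF)
    fun_prop
  refine ⟨fun z ↦ iteratedDeriv t f z₀ / t.factorial + (z - z₀) * F (z - z₀),
    analyticAt_const.add ((analyticAt_id.sub analyticAt_const).mul hFz), ?_, ?_⟩
  · have ht : Tendsto (fun z : ℂ ↦ z - z₀) (𝓝 z₀) (𝓝 0) := by
      have : Continuous fun z : ℂ ↦ z - z₀ := by fun_prop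
      simpa using this.tendsto z₀
    filter_upwards [ht.eventually hFe] with z hz
    simp only [add_sub_cancel, iteratedDeriv_comp_const_add, add_zero, smul_eq_mul] at hz
    rw [hz, Finset.sum_range_succ, Finset.sum_eq_zero]
    · ring
    · intro s hs
      rw [h s (Finset.mem_range.1 hs), mul_zero]
  · have : (t.factorial : ℂ) ≠ 0 := by exact_mod_cast t.factorial_ne_zero
    simp
    field_simp

end

section

open Complex Filter Topology

theorem Complex.norm_sin_le_exp (w : ℂ) : ‖sin w‖ ≤ Real.exp |w.im| := by
  have h1 : Complex.sin w = (exp (-w * I) - exp (w * I)) * I / 2 := rfl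
  rw [h1, norm_div, norm_mul, norm_I, mul_one]
  have h2 : ‖exp (-w * I)‖ = Real.exp w.im := by rw [norm_exp]; simp
  have h3 : ‖exp (w * I)‖ = Real.exp (-w.im) := by rw [norm_exp]; simp
  have := norm_sub_le (exp (-w * I)) (exp (w * I))
  rw [h2, h3] at this
  have h4 : Real.exp w.im ≤ Real.exp |w.im| := Real.exp_le_exp.2 (le_abs_self _)
  have h5 : Real.exp (-w.im) ≤ Real.exp |w.im| := Real.exp_le_exp.2 (neg_le_abs _)
  rw [show ‖(2 : ℂ)‖ = 2 by norm_num]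
  linarith

theorem Complex.sinh_abs_im_le_norm_cos (w : ℂ) : Real.sinh |w.im| ≤ ‖cos w‖ := by
  have h1 : Complex.cos w = (exp (w * I) + exp (-w * I)) / 2 := rfl
  rw [h1, norm_div]
  have h2 : ‖exp (-w * I)‖ = Real.exp w.im := by rw [norm_exp]; simp
  have h3 : ‖exp (w * I)‖ = Real.exp (-w.im) := by rw [norm_exp]; simp
  have := abs_norm_sub_norm_le (exp (w * I)) (-exp (-w * I))
  rw [norm_neg, h2, h3, sub_neg_eq_add] at this
  rw [Real.sinh_eq]
  rw [show ‖(2 : ℂ)‖ = 2 by norm_num]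
  gcongr
  refine le_trans ?_ this
  rcases abs_cases w.im with ⟨h, _⟩ | ⟨h, _⟩ <;> rw [h]
  · rw [abs_sub_comm]; exact le_abs_self _
  · rw [neg_neg]; exact le_abs_self _

theorem Real.exp_mul_sinh_le {x y : ℝ} (hx : 0 ≤ x) :
    Real.exp x * Real.sinh y ≤ Real.sinh (x + y) := by
  rw [Real.sinh_eq, Real.sinh_eq]
  have h1 := Real.exp_add x y
  have h2 := Real.exp_add (-x) (-y)
  have h3 : Real.exp (-x) ≤ Real.exp x := Real.exp_le_exp.2 (by linarith)
  have h4 := mul_le_mul_of_nonneg_right h3 (Real.exp_pos (-y)).le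
  rw [neg_add, h1, h2]
  linarith

/-- A product of sines vanishing on the rows `-N, …, N` of the lattice `ℤ + ℤ τ`. -/
noncomputable def rowSin (τ : ℂ) (N : ℕ) (z : ℂ) : ℂ :=
  ∏ m ∈ Finset.Icc (-(N : ℤ)) N, sin (Real.pi * (z - m * τ))

theorem analyticAt_rowSin (τ : ℂ) (N : ℕ) (z : ℂ) : AnalyticAt ℂ (rowSin τ N) z := by
  have : AnalyticAt ℂ (fun z : ℂ ↦ ∏ m ∈ Finset.Icc (-(N : ℤ)) N,
      sin (Real.pi * (z - m * τ))) z :=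
    Finset.analyticAt_fun_prod _ fun m _ ↦ by fun_prop
  exact this

theorem card_Icc_neg (N : ℕ) : (Finset.Icc (-(N : ℤ)) N).card = 2 * N + 1 := by
  simp; omega

theorem norm_rowSin_le {τ : ℂ} (hτ : 0 < τ.im) (N : ℕ) {z : ℂ} (hz : |z.im| ≤ (N + 1 / 2) * τ.im) :
    ‖rowSin τ N z‖ ≤ Real.exp (Real.pi * τ.im) ^ ((2 * N + 1) ^ 2) := by
  rw [rowSin, norm_prod]
  calc _ ≤ ∏ m ∈ Finset.Icc (-(N : ℤ)) N, Real.exp (Real.pi * τ.im) ^ (2 * N + 1) := by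
        refine Finset.prod_le_prod (fun _ _ ↦ norm_nonneg _) fun m hm ↦ ?_
        refine (norm_sin_le_exp _).trans ?_
        rw [← Real.exp_nat_mul]
        apply Real.exp_le_exp.2
        have hm' : |(m : ℝ)| ≤ N := by
          rw [Finset.mem_Icc] at hm
          rw [abs_le]
          exact ⟨by exact_mod_cast hm.1, by exact_mod_cast hm.2⟩
        have h1 : (Real.pi * (z - m * τ)).im = Real.pi * (z.im - m * τ.im) := by simp
        rw [h1, abs_mul, abs_of_pos Real.pi_pos]
        have h2 := abs_sub z.im (m * τ.im)
        rw [abs_mul, abs_of_pos hτ] at h2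
        have h3 := mul_le_mul_of_nonneg_right hm' hτ.le
        push_cast
        have : |z.im - m * τ.im| ≤ (2 * N + 1) * τ.im := by linarith
        nlinarith [Real.pi_pos]
    _ = _ := by
        rw [Finset.prod_const, card_Icc_neg, ← pow_mul, sq]

theorem le_norm_rowSin_half {τ : ℂ} (hτ : 0 < τ.im) (N : ℕ) :
    (min 1 (Real.sinh (Real.pi * τ.im))) ^ (2 * N + 1) ≤ ‖rowSin τ N (1 / 2)‖ := by
  rw [rowSin, norm_prod, ← card_Icc_neg, ← Finset.prod_const]
  have hpos : 0 < Real.pi * τ.im := mul_pos Real.pi_pos hτ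
  refine Finset.prod_le_prod (fun _ _ ↦ ?_) fun m hm ↦ ?_
  · have := Real.sinh_pos_iff.2 hpos
    positivity
  · have h1 : (Real.pi : ℂ) * (1 / 2 - m * τ) = Real.pi / 2 - Real.pi * m * τ := by ring
    rw [h1, sin_pi_div_two_sub]
    rcases eq_or_ne m 0 with rfl | hm0
    · simp
    · refine (min_le_right _ _).trans (le_trans ?_ (sinh_abs_im_le_norm_cos _))
      rw [Real.sinh_le_sinh]
      have h2 : (Real.pi * m * τ : ℂ).im = Real.pi * τ.im * m := by
        have : (Real.pi * m * τ : ℂ) = ((Real.pi * m : ℝ) : ℂ) * τ := by push_cast; ring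
        rw [this, im_ofReal_mul]; ring
      rw [h2, abs_mul, abs_of_pos hpos]
      have : (1 : ℝ) ≤ |(m : ℝ)| := by exact_mod_cast Int.one_le_abs hm0
      nlinarith

theorem rowSin_add_two (τ : ℂ) (N : ℕ) (z : ℂ) : rowSin τ N (z + 2) = rowSin τ N z := by
  refine Finset.prod_congr rfl fun m _ ↦ ?_
  rw [← sin_add_two_pi (Real.pi * (z - m * τ))]
  congr 1
  ring

/-- Near a lattice point of the rows `-N, …, N`, the function `rowSin` is divisible by a sine. -/
theorem rowSin_eq_mul (τ : ℂ) (N : ℕ) {m₀ n₀ : ℤ} (hn : n₀ ∈ Finset.Icc (-(N : ℤ)) N) :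
    ∃ R : ℂ → ℂ, (∀ z, AnalyticAt ℂ R z) ∧
      ∀ z, rowSin τ N z = sin (Real.pi * (z - (m₀ + n₀ * τ))) * R z := by
  refine ⟨fun z ↦ (-1) ^ m₀ * ∏ m ∈ (Finset.Icc (-(N : ℤ)) N).erase n₀,
    sin (Real.pi * (z - m * τ)), fun z ↦ ?_, fun z ↦ ?_⟩
  · exact analyticAt_const.mul (Finset.analyticAt_fun_prod _ fun m _ ↦ by fun_prop)
  · rw [rowSin, ← Finset.mul_prod_erase _ _ hn]
    have : (Real.pi : ℂ) * (z - n₀ * τ) = Real.pi * (z - (m₀ + n₀ * τ)) + m₀ * Real.pi := by ring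
    rw [this, Complex.sin_antiperiodic.add_int_mul_eq m₀, Int.cast_negOnePow]
    ring

end

section

open Complex Filter Topology

/-- The auxiliary function `∑ aᵢⱼ Pⁱ Hʲ`. -/
noncomputable def auxFun (P H : ℂ → ℂ) (n : ℕ) (a : ℕ → ℕ → ℂ) (z : ℂ) : ℂ :=
  ∑ i ∈ Finset.range n, ∑ j ∈ Finset.range n, a i j * (P z ^ i * H z ^ j)

theorem norm_auxFun_le {P H : ℂ → ℂ} {n : ℕ} {a : ℕ → ℕ → ℂ} {M C D : ℝ} {z : ℂ}
    (ha : ∀ i j, ‖a i j‖ ≤ M) (hC : 1 ≤ C) (hD : 1 ≤ D) (hP : ‖P z‖ ≤ C) (hH : ‖H z‖ ≤ D) :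
    ‖auxFun P H n a z‖ ≤ n ^ 2 * M * (C ^ n * D ^ n) := by
  have hM : 0 ≤ M := (norm_nonneg _).trans (ha 0 0)
  have : ∀ i ∈ Finset.range n, ∀ j ∈ Finset.range n,
      ‖a i j * (P z ^ i * H z ^ j)‖ ≤ M * (C ^ n * D ^ n) := by
    intro i hi j hj
    rw [norm_mul, norm_mul, norm_pow, norm_pow]
    have hi := (Finset.mem_range.1 hi).le
    have hj := (Finset.mem_range.1 hj).le
    have h1 : ‖P z‖ ^ i ≤ C ^ n := (pow_le_pow_left₀ (norm_nonneg _) hP _).trans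
      (pow_le_pow_right₀ hC hi)
    have h2 : ‖H z‖ ^ j ≤ D ^ n := (pow_le_pow_left₀ (norm_nonneg _) hH _).trans
      (pow_le_pow_right₀ hD hj)
    have := ha i j
    gcongr
  calc _ ≤ ∑ i ∈ Finset.range n, ∑ j ∈ Finset.range n, M * (C ^ n * D ^ n) := by
        refine norm_sum_le_of_le _ fun i hi ↦ norm_sum_le_of_le _ fun j hj ↦ this i hi j hj
    _ = _ := by simp; ring

namespace QuasiElliptic

theorem analyticAt_auxFun {τ κ : ℂ} {P H : ℂ → ℂ} (h : QuasiElliptic τ κ P H) (n : ℕ)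
    (a : ℕ → ℕ → ℂ) {z : ℂ} (hz : ∀ m n : ℤ, z ≠ m + n * τ) :
    AnalyticAt ℂ (auxFun P H n a) z := by
  have h1 := h.analyticAt_P z hz
  have h2 := h.analyticAt_H z hz
  refine Finset.analyticAt_fun_sum _ fun i _ ↦ Finset.analyticAt_fun_sum _ fun j _ ↦ ?_
  exact analyticAt_const.mul ((h1.pow i).mul (h2.pow j))

theorem auxFun_add_int {τ κ : ℂ} {P H : ℂ → ℂ} (h : QuasiElliptic τ κ P H) (n : ℕ)
    (a : ℕ → ℕ → ℂ) (z : ℂ) (m : ℤ) : auxFun P H n a (z + m) = auxFun P H n a z := by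
  have h1 := h.P_add z m 0
  have h2 := h.H_add z m 0
  simp only [Int.cast_zero, zero_mul, add_zero] at h1 h2
  simp only [auxFun, h1, h2]

theorem tendsto_sub_nhdsNE (z₀ w : ℂ) :
    Tendsto (fun z : ℂ ↦ z - w) (𝓝[≠] z₀) (𝓝[≠] (z₀ - w)) := by
  apply tendsto_nhdsWithin_of_tendsto_nhds_of_eventually_within
  · exact ((continuous_id.sub continuous_const).tendsto z₀).mono_left nhdsWithin_le_nhds
  · filter_upwards [self_mem_nhdsWithin] with z hz
    simpa using hz

theorem exists_analyticAt_eq_auxFun_mul {τ κ : ℂ} {P H : ℂ → ℂ} (h : QuasiElliptic τ κ P H)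
    (n N : ℕ) (a : ℕ → ℕ → ℂ) {z₀ : ℂ} (hz₀ : |z₀.im| < (N + 1) * τ.im) :
    ∃ g : ℂ → ℂ, AnalyticAt ℂ g z₀ ∧
      (fun z ↦ auxFun P H n a z * rowSin τ N z ^ (3 * n)) =ᶠ[𝓝[≠] z₀] g := by
  by_cases hlat : ∀ m n : ℤ, z₀ ≠ m + n * τ
  · exact ⟨_, (h.analyticAt_auxFun n a hlat).mul ((analyticAt_rowSin τ N z₀).pow _), .rfl⟩
  push Not at hlat
  obtain ⟨m₀, n₀, hz⟩ := hlat
  have hn₀ : n₀ ∈ Finset.Icc (-(N : ℤ)) N := by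
    have h1 : z₀.im = n₀ * τ.im := by rw [hz]; simp
    rw [h1, abs_mul, abs_of_pos h.im_pos] at hz₀
    have h2 := lt_of_mul_lt_mul_right hz₀ h.im_pos.le
    have h3 : |n₀| < N + 1 := by exact_mod_cast h2
    rw [abs_lt] at h3
    rw [Finset.mem_Icc]
    omega
  obtain ⟨R, hR, hQ⟩ := rowSin_eq_mul τ N (m₀ := m₀) hn₀
  rw [← hz] at hQ
  obtain ⟨gP, hgP, hP⟩ := h.pole_P
  obtain ⟨gH, hgH, hH⟩ := h.pole_H
  have hcomp : ∀ g : ℂ → ℂ, AnalyticAt ℂ g 0 → AnalyticAt ℂ (fun z ↦ g (z - z₀)) z₀ := by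
    intro g hg
    apply AnalyticAt.comp (f := fun w : ℂ ↦ w - z₀) (by simpa using hg)
    fun_prop
  have hS : AnalyticAt ℂ (fun z ↦ sin (Real.pi * (z - z₀))) z₀ := by fun_prop
  refine ⟨fun z ↦ ∑ i ∈ Finset.range n, ∑ j ∈ Finset.range n, a i j * (gP (z - z₀) ^ i *
    (gH (z - z₀) + n₀ * κ * sin (Real.pi * (z - z₀))) ^ j *
    sin (Real.pi * (z - z₀)) ^ (3 * n - 2 * i - j) * R z ^ (3 * n)), ?_, ?_⟩
  · refine Finset.analyticAt_fun_sum _ fun i _ ↦ Finset.analyticAt_fun_sum _ fun j _ ↦ ?_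
    exact analyticAt_const.mul (((((hcomp _ hgP).pow i).mul
      (((hcomp _ hgH).add (analyticAt_const.mul hS)).pow j)).mul (hS.pow _)).mul ((hR z₀).pow _))
  · have ht := tendsto_sub_nhdsNE z₀ z₀
    rw [sub_self] at ht
    filter_upwards [ht.eventually hP, ht.eventually hH] with z hPz hHz
    rw [auxFun, Finset.sum_mul]
    refine Finset.sum_congr rfl fun i hi ↦ ?_
    rw [Finset.sum_mul]
    refine Finset.sum_congr rfl fun j hj ↦ ?_
    have hPs : P z = P (z - z₀) := by
      have := h.P_add (z - z₀) m₀ n₀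
      rwa [← hz, sub_add_cancel] at this
    have hHs : H z = H (z - z₀) + n₀ * κ := by
      have := h.H_add (z - z₀) m₀ n₀
      rwa [← hz, sub_add_cancel] at this
    rw [← hPz, ← hHz, hPs, hHs, hQ]
    have hexp : 3 * n = 2 * i + j + (3 * n - 2 * i - j) := by
      have := Finset.mem_range.1 hi
      have := Finset.mem_range.1 hj
      omega
    set S := sin (Real.pi * (z - z₀))
    have : S ^ (3 * n) = S ^ (2 * i) * S ^ j * S ^ (3 * n - 2 * i - j) := by
      rw [← pow_add, ← pow_add, ← hexp]
    rw [mul_pow S, this, pow_mul S 2 i, mul_pow (P (z - z₀)), ← add_mul, mul_pow _ S j]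
    ring

end QuasiElliptic

theorem cos_pi_mul_eq {z₀ : ℂ} (h : cos (Real.pi * z₀) = 0) : ∃ c : ℂ → ℂ, AnalyticAt ℂ c z₀ ∧
    (∀ z, cos (Real.pi * z) = (z - z₀) * c z) ∧ c z₀ = -Real.pi * sin (Real.pi * z₀) := by
  have han : AnalyticAt ℂ (fun z : ℂ ↦ cos (Real.pi * z)) z₀ := by fun_prop
  obtain ⟨p, hp⟩ := han
  refine ⟨dslope (fun z : ℂ ↦ cos (Real.pi * z)) z₀, ⟨_, hp.has_fpower_series_dslope_fslope⟩,
    fun z ↦ ?_, ?_⟩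
  · have := sub_smul_dslope (fun z : ℂ ↦ cos (Real.pi * z)) z₀ z
    rw [smul_eq_mul] at this
    rw [this, h, sub_zero]
  · rw [dslope_same]
    have h1 : HasDerivAt (fun z : ℂ ↦ Real.pi * z) (Real.pi * 1) z₀ :=
      (hasDerivAt_id z₀).const_mul _
    have := h1.ccos.deriv
    rw [this]; ring

end

section

open Complex Filter Topology

theorem half_ne_int_add {τ : ℂ} (hτ : 0 < τ.im) (m n : ℤ) : (1 / 2 : ℂ) ≠ m + n * τ := by
  intro h
  have h1 := congrArg Complex.im h
  simp [hτ.ne'] at h1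
  rw [h1] at h
  have h2 : (1 : ℂ) = ((2 * m : ℤ) : ℂ) := by
    push_cast
    linear_combination 2 * h
  have h3 : (1 : ℤ) = 2 * m := by exact_mod_cast h2
  omega

namespace QuasiElliptic

theorem exists_norm_iteratedDeriv_auxFun_le {τ κ : ℂ} {P H : ℂ → ℂ} (h : QuasiElliptic τ κ P H) :
    ∃ K η : ℝ, 1 ≤ K ∧ 0 < η ∧ ∀ (n N t : ℕ) (a : ℕ → ℕ → ℂ) (M : ℝ), (∀ i j, ‖a i j‖ ≤ M) →
      (∀ s < t, iteratedDeriv s (auxFun P H n a) (1 / 2) = 0) →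
      ‖iteratedDeriv t (auxFun P H n a) (1 / 2)‖ ≤ t.factorial * (n ^ 2 * M * (N + 2) ^ n *
        K ^ (n * (2 * N + 1) ^ 2 + t) * Real.exp (-(η * N * t))) := by
  have hy := h.im_pos
  have hpy : 0 < Real.pi * τ.im := mul_pos Real.pi_pos hy
  obtain ⟨C, hC1, hC⟩ := h.exists_bound_on_line
  set E := Real.exp (Real.pi * τ.im) with hE
  set σ := Real.sinh (Real.pi * τ.im / 2) with hσ
  set δ := min 1 (Real.sinh (Real.pi * τ.im)) with hδ
  have hσ0 : 0 < σ := Real.sinh_pos_iff.2 (by linarith)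
  have hδ0 : 0 < δ := lt_min one_pos (Real.sinh_pos_iff.2 hpy)
  have hδ1 : δ ≤ 1 := min_le_left _ _
  have hE1 : 1 ≤ E := Real.one_le_exp hpy.le
  have hC2 : 1 ≤ C ^ 2 := one_le_pow₀ hC1
  have hE3 : 1 ≤ E ^ 3 := one_le_pow₀ hE1
  have hδ3 : 1 ≤ δ⁻¹ ^ 3 := one_le_pow₀ ((one_le_inv₀ hδ0).2 hδ1)
  have hK0 : 1 ≤ C ^ 2 * E ^ 3 * δ⁻¹ ^ 3 := one_le_mul_of_one_le_of_one_le
    (one_le_mul_of_one_le_of_one_le hC2 hE3) hδ3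
  refine ⟨C ^ 2 * E ^ 3 * δ⁻¹ ^ 3 * max 1 (Real.pi / σ), Real.pi * τ.im,
    one_le_mul_of_one_le_of_one_le hK0 (le_max_left _ _), hpy, ?_⟩
  intro n N t a M ha hvan
  have hM : 0 ≤ M := (norm_nonneg _).trans (ha 0 0)
  set F := auxFun P H n a with hF
  obtain ⟨g₀, hg₀, hFg, hval⟩ := exists_eventually_eq_sub_pow_mul
    (h.analyticAt_auxFun n a (half_ne_int_add hy)) hvan
  rw [← hF] at hFg hval
  set f : ℂ → ℂ := fun z ↦ F z * rowSin τ N z ^ (3 * n) * (cos (Real.pi * z) ^ t)⁻¹ with hf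
  have hloc : ∀ k : ℤ, ∃ g : ℂ → ℂ, AnalyticAt ℂ g (1 / 2 + k) ∧ f =ᶠ[𝓝[≠] (1 / 2 + k : ℂ)] g ∧
      g (1 / 2 + k) = g₀ (1 / 2) * rowSin τ N (1 / 2 + k) ^ (3 * n) *
        ((-Real.pi * sin (Real.pi * (1 / 2 + k))) ^ t)⁻¹ := by
    intro k
    set z₀ : ℂ := 1 / 2 + k with hz₀
    have hcos : cos (Real.pi * z₀) = 0 := by
      rw [Complex.cos_eq_zero_iff]
      exact ⟨k, by rw [hz₀]; ring⟩
    have hsin : sin (Real.pi * z₀) ≠ 0 := by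
      intro hs
      have := Complex.sin_sq_add_cos_sq (Real.pi * z₀)
      rw [hs, hcos] at this
      norm_num at this
    obtain ⟨c, hc, hcz, hc0⟩ := cos_pi_mul_eq hcos
    have hz₀k : z₀ - k = 1 / 2 := by rw [hz₀]; ring
    have hc0' : c z₀ ≠ 0 := by
      rw [hc0]
      exact mul_ne_zero (neg_ne_zero.2 (by exact_mod_cast Real.pi_ne_zero)) hsin
    refine ⟨fun z ↦ g₀ (z - k) * rowSin τ N z ^ (3 * n) * (c z ^ t)⁻¹, ?_, ?_, ?_⟩
    · have h1 : AnalyticAt ℂ (fun z ↦ g₀ (z - k)) z₀ := by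
        apply AnalyticAt.comp (f := fun w : ℂ ↦ w - k) (by rw [hz₀k]; exact hg₀)
        fun_prop
      exact (h1.mul ((analyticAt_rowSin τ N z₀).pow _)).mul ((hc.pow t).inv (pow_ne_zero _ hc0'))
    · have ht := tendsto_sub_nhdsNE z₀ k
      rw [hz₀k] at ht
      filter_upwards [ht.eventually (hFg.filter_mono nhdsWithin_le_nhds), self_mem_nhdsWithin]
        with z hz hne
      have hFz : F z = F (z - k) := by
        have := h.auxFun_add_int n a (z - k) k
        rwa [sub_add_cancel] at this
      have hsub : z - k - 1 / 2 = z - z₀ := by rw [hz₀]; ring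
      have hne' : z - z₀ ≠ 0 := sub_ne_zero.2 hne
      rw [hf]
      simp only
      rw [hFz, hz, hcz, hsub, mul_pow, mul_inv]
      have := pow_ne_zero t hne'
      field_simp
    · simp only [hz₀k, hc0]
  have hstrip : ∀ z : ℂ, |z.im| ≤ (N + 1 / 2) * τ.im →
      ∃ g : ℂ → ℂ, AnalyticAt ℂ g z ∧ f =ᶠ[𝓝[≠] z] g := by
    intro z hz
    by_cases hcos : cos (Real.pi * z) = 0
    · obtain ⟨k, hk⟩ := Complex.cos_eq_zero_iff.1 hcos
      have hz' : z = 1 / 2 + k := by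
        have hpi : (Real.pi : ℂ) ≠ 0 := by exact_mod_cast Real.pi_ne_zero
        apply mul_left_cancel₀ hpi
        rw [hk]; ring
      rw [hz']
      obtain ⟨g, hg, hfg, -⟩ := hloc k
      exact ⟨g, hg, hfg⟩
    · obtain ⟨g, hg, hfg⟩ := h.exists_analyticAt_eq_auxFun_mul n N a (z₀ := z) (by nlinarith)
      have hcan : AnalyticAt ℂ (fun z ↦ (cos (Real.pi * z) ^ t)⁻¹) z :=
        AnalyticAt.inv (by fun_prop) (pow_ne_zero _ hcos)
      refine ⟨_, hg.mul hcan, ?_⟩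
      filter_upwards [hfg] with w hw
      rw [Pi.mul_apply, ← hw]
  have hper : ∀ z, f (z + 2) = f z := by
    intro z
    have h1 := h.auxFun_add_int n a z 2
    have h2 : cos (Real.pi * (z + 2)) = cos (Real.pi * z) := by
      rw [← cos_add_two_pi (Real.pi * z)]; congr 1; ring
    push_cast at h1
    simp only [hf, rowSin_add_two, h2, hF, h1]
  set B : ℝ := n ^ 2 * M * (C ^ n * (C * (N + 2)) ^ n) * (E ^ ((2 * N + 1) ^ 2)) ^ (3 * n) *
    ((Real.exp (Real.pi * τ.im * N) * σ) ^ t)⁻¹ with hB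
  have hbd : ∀ z : ℂ, |z.im| = (N + 1 / 2) * τ.im → ContinuousAt f z ∧ ‖f z‖ ≤ B := by
    intro z hz
    have hN0 : (0 : ℝ) ≤ N := Nat.cast_nonneg _
    have hrow : ∃ N' : ℤ, z.im = (N' + 1 / 2) * τ.im ∧ |(N' : ℝ)| + 1 ≤ N + 2 := by
      rcases abs_eq (by positivity : (0 : ℝ) ≤ (N + 1 / 2) * τ.im) |>.1 hz with h1 | h1
      · exact ⟨N, by rw [h1]; simp, by simp⟩
      · refine ⟨-N - 1, by rw [h1]; push_cast; ring, ?_⟩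
        push_cast
        rw [show -(N : ℝ) - 1 = -(N + 1) by ring, abs_neg, abs_of_nonneg (by linarith)]
        linarith
    obtain ⟨N', hN', hN'2⟩ := hrow
    have hoff : ∀ m n : ℤ, z ≠ m + n * τ :=
      h.ne_of_im (N := N') (by rw [hN']; nlinarith) (by rw [hN']; nlinarith)
    have hcos : Real.exp (Real.pi * τ.im * N) * σ ≤ ‖cos (Real.pi * z)‖ := by
      refine le_trans ?_ (sinh_abs_im_le_norm_cos _)
      have h1 : |(Real.pi * z : ℂ).im| = Real.pi * τ.im * N + Real.pi * τ.im / 2 := by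
        rw [im_ofReal_mul, abs_mul, hz, abs_of_pos Real.pi_pos]; ring
      rw [h1]
      exact Real.exp_mul_sinh_le (by positivity)
    have hcpos : 0 < Real.exp (Real.pi * τ.im * N) * σ := by positivity
    have hcos0 : cos (Real.pi * z) ≠ 0 := by
      intro h0
      rw [h0, norm_zero] at hcos
      linarith
    constructor
    · have hcan : AnalyticAt ℂ (fun z ↦ (cos (Real.pi * z) ^ t)⁻¹) z :=
        AnalyticAt.inv (by fun_prop) (pow_ne_zero _ hcos0)
      exact (((h.analyticAt_auxFun n a hoff).mul
        ((analyticAt_rowSin τ N z).pow (3 * n))).mul hcan).continuousAt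
    · obtain ⟨hPz, hHz⟩ := hC z N' hN'
      have hHz' : ‖H z‖ ≤ C * (N + 2) := hHz.trans (by gcongr)
      have hD : 1 ≤ C * ((N : ℝ) + 2) := by nlinarith
      have h1 := norm_auxFun_le (n := n) ha hC1 hD hPz hHz'
      have h2 := norm_rowSin_le hy N hz.le
      rw [hf]
      simp only [norm_mul, norm_pow, norm_inv]
      rw [hB]
      gcongr
  obtain ⟨g, hg, hfg, hgval⟩ := hloc 0
  simp only [Int.cast_zero, add_zero] at hg hfg hgval
  have hmain := norm_le_of_norm_le_on_strip (by positivity) hstrip hper hbd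
    (z₀ := 1 / 2) (by simp; positivity) hg hfg
  have hsin : sin ((Real.pi : ℂ) * (1 / 2)) = 1 := by
    rw [show (Real.pi : ℂ) * (1 / 2) = Real.pi / 2 by ring, Complex.sin_pi_div_two]
  rw [hgval, hsin, mul_one, norm_mul, norm_mul, norm_inv, norm_pow, norm_pow, norm_neg,
    norm_real, Real.norm_of_nonneg Real.pi_pos.le] at hmain
  have hQ := le_norm_rowSin_half hy N
  rw [← hδ] at hQ
  have hQpos : 0 < δ ^ (2 * N + 1) := pow_pos hδ0 _
  have hg0 : ‖g₀ (1 / 2)‖ ≤ B * Real.pi ^ t * ((δ ^ (2 * N + 1)) ^ (3 * n))⁻¹ := by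
    have hpit : 0 < Real.pi ^ t := pow_pos Real.pi_pos _
    rw [← div_eq_mul_inv, le_div_iff₀ (pow_pos hQpos _), ← div_le_iff₀ hpit, div_eq_mul_inv]
    refine le_trans ?_ hmain
    gcongr
  rw [hval, norm_mul]
  have hfac : ‖((t.factorial : ℕ) : ℂ)‖ = t.factorial := by simp
  rw [hfac]
  refine mul_le_mul_of_nonneg_left (hg0.trans ?_) (Nat.cast_nonneg _)
  set L := (2 * N + 1) ^ 2 with hL
  have hLn : n ≤ n * L := Nat.le_mul_of_pos_right _ (by positivity)
  have hL2 : 3 * (n * (2 * N + 1)) ≤ 3 * (n * L) := by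
    rw [hL]; gcongr; nlinarith
  calc _ = n ^ 2 * M * (N + 2) ^ n * ((C ^ 2) ^ n * (E ^ 3) ^ (n * L) *
        δ⁻¹ ^ (3 * (n * (2 * N + 1))) * (Real.pi / σ) ^ t) *
          Real.exp (-(Real.pi * τ.im * N * t)) := by
        have e1 : (E ^ L) ^ (3 * n) = (E ^ 3) ^ (n * L) := by
          rw [← pow_mul, ← pow_mul]; congr 1; ring
        have e2 : ((δ ^ (2 * N + 1)) ^ (3 * n))⁻¹ = δ⁻¹ ^ (3 * (n * (2 * N + 1))) := by
          rw [← pow_mul, ← inv_pow]; congr 1; ring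
        have e3 : Real.exp (-(Real.pi * τ.im * N * t)) = (Real.exp (Real.pi * τ.im * N) ^ t)⁻¹ := by
          rw [Real.exp_neg, ← Real.exp_nat_mul]; congr 2; ring
        rw [hB, e1, e2, e3, mul_pow (Real.exp _) σ, mul_inv, mul_pow C, div_pow]
        ring
    _ ≤ n ^ 2 * M * (N + 2) ^ n * ((C ^ 2) ^ (n * L) * (E ^ 3) ^ (n * L) *
        δ⁻¹ ^ (3 * (n * L)) * (max 1 (Real.pi / σ)) ^ (n * L + t)) *
          Real.exp (-(Real.pi * τ.im * N * t)) := by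
        have hm : (Real.pi / σ) ^ t ≤ (max 1 (Real.pi / σ)) ^ (n * L + t) :=
          (pow_le_pow_left₀ (by positivity) (le_max_right _ _) _).trans
            (pow_le_pow_right₀ (le_max_left _ _) (by omega))
        have hδi : 1 ≤ δ⁻¹ := (one_le_inv₀ hδ0).2 hδ1
        gcongr
    _ ≤ n ^ 2 * M * (N + 2) ^ n * (C ^ 2 * E ^ 3 * δ⁻¹ ^ 3 * max 1 (Real.pi / σ)) ^ (n * L + t) *
          Real.exp (-(Real.pi * τ.im * N * t)) := by
        have e4 : (C ^ 2) ^ (n * L) * (E ^ 3) ^ (n * L) * δ⁻¹ ^ (3 * (n * L)) =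
            (C ^ 2 * E ^ 3 * δ⁻¹ ^ 3) ^ (n * L) := by
          rw [pow_mul δ⁻¹ 3, mul_pow, mul_pow]
        have h5 : (C ^ 2 * E ^ 3 * δ⁻¹ ^ 3) ^ (n * L) ≤ (C ^ 2 * E ^ 3 * δ⁻¹ ^ 3) ^ (n * L + t) :=
          pow_le_pow_right₀ hK0 (by omega)
        rw [e4, mul_pow _ (max 1 (Real.pi / σ))]
        gcongr

end QuasiElliptic

end

section

open Complex Filter Topology

theorem eq_zero_of_sum_mul_pow_eq_zero {R : Type*} [CommRing R] [IsDomain R] {n : ℕ} {b : ℕ → R}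
    {S : Set R} (hS : S.Infinite) (h : ∀ x ∈ S, ∑ j ∈ Finset.range n, b j * x ^ j = 0) :
    ∀ j < n, b j = 0 := by
  set p : Polynomial R := ∑ j ∈ Finset.range n, Polynomial.C (b j) * Polynomial.X ^ j with hp
  have hp0 : p = 0 := by
    apply Polynomial.eq_zero_of_infinite_isRoot
    refine hS.mono fun x hx ↦ ?_
    have := h x hx
    simpa [hp, Polynomial.IsRoot, Polynomial.eval_finsetSum] using this
  intro j hj
  have := congrArg (fun q ↦ Polynomial.coeff q j) hp0
  simpa [hp, Polynomial.finsetSum_coeff, Polynomial.coeff_C_mul, Polynomial.coeff_X_pow, hj]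
    using this

namespace QuasiElliptic

theorem exists_iteratedDeriv_auxFun_ne_zero {τ κ : ℂ} {P H : ℂ → ℂ} (h : QuasiElliptic τ κ P H)
    (hκ : κ ≠ 0) (hP : ∀ R : ℝ, ∃ z, (∀ m n : ℤ, z ≠ m + n * τ) ∧ R < ‖P z‖)
    {n : ℕ} {a : ℕ → ℕ → ℂ} (ha : ∃ i < n, ∃ j < n, a i j ≠ 0) :
    ∃ t, iteratedDeriv t (auxFun P H n a) (1 / 2) ≠ 0 := by
  by_contra! hall
  set U : Set ℂ := (Set.range fun p : ℤ × ℤ ↦ (p.1 : ℂ) + p.2 * τ)ᶜ with hU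
  have hmem : ∀ z, z ∈ U ↔ ∀ m n : ℤ, z ≠ m + n * τ := by
    intro z
    simp only [hU, Set.mem_compl_iff, Set.mem_range, Prod.exists, not_exists]
    exact forall₂_congr fun m n ↦ by rw [ne_comm]
  have hconn : IsPreconnected U :=
    ((Set.countable_range _).isConnected_compl_of_one_lt_rank (by simp)).isPreconnected
  have han : AnalyticOnNhd ℂ (auxFun P H n a) U := fun z hz ↦
    h.analyticAt_auxFun n a ((hmem z).1 hz)
  have hhalf : (1 / 2 : ℂ) ∈ U := (hmem _).2 (half_ne_int_add h.im_pos)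
  have hev : auxFun P H n a =ᶠ[𝓝 (1 / 2)] 0 := by
    have : analyticOrderAt (auxFun P H n a) (1 / 2) = ⊤ := by
      rw [ENat.eq_top_iff_forall_ge]
      intro m
      exact (natCast_le_analyticOrderAt_iff_iteratedDeriv_eq_zero (han _ hhalf)).2 fun i _ ↦ hall i
    exact analyticOrderAt_eq_top.1 this
  have hzero := han.eqOn_zero_of_preconnected_of_eventuallyEq_zero hconn hhalf hev
  have hcol : ∀ z ∈ U, ∀ j < n, ∑ i ∈ Finset.range n, a i j * P z ^ i = 0 := by
    intro z hz
    apply eq_zero_of_sum_mul_pow_eq_zero (S := Set.range fun m : ℤ ↦ H z + m * κ)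
    · apply Set.infinite_range_of_injective
      intro m m' hm
      simpa [hκ] using hm
    · rintro _ ⟨m, rfl⟩
      have hz' : z + ((0 : ℤ) + m * τ) ∈ U := by
        rw [hmem] at hz ⊢
        intro p q hpq
        apply hz p (q - m)
        push_cast at hpq ⊢
        linear_combination hpq
      have := hzero hz'
      simp only [auxFun, h.P_add, h.H_add, Pi.zero_apply] at this
      rw [Finset.sum_comm] at this
      rw [← this]
      refine Finset.sum_congr rfl fun j _ ↦ ?_
      rw [Finset.sum_mul]
      refine Finset.sum_congr rfl fun i _ ↦ ?_
      ring
  obtain ⟨i, hi, j, hj, hij⟩ := ha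
  refine hij (eq_zero_of_sum_mul_pow_eq_zero (n := n) (b := fun i ↦ a i j) (S := P '' U) ?_ ?_ i hi)
  · intro hfin
    obtain ⟨R, hR⟩ := (hfin.image (fun x ↦ ‖x‖)).bddAbove
    obtain ⟨z, hz, hRz⟩ := hP R
    have := hR ⟨P z, ⟨z, (hmem z).2 hz, rfl⟩, rfl⟩
    simp only at this
    linarith
  · rintro _ ⟨z, hz, rfl⟩
    exact hcol z hz j hj

end QuasiElliptic

end

section

open NumberField Matrix

theorem NumberField.house_le_of_forall {K : Type*} [Field K] [NumberField K] {α : K} {C : ℝ}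
    (h : ∀ σ : K →+* ℂ, ‖σ α‖ ≤ C) : house α ≤ C := by
  have hC : 0 ≤ C := (norm_nonneg _).trans (h (Classical.arbitrary _))
  lift C to NNReal using hC
  rw [house_eq_sup']
  exact_mod_cast Finset.sup'_le _ _ fun σ _ ↦ by exact_mod_cast h σ

/-- **Siegel's lemma** for systems with twice as many unknowns as equations. -/
theorem NumberField.exists_siegel_bound (K : Type*) [Field K] [NumberField K] : ∃ c : ℝ, 1 ≤ c ∧
    ∀ (α β : Type) [Fintype α] [Fintype β], 0 < Fintype.card α →
      Fintype.card β = 2 * Fintype.card α → ∀ (a : Matrix α β (𝓞 K)) (A : ℝ), 1 ≤ A →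
      (∀ k l, house (a k l : K) ≤ A) →
      ∃ ξ : β → 𝓞 K, ξ ≠ 0 ∧ a *ᵥ ξ = 0 ∧ ∀ l, house (ξ l : K) ≤ c * Fintype.card β * A := by
  classical
  have key : ∃ c : ℝ, ∀ (α β : Type) [Fintype α] [Fintype β], 0 < Fintype.card α →
      Fintype.card β = 2 * Fintype.card α → ∀ (a : Matrix α β (𝓞 K)) (A : ℝ), a ≠ 0 →
      (∀ k l, house (a k l : K) ≤ A) →
      ∃ ξ : β → 𝓞 K, ξ ≠ 0 ∧ a *ᵥ ξ = 0 ∧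
        ∀ l, house (ξ l : K) ≤ c * ((c * Fintype.card β * A) ^
          ((Fintype.card α : ℝ) / (Fintype.card β - Fintype.card α))) := by
    refine ⟨?_, fun α β _ _ h0 hc a A ha hA ↦ ?_⟩
    swap
    exact house.exists_ne_zero_int_vec_house_le K a ha h0 (by omega) rfl hA rfl
  obtain ⟨c, hc⟩ := key
  refine ⟨max 1 (c ^ 2), le_max_left _ _, fun α β _ _ h0 hcard a A hA1 hA ↦ ?_⟩
  have hβ : (1 : ℝ) ≤ Fintype.card β := by exact_mod_cast (by omega : 1 ≤ Fintype.card β)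
  by_cases ha : a = 0
  · have : Nonempty β := Fintype.card_pos_iff.1 (by omega)
    refine ⟨1, one_ne_zero, by rw [ha, zero_mulVec], fun l ↦ ?_⟩
    have h1 : house ((1 : 𝓞 K) : K) ≤ 1 := house_le_of_forall fun σ ↦ by simp
    refine h1.trans (one_le_mul_of_one_le_of_one_le (one_le_mul_of_one_le_of_one_le
      (le_max_left _ _) hβ) hA1)
  · obtain ⟨ξ, h1, h2, h3⟩ := hc α β h0 hcard a A ha hA
    refine ⟨ξ, h1, h2, fun l ↦ (h3 l).trans ?_⟩
    have hα : (Fintype.card α : ℝ) ≠ 0 := by exact_mod_cast h0.ne'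
    have hexp : (Fintype.card α : ℝ) / (Fintype.card β - Fintype.card α) = 1 := by
      rw [hcard]; push_cast
      rw [show (2 : ℝ) * Fintype.card α - Fintype.card α = Fintype.card α by ring, div_self hα]
    rw [hexp, Real.rpow_one]
    calc c * (c * Fintype.card β * A) = c ^ 2 * Fintype.card β * A := by ring
      _ ≤ _ := by gcongr; exact le_max_right _ _

theorem exists_house_derivVal_le {K : Type*} [Field K] [NumberField K] (A B e : 𝓞 K) :
    ∃ C : ℝ, 1 ≤ C ∧ ∀ t i j : ℕ, house ((derivVal A B e 0 0 t i 0 j : 𝓞 K) : K) ≤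
      C ^ (i + j + t) * (7 * ((i + j + t : ℕ) : ℝ)) ^ t := by
  refine ⟨max 1 (max (house (A : K)) (max (house (B : K)) (house (e : K)))), le_max_left _ _,
    fun t i j ↦ house_le_of_forall fun σ ↦ ?_⟩
  set C := max 1 (max (house (A : K)) (max (house (B : K)) (house (e : K)))) with hC
  have hbd : ∀ x : 𝓞 K, ‖σ (x : K)‖ ≤ house (x : K) := fun x ↦ norm_embedding_le_house _ σ
  have hC1 : 1 ≤ C := le_max_left _ _
  have := map_derivVal (σ.comp (algebraMap (𝓞 K) K)) A B e 0 0 t i 0 j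
  rw [RingHom.comp_apply] at this
  rw [this]
  refine (norm_derivVal_le hC1 ((hbd A).trans (by simp [hC])) ((hbd B).trans (by simp [hC]))
    ((hbd e).trans (by simp [hC])) (by simp; linarith) (by simp; linarith) t i 0 j).trans ?_
  simp

theorem exists_siegel_coefficients {K : Type*} [Field K] [NumberField K] (A B e : 𝓞 K) :
    ∃ E : ℝ, 1 ≤ E ∧ ∀ s : ℕ, 1 ≤ s → ∃ ξ : ℕ → ℕ → 𝓞 K,
      (∃ i < 2 * s, ∃ j < 2 * s, ξ i j ≠ 0) ∧
      (∀ t < 2 * s ^ 2, ∑ i ∈ Finset.range (2 * s), ∑ j ∈ Finset.range (2 * s),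
        ξ i j * derivVal A B e 0 0 t i 0 j = 0) ∧
      ∀ t, 2 * s ^ 2 ≤ t → (∀ i j, house (ξ i j : K) ≤ E ^ t * (t : ℝ) ^ t) ∧
        house ((∑ i ∈ Finset.range (2 * s), ∑ j ∈ Finset.range (2 * s),
          ξ i j * derivVal A B e 0 0 t i 0 j : 𝓞 K) : K) ≤ E ^ t * (t : ℝ) ^ (2 * t) := by
  obtain ⟨c, hc1, hc⟩ := exists_siegel_bound K
  obtain ⟨C, hC1, hC⟩ := exists_house_derivVal_le A B e
  have hC3 : 1 ≤ C ^ 3 := one_le_pow₀ hC1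
  set E₁ := 4 * C ^ 3 * 21 with hE₁
  clear_value E₁
  have hE₁1 : 1 ≤ E₁ := by linarith
  have hval : ∀ s t t' i j : ℕ, 1 ≤ s → 2 * s ^ 2 ≤ t → t' ≤ t → i < 2 * s → j < 2 * s →
      house ((derivVal A B e 0 0 t' i 0 j : 𝓞 K) : K) ≤ C ^ (3 * t) * (21 * (t : ℝ)) ^ t := by
    intro s t t' i j hs hst ht hi hj
    have hle : i + j + t' ≤ 3 * t := by nlinarith
    have hle' : ((i + j + t' : ℕ) : ℝ) ≤ 3 * t := by exact_mod_cast hle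
    have ht1 : (1 : ℝ) ≤ t := by exact_mod_cast (by nlinarith : 1 ≤ t)
    refine (hC t' i j).trans ?_
    calc _ ≤ C ^ (3 * t) * (21 * (t : ℝ)) ^ t' := by
          refine mul_le_mul (pow_le_pow_right₀ hC1 hle)
            (pow_le_pow_left₀ (by positivity) (by linarith) _) (by positivity) (by positivity)
      _ ≤ _ := mul_le_mul_of_nonneg_left (pow_le_pow_right₀ (by linarith) ht) (by positivity)
  refine ⟨c * E₁ ^ 2, one_le_mul_of_one_le_of_one_le hc1 (one_le_pow₀ hE₁1), fun s hs ↦ ?_⟩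
  have hT0 : 1 ≤ 2 * s ^ 2 := by nlinarith
  have hT : (1 : ℝ) ≤ ((2 * s ^ 2 : ℕ) : ℝ) := by exact_mod_cast hT0
  obtain ⟨ξ, hξ0, hξ, hξh⟩ := hc (Fin (2 * s ^ 2)) (Fin (2 * s) × Fin (2 * s)) (by simp; omega)
    (by simp; ring) (fun t p ↦ derivVal A B e 0 0 t p.1 0 p.2)
    (C ^ (3 * (2 * s ^ 2)) * (21 * ((2 * s ^ 2 : ℕ) : ℝ)) ^ (2 * s ^ 2))
    (one_le_mul_of_one_le_of_one_le (one_le_pow₀ hC1) (one_le_pow₀ (by linarith)))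
    (fun t p ↦ hval s _ t p.1 p.2 hs le_rfl t.2.le p.1.2 p.2.2)
  set x : ℕ → ℕ → 𝓞 K := fun i j ↦ if h : i < 2 * s ∧ j < 2 * s then ξ (⟨i, h.1⟩, ⟨j, h.2⟩) else 0
    with hx
  have hxξ : ∀ p : Fin (2 * s) × Fin (2 * s), x p.1 p.2 = ξ p := by
    intro p
    simp [hx]
  have hpow : ∀ t : ℕ, 1 ≤ t → 2 * (t : ℝ) * (C ^ (3 * t) * (21 * (t : ℝ)) ^ t) ≤
      E₁ ^ t * (t : ℝ) ^ t := by
    intro t ht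
    have h1 : 2 * (t : ℝ) ≤ 4 ^ t := by
      have h2 : t + 1 ≤ 2 ^ t := Nat.lt_two_pow_self
      have h3 : 2 ≤ 2 ^ t := by
        calc 2 = 2 ^ 1 := rfl
          _ ≤ 2 ^ t := Nat.pow_le_pow_right (by norm_num) ht
      have h4 : 2 * t ≤ 4 ^ t := by
        rw [show 4 = 2 * 2 by rfl, mul_pow]
        exact Nat.mul_le_mul h3 (by omega)
      exact_mod_cast h4
    calc _ ≤ 4 ^ t * (C ^ (3 * t) * (21 * (t : ℝ)) ^ t) := by gcongr
      _ = _ := by rw [hE₁, mul_pow, mul_pow, mul_pow, ← pow_mul C 3]; ring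
  have hs2 : ∀ t, 2 * s ^ 2 ≤ t → (4 * s ^ 2 : ℝ) ≤ 2 * t := by
    intro t ht
    have : ((2 * s ^ 2 : ℕ) : ℝ) ≤ t := by exact_mod_cast ht
    push_cast at this
    linarith
  have hbound : ∀ t, 2 * s ^ 2 ≤ t → ∀ i j, house (x i j : K) ≤ (c * E₁) ^ t * (t : ℝ) ^ t := by
    intro t ht i j
    have ht1 : 1 ≤ t := hT0.trans ht
    have ht1' : (1 : ℝ) ≤ t := by exact_mod_cast ht1
    by_cases h : i < 2 * s ∧ j < 2 * s
    · simp only [hx, h, and_self, dite_true]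
      refine (hξh _).trans ?_
      have hTt : ((2 * s ^ 2 : ℕ) : ℝ) ≤ t := by exact_mod_cast ht
      calc _ ≤ c * (2 * t) * (C ^ (3 * t) * (21 * (t : ℝ)) ^ t) := by
            have hcard : (Fintype.card (Fin (2 * s) × Fin (2 * s)) : ℝ) ≤ 2 * t := by
              have := hs2 t ht
              simp only [Fintype.card_prod, Fintype.card_fin]
              push_cast
              linarith
            have h21 : (21 * ((2 * s ^ 2 : ℕ) : ℝ)) ^ (2 * s ^ 2) ≤ (21 * (t : ℝ)) ^ t := by
              calc _ ≤ (21 * (t : ℝ)) ^ (2 * s ^ 2) := by gcongr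
                _ ≤ _ := by
                  gcongr
                  linarith
            gcongr
        _ = c * (2 * t * (C ^ (3 * t) * (21 * (t : ℝ)) ^ t)) := by ring
        _ ≤ c ^ t * (E₁ ^ t * (t : ℝ) ^ t) := by
            have := hpow t ht1
            have hct : c ≤ c ^ t := le_self_pow₀ hc1 (by omega)
            gcongr
        _ = _ := by rw [mul_pow]; ring
    · simp only [hx, h, dite_false]
      have : house ((0 : 𝓞 K) : K) ≤ 0 := house_le_of_forall fun σ ↦ by simp
      exact this.trans (by positivity)
  refine ⟨x, ?_, fun t ht ↦ ?_, fun t ht ↦ ⟨fun i j ↦ ?_, ?_⟩⟩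
  · by_contra! hcon
    apply hξ0
    funext p
    rw [← hxξ]
    exact hcon _ p.1.2 _ p.2.2
  · have := congrFun hξ ⟨t, ht⟩
    simp only [mulVec, dotProduct, Pi.zero_apply, Fintype.sum_prod_type] at this
    refine Eq.trans ?_ this
    rw [Finset.sum_range]
    refine Finset.sum_congr rfl fun i _ ↦ ?_
    rw [Finset.sum_range]
    refine Finset.sum_congr rfl fun j _ ↦ ?_
    rw [hxξ (i, j)]
    ring
  · refine (hbound t ht i j).trans ?_
    gcongr
    exact le_self_pow₀ hE₁1 (by norm_num)
  · have ht1 : 1 ≤ t := hT0.trans ht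
    calc _ ≤ ∑ i ∈ Finset.range (2 * s), ∑ j ∈ Finset.range (2 * s),
          ((c * E₁) ^ t * (t : ℝ) ^ t) * (C ^ (3 * t) * (21 * (t : ℝ)) ^ t) := by
          simp only [map_sum, map_mul]
          refine (house_sum_le_sum_house _ _).trans (Finset.sum_le_sum fun i hi ↦ ?_)
          refine (house_sum_le_sum_house _ _).trans (Finset.sum_le_sum fun j hj ↦ ?_)
          refine (house_mul_le _ _).trans ?_
          exact mul_le_mul (hbound t ht i j) (hval s t t i j hs ht le_rfl (Finset.mem_range.1 hi)
            (Finset.mem_range.1 hj)) (house_nonneg _) (by positivity)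
      _ = (c * E₁) ^ t * (t : ℝ) ^ t * (4 * s ^ 2 * (C ^ (3 * t) * (21 * (t : ℝ)) ^ t)) := by
          simp; ring
      _ ≤ (c * E₁) ^ t * (t : ℝ) ^ t * (2 * t * (C ^ (3 * t) * (21 * (t : ℝ)) ^ t)) := by
          have := hs2 t ht
          gcongr
      _ ≤ (c * E₁) ^ t * (t : ℝ) ^ t * (E₁ ^ t * (t : ℝ) ^ t) := by
          have := hpow t ht1
          gcongr
      _ = _ := by rw [mul_pow, mul_pow c]; ring

end

section

open Complex Filter Topology NumberField

theorem exists_forall_mul_pow_mul_exp_lt_one (W : ℝ) (D : ℕ) {η : ℝ} (hη : 0 < η) :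
    ∃ N₀ : ℕ, ∀ N : ℕ, N₀ ≤ N → W * ((N : ℝ) + 1) ^ D * Real.exp (-(η * N)) < 1 := by
  have h1 := Real.tendsto_pow_mul_exp_neg_atTop_nhds_zero D
  have h2 : Tendsto (fun N : ℕ ↦ η * ((N : ℝ) + 1)) atTop atTop :=
    (tendsto_atTop_add_const_right _ _ tendsto_natCast_atTop_atTop).const_mul_atTop hη
  have h3 := ((h1.comp h2).const_mul (W * η⁻¹ ^ D * Real.exp η))
  rw [mul_zero] at h3
  obtain ⟨N₀, hN₀⟩ := eventually_atTop.1 (h3.eventually_lt_const one_pos)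
  refine ⟨N₀, fun N hN ↦ lt_of_eq_of_lt ?_ (hN₀ N hN)⟩
  simp only [Function.comp]
  rw [show -(η * ((N : ℝ) + 1)) = -(η * N) + -η by ring, Real.exp_add, Real.exp_neg η, mul_pow]
  have := Real.exp_pos η
  field_simp
  rw [one_div, mul_assoc, ← mul_pow, inv_mul_cancel₀ hη.ne', one_pow, mul_one]

theorem NumberField.one_le_norm_mul_house_pow {K : Type*} [Field K] [NumberField K] {v : 𝓞 K}
    (hv : v ≠ 0) (σ : K →+* ℂ) : 1 ≤ ‖σ v‖ * house (v : K) ^ (Module.finrank ℚ K - 1) := by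
  refine le_trans ?_ (norm_norm_le_norm_mul_house_pow (v : K) σ)
  rw [← Algebra.coe_norm_int, ← Rat.norm_cast_real, Rat.cast_intCast, Int.norm_cast_real,
    Int.norm_eq_abs]
  have : Algebra.norm ℤ v ≠ 0 := Algebra.norm_ne_zero_iff.2 hv
  exact_mod_cast Int.one_le_abs this

/-- A form of Schneider's theorem for the values of an elliptic and a quasi-elliptic function
satisfying an algebraic system of differential equations. -/
theorem QuasiElliptic.false_of_isIntegral {τ κ c A B e : ℂ} {P P₁ H : ℂ → ℂ}
    (h : QuasiElliptic τ κ P H) (hκ : κ ≠ 0)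
    (hPun : ∀ R : ℝ, ∃ z, (∀ m n : ℤ, z ≠ m + n * τ) ∧ R < ‖P z‖) (hc : c ≠ 0)
    (U : Set ℂ) (hU : IsOpen U) (hhalf : 1 / 2 ∈ U)
    (hdP : ∀ z ∈ U, HasDerivAt P (c⁻¹ * P₁ z) z)
    (hdP₁ : ∀ z ∈ U, HasDerivAt P₁ (c⁻¹ * (6 * P z ^ 2 - A)) z)
    (hdH : ∀ z ∈ U, HasDerivAt H (c⁻¹ * (-P z - B)) z)
    (hP : P (1 / 2) = e) (hP₁ : P₁ (1 / 2) = 0) (hH : H (1 / 2) = 0)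
    (hA : IsIntegral ℤ A) (hB : IsIntegral ℤ B) (he : IsIntegral ℤ e) : False := by
  let K := IntermediateField.adjoin ℚ ({A, B, e} : Set ℂ)
  have hfin : FiniteDimensional ℚ K := by
    apply IntermediateField.finiteDimensional_adjoin
    rintro x (rfl | rfl | rfl)
    exacts [hA.tower_top, hB.tower_top, he.tower_top]
  have hK : NumberField K := { }
  have hlift : ∀ x ∈ ({A, B, e} : Set ℂ), IsIntegral ℤ x → ∃ y : 𝓞 K, ((y : K) : ℂ) = x := by
    intro x hx hInt
    have : IsIntegral ℤ (⟨x, IntermediateField.subset_adjoin ℚ _ hx⟩ : K) := by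
      rw [← isIntegral_algebraMap_iff (B := ℂ) (FaithfulSMul.algebraMap_injective K ℂ)]
      exact hInt
    exact ⟨⟨_, this⟩, rfl⟩
  obtain ⟨A', hA'⟩ := hlift A (by simp) hA
  obtain ⟨B', hB'⟩ := hlift B (by simp) hB
  obtain ⟨e', he'⟩ := hlift e (by simp) he
  let σ₀ : K →+* ℂ := algebraMap K ℂ
  obtain ⟨E, hE1, hE⟩ := exists_siegel_coefficients A' B' e'
  obtain ⟨G, η, hG1, hη, hmain⟩ := h.exists_norm_iteratedDeriv_auxFun_le
  set d := Module.finrank ℚ K - 1 with hd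
  set W := ‖c‖ * 4 * E * 3 * G ^ 14 * E ^ d with hW
  set D := 3 + 2 * d with hD
  obtain ⟨N₀, hN₀⟩ := exists_forall_mul_pow_mul_exp_lt_one W (4 * D) hη
  set s := (N₀ + 1) ^ 2 with hs
  have hs1 : 1 ≤ s := Nat.one_le_pow _ _ (by omega)
  obtain ⟨ξ, hξ0, hξ, hξh⟩ := hE s hs1
  set v : ℕ → 𝓞 K := fun t ↦ ∑ i ∈ Finset.range (2 * s), ∑ j ∈ Finset.range (2 * s),
    ξ i j * derivVal A' B' e' 0 0 t i 0 j with hv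
  set a : ℕ → ℕ → ℂ := fun i j ↦ σ₀ (ξ i j) with ha
  have hderiv : ∀ t, iteratedDeriv t (auxFun P H (2 * s) a) (1 / 2) = c⁻¹ ^ t * σ₀ (v t) := by
    intro t
    have hoff := half_ne_int_add h.im_pos
    have hPa := h.analyticAt_P _ hoff
    have hHa := h.analyticAt_H _ hoff
    have hfun : auxFun P H (2 * s) a = fun z ↦ ∑ i ∈ Finset.range (2 * s),
      ∑ j ∈ Finset.range (2 * s), a i j * (P z ^ i * P₁ z ^ 0 * H z ^ j) := by
      funext z; simp [auxFun]
    have han : ∀ i j, AnalyticAt ℂ (fun z ↦ a i j * (P z ^ i * P₁ z ^ 0 * H z ^ j)) (1 / 2) := by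
      intro i j
      simp only [pow_zero, mul_one]
      exact analyticAt_const.mul ((hPa.pow i).mul (hHa.pow j))
    rw [hfun, iteratedDeriv_fun_sum fun i _ ↦
      (Finset.analyticAt_fun_sum _ fun j _ ↦ han i j).contDiffAt]
    simp only [hv, map_sum, Finset.mul_sum]
    refine Finset.sum_congr rfl fun i _ ↦ ?_
    rw [iteratedDeriv_fun_sum fun j _ ↦ (han i j).contDiffAt]
    refine Finset.sum_congr rfl fun j _ ↦ ?_
    rw [iteratedDeriv_const_mul_field,
      (iteratedDeriv_eq_derivVal U hU hdP hdP₁ hdH t i 0 j _ hhalf).1, hP, hP₁, hH]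
    have := map_derivVal (σ₀.comp (algebraMap (𝓞 K) K)) A' B' e' 0 0 t i 0 j
    simp only [RingHom.comp_apply] at this
    rw [map_mul, map_mul, this, ha]
    simp only [map_zero]
    have h1 : σ₀ (algebraMap (𝓞 K) K A') = A := hA'
    have h2 : σ₀ (algebraMap (𝓞 K) K B') = B := hB'
    have h3 : σ₀ (algebraMap (𝓞 K) K e') = e := he'
    rw [h1, h2, h3]
    ring
  have hne := h.exists_iteratedDeriv_auxFun_ne_zero hκ hPun (n := 2 * s) (a := a) (by
    obtain ⟨i, hi, j, hj, hij⟩ := hξ0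
    refine ⟨i, hi, j, hj, ?_⟩
    simp only [ha, ne_eq, map_eq_zero]
    exact_mod_cast hij)
  classical
  obtain ⟨t, hvt, hlt⟩ : ∃ t, v t ≠ 0 ∧ ∀ s' < t, v s' = 0 := by
    have hex : ∃ t, v t ≠ 0 := by
      obtain ⟨t, ht⟩ := hne
      refine ⟨t, fun h0 ↦ ht ?_⟩
      rw [hderiv, h0]; simp
    exact ⟨Nat.find hex, Nat.find_spec hex, fun s' hs' ↦ not_not.1 (Nat.find_min hex hs')⟩
  have hst : 2 * s ^ 2 ≤ t := by
    by_contra! hcon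
    exact hvt (hξ t hcon)
  obtain ⟨hξb, hvb⟩ := hξh t hst
  set N := Nat.sqrt (Nat.sqrt t) with hN
  have hs4 : s ^ 2 ≤ t := by nlinarith
  have hNN₀ : N₀ + 1 ≤ N := by
    rw [hN, Nat.le_sqrt', Nat.le_sqrt']
    rw [← hs]; exact hs4
  have hN4 : N ^ 4 ≤ t := by
    calc N ^ 4 = (N ^ 2) ^ 2 := by ring
      _ ≤ (Nat.sqrt t) ^ 2 := Nat.pow_le_pow_left (Nat.sqrt_le' _) 2
      _ ≤ t := Nat.sqrt_le' _
  have htN : t ≤ (N + 1) ^ 4 := by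
    calc t ≤ (Nat.sqrt t + 1) ^ 2 := (Nat.lt_succ_sqrt' t).le
      _ ≤ ((N + 1) ^ 2) ^ 2 := Nat.pow_le_pow_left (Nat.lt_succ_sqrt' _) 2
      _ = (N + 1) ^ 4 := by ring
  have hN1 : 1 ≤ N := by omega
  have ht1 : 1 ≤ t := hs1.trans (by nlinarith)
  have hn2 : ((2 * s : ℕ) : ℝ) ^ 2 ≤ 4 ^ t := by
    have h1 : (2 * s) ^ 2 ≤ 4 ^ t := by
      have h2 : t + 1 ≤ 2 ^ t := Nat.lt_two_pow_self
      have h3 : 2 ≤ 2 ^ t := by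
        calc 2 = 2 ^ 1 := rfl
          _ ≤ 2 ^ t := Nat.pow_le_pow_right (by norm_num) ht1
      rw [show 4 = 2 * 2 by rfl, mul_pow 2 2 t]
      calc (2 * s) ^ 2 = 2 * (2 * s ^ 2) := by ring
        _ ≤ _ := Nat.mul_le_mul h3 (by omega)
    exact_mod_cast h1
  have hexp : 2 * s * (2 * N + 1) ^ 2 ≤ 13 * t := by
    have h1 : (2 * N + 1) ^ 2 ≤ 9 * N ^ 2 := by nlinarith
    have h2 : (2 * s * (9 * N ^ 2)) ^ 2 ≤ (13 * t) ^ 2 := by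
      calc (2 * s * (9 * N ^ 2)) ^ 2 = 162 * ((2 * s ^ 2) * N ^ 4) := by ring
        _ ≤ 162 * (t * t) := by gcongr
        _ ≤ (13 * t) ^ 2 := by nlinarith
    exact (Nat.mul_le_mul_left _ h1).trans ((Nat.pow_le_pow_iff_left (by norm_num)).1 h2)
  have hnt : 2 * s ≤ t := by nlinarith
  have hN3 : (N : ℝ) + 2 ≤ 3 * t := by
    have : N ≤ N ^ 4 := Nat.le_self_pow (by norm_num) _
    exact_mod_cast (by omega : N + 2 ≤ 3 * t)
  have ht1' : (1 : ℝ) ≤ t := by exact_mod_cast ht1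
  have hc0 : 0 < ‖c‖ := norm_pos_iff.2 hc
  have key : 1 ≤ (W * (t : ℝ) ^ D * Real.exp (-(η * N))) ^ t := by
    have h1 := one_le_norm_mul_house_pow hvt σ₀
    have h2 := hmain (2 * s) N t a (E ^ t * (t : ℝ) ^ t)
      (fun i j ↦ (norm_embedding_le_house _ _).trans (hξb i j))
      (fun s' hs' ↦ by rw [hderiv, hlt s' hs']; simp)
    rw [hderiv, norm_mul, norm_pow, norm_inv, inv_pow, inv_mul_le_iff₀ (pow_pos hc0 t)] at h2
    have hfact : (t.factorial : ℝ) ≤ (t : ℝ) ^ t := by exact_mod_cast Nat.factorial_le_pow t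
    have hN3' : ((N : ℝ) + 2) ^ (2 * s) ≤ (3 * t) ^ t :=
      (pow_le_pow_left₀ (by positivity) hN3 _).trans (pow_le_pow_right₀ (by linarith) hnt)
    have hGe : G ^ (2 * s * (2 * N + 1) ^ 2 + t) ≤ G ^ (14 * t) :=
      pow_le_pow_right₀ hG1 (by omega)
    calc (1 : ℝ) ≤ _ := h1
      _ ≤ (‖c‖ ^ t * ((t : ℝ) ^ t * (4 ^ t * (E ^ t * (t : ℝ) ^ t) * (3 * t) ^ t * G ^ (14 * t) *
          Real.exp (-(η * N * t))))) * (E ^ t * (t : ℝ) ^ (2 * t)) ^ d := by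
          refine mul_le_mul (h2.trans ?_) (pow_le_pow_left₀ (house_nonneg _) hvb _)
            (pow_nonneg (house_nonneg _) _) (by positivity)
          gcongr
      _ = _ := by
          have e1 : Real.exp (-(η * N * t)) = Real.exp (-(η * N)) ^ t := by
            rw [← Real.exp_nat_mul]; congr 1; ring
          rw [e1, hW, hD]
          simp only [mul_pow, pow_add, ← pow_mul]
          ring
  have hbase : 1 ≤ W * (t : ℝ) ^ D * Real.exp (-(η * N)) := by
    by_contra! hlt1
    have hnn : 0 ≤ W * (t : ℝ) ^ D * Real.exp (-(η * N)) := by positivity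
    exact absurd key (not_le.2 (pow_lt_one₀ hnn hlt1 (by omega)))
  have hfinal := hN₀ N (by omega)
  refine absurd hbase (not_le.2 (lt_of_le_of_lt ?_ hfinal))
  have htN' : (t : ℝ) ≤ ((N : ℝ) + 1) ^ 4 := by exact_mod_cast htN
  have : (t : ℝ) ^ D ≤ ((N : ℝ) + 1) ^ (4 * D) := by
    rw [pow_mul]
    exact pow_le_pow_left₀ (by positivity) htN' _
  gcongr

end

section

open Complex Filter Topology UpperHalfPlane

theorem tauPair_G (τ : ℍ) {k : ℕ} (hk : 3 ≤ k) :
    (tauPair τ).G k = 2 * riemannZeta k * ModularForm.E hk τ := by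
  have h1 := tsum_eisSummand_eq_riemannZeta_mul_eisensteinSeries hk τ
  have h2 : ModularForm.E hk τ = (1 / 2 : ℂ) * eisensteinSeries (N := 1) 0 k τ := by
    rw [show ModularForm.E hk τ = (1 / 2 : ℂ) • EisensteinSeries.eisensteinSeriesSIF (N := 1) 0 k τ
      from rfl, EisensteinSeries.eisensteinSeriesSIF_apply 0 k τ, smul_eq_mul]
  rw [h2, show 2 * riemannZeta k * (1 / 2 * eisensteinSeries (N := 1) 0 k τ) =
    riemannZeta k * eisensteinSeries (N := 1) 0 k τ by ring, ← h1, PeriodPair.G,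
    ← (tauPair τ).latticeEquivProd.symm.toEquiv.tsum_eq, ← (Equiv.prodComm ℤ ℤ).tsum_eq,
    ← (finTwoArrowEquiv ℤ).symm.tsum_eq]
  refine tsum_congr fun p ↦ ?_
  have hl : (((tauPair τ).latticeEquivProd.symm.toEquiv (Equiv.prodComm ℤ ℤ p) : ℂ)) =
      p.1 * τ + p.2 := by
    refine ((tauPair τ).latticeEquiv_symm_apply p.swap).trans ?_
    simp [tauPair, add_comm]
  rw [hl]
  simp [EisensteinSeries.eisSummand]

theorem tauPair_g₂ (τ : ℍ) : (tauPair τ).g₂ = 4 / 3 * Real.pi ^ 4 * ModularForm.E₄ τ := by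
  have := tauPair_G τ (k := 4) (by norm_num)
  rw [PeriodPair.g₂, this]
  push_cast
  rw [riemannZeta_four]
  ring

theorem riemannZeta_six : riemannZeta 6 = (Real.pi : ℂ) ^ 6 / 945 := by
  have := riemannZeta_two_mul_nat (k := 3) (by norm_num)
  have h6 : bernoulli 6 = 1 / 42 := by
    rw [bernoulli_eq_bernoulli'_of_ne_one (by norm_num), bernoulli'_def]
    norm_num [Finset.sum_range_succ, Nat.choose,
      bernoulli'_eq_zero_of_odd (show Odd 5 by decide) (by norm_num)]
  norm_num [h6, Nat.factorial] at this
  rw [this]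
  ring

theorem tauPair_g₃ (τ : ℍ) : (tauPair τ).g₃ = 8 / 27 * Real.pi ^ 6 * ModularForm.E₆ τ := by
  have := tauPair_G τ (k := 6) (by norm_num)
  rw [PeriodPair.g₃, this]
  push_cast
  rw [riemannZeta_six]
  ring

theorem G2_eq_E2 (τ : ℍ) :
    EisensteinSeries.G2 τ = Real.pi ^ 2 / 3 * EisensteinSeries.E2 τ := by
  have : (Real.pi : ℂ) ≠ 0 := by exact_mod_cast Real.pi_ne_zero
  simp only [EisensteinSeries.E2, riemannZeta_two, Pi.smul_apply, smul_eq_mul]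
  field_simp
  ring

namespace PeriodPair

variable (L : PeriodPair)

theorem exists_norm_weierstrassP_gt (R : ℝ) : ∃ z, z ∉ L.lattice ∧ R < ‖L.weierstrassP z‖ := by
  have h := tendsto_cobounded_of_meromorphicOrderAt_neg (f := L.weierstrassP) (x := 0) (by
    rw [L.order_weierstrassP 0 (zero_mem _)]; decide)
  have h1 := (tendsto_norm_cobounded_atTop.comp h).eventually_gt_atTop R
  have h2 : ∀ᶠ z in 𝓝[≠] (0 : ℂ), z ∉ L.lattice := by
    filter_upwards [nhdsWithin_le_nhds (L.compl_lattice_sdiff_singleton_mem_nhds 0),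
      self_mem_nhdsWithin] with z hz hz'
    intro hl
    exact hz ⟨hl, hz'⟩
  obtain ⟨z, h1, h2⟩ := (h1.and h2).exists
  exact ⟨z, h2, h1⟩

theorem isOpen_compl_lattice : IsOpen ((L.lattice : Set ℂ)ᶜ) := L.isClosed_lattice.isOpen_compl

theorem isPreconnected_compl_lattice : IsPreconnected ((L.lattice : Set ℂ)ᶜ) := by
  have : (L.lattice : Set ℂ).Countable :=
    Set.countable_coe_iff.1 (Countable.of_equiv _ L.latticeEquivProd.symm.toEquiv)
  refine (this.isPathConnected_compl_of_one_lt_rank ?_).isConnected.isPreconnected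
  rw [Complex.rank_real_complex]
  norm_num

theorem hasDerivAt_weierstrassP {z : ℂ} (hz : z ∉ L.lattice) :
    HasDerivAt L.weierstrassP (L.derivWeierstrassP z) z := by
  rw [← L.deriv_weierstrassP]
  exact (L.analyticOnNhd_weierstrassP z hz).differentiableAt.hasDerivAt

theorem hasDerivAt_derivWeierstrassP {z : ℂ} (hz : z ∉ L.lattice) :
    HasDerivAt L.derivWeierstrassP (6 * L.weierstrassP z ^ 2 - L.g₂ / 2) z := by
  have han := L.analyticOnNhd_derivWeierstrassP
  have hmem : ∀ᶠ w in 𝓝 z, w ∉ L.lattice := L.isOpen_compl_lattice.mem_nhds hz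
  have hmul : ∀ᶠ w in 𝓝 z, L.derivWeierstrassP w *
      (deriv L.derivWeierstrassP w - (6 * L.weierstrassP w ^ 2 - L.g₂ / 2)) = 0 := by
    filter_upwards [hmem.eventually_nhds] with w hw
    have hw' := hw.self_of_nhds
    have h1 := (han w hw').differentiableAt.hasDerivAt
    have h2 := L.hasDerivAt_weierstrassP hw'
    have h3 := h1.pow 2
    have h4 := (((h2.pow 3).const_mul 4).sub (h2.const_mul L.g₂)).sub_const L.g₃
    have h5 : (fun w ↦ 4 * L.weierstrassP w ^ 3 - L.g₂ * L.weierstrassP w - L.g₃) =ᶠ[𝓝 w]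
        (fun w ↦ L.derivWeierstrassP w ^ 2) := by
      filter_upwards [hw] with v hv using (L.derivWeierstrassP_sq v hv).symm
    have h6 := (h3.congr_of_eventuallyEq h5).unique h4
    norm_num at h6
    linear_combination h6 / 2
  have hg : AnalyticAt ℂ (fun w ↦ deriv L.derivWeierstrassP w -
      (6 * L.weierstrassP w ^ 2 - L.g₂ / 2)) z :=
    (han z hz).deriv.sub ((analyticAt_const.mul ((L.analyticOnNhd_weierstrassP z hz).pow 2)).sub
      analyticAt_const)
  have key : deriv L.derivWeierstrassP z - (6 * L.weierstrassP z ^ 2 - L.g₂ / 2) = 0 := by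
    rcases (han z hz).eventually_eq_zero_or_eventually_ne_zero with h0 | h0
    · exfalso
      have hall := han.eqOn_zero_of_preconnected_of_eventuallyEq_zero
        L.isPreconnected_compl_lattice hz h0
      obtain ⟨a, ha⟩ := L.isOpen_compl_lattice.exists_is_const_of_deriv_eq_zero
        L.isPreconnected_compl_lattice
        (fun w hw ↦ (L.analyticOnNhd_weierstrassP w hw).differentiableAt.differentiableWithinAt)
        (by rw [L.deriv_weierstrassP]; exact hall)
      obtain ⟨w, hw, hw'⟩ := L.exists_norm_weierstrassP_gt ‖a‖
      rw [ha w hw] at hw'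
      exact lt_irrefl _ hw'
    · have h1 : ∀ᶠ w in 𝓝[≠] z, deriv L.derivWeierstrassP w -
          (6 * L.weierstrassP w ^ 2 - L.g₂ / 2) = 0 := by
        filter_upwards [h0, nhdsWithin_le_nhds hmul] with w hw hw'
        exact (mul_eq_zero.1 hw').resolve_left hw
      exact tendsto_nhds_unique (hg.continuousAt.tendsto.mono_left nhdsWithin_le_nhds)
        (tendsto_const_nhds.congr' (h1.mono fun w hw ↦ hw.symm))
  rw [← sub_eq_zero.1 key]
  exact (han z hz).differentiableAt.hasDerivAt

theorem weierstrassP_pole : ∃ g : ℂ → ℂ, AnalyticAt ℂ g 0 ∧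
    ∀ᶠ z in 𝓝[≠] 0, L.weierstrassP z * sin (Real.pi * z) ^ 2 = g z := by
  have hs : AnalyticAt ℂ (fun z : ℂ ↦ sin (Real.pi * z)) 0 := by fun_prop
  obtain ⟨p, hp⟩ := hs
  have hd := hp.has_fpower_series_dslope_fslope
  refine ⟨fun z ↦ L.weierstrassPExcept 0 z * sin (Real.pi * z) ^ 2 +
    dslope (fun z : ℂ ↦ sin (Real.pi * z)) 0 z ^ 2,
    ((L.analyticAt_weierstrassPExcept 0).mul (hp.analyticAt.pow 2)).add (hd.analyticAt.pow 2), ?_⟩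
  filter_upwards [self_mem_nhdsWithin] with z hz
  have h0 := L.weierstrassPExcept_def 0 z
  rw [dslope_of_ne _ hz, slope_def_field]
  have hz' : z ≠ 0 := hz
  simp at h0 ⊢
  rw [h0]
  field_simp
  ring

end PeriodPair

end

section

open Complex Filter Topology UpperHalfPlane

theorem false_of_isIntegral_invariants {τ : ℍ} {c : ℂ} (hc : c ≠ 0)
    (hA : IsIntegral ℤ (c ^ 4 * ((tauPair τ).g₂ / 2)))
    (hB : IsIntegral ℤ (c ^ 2 * EisensteinSeries.G2 τ))
    (he : IsIntegral ℤ (c ^ 2 * (tauPair τ).weierstrassP (1 / 2))) : False := by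
  set L := tauPair τ with hL
  have hτ : 0 < (τ : ℂ).im := τ.2
  have hnot : ∀ z : ℂ, (∀ m n : ℤ, z ≠ m + n * τ) ↔ z ∉ L.lattice := by
    intro z
    rw [hL, mem_tauPair_lattice]
    simp
  have h1 : (1 : ℂ) ∈ L.lattice := mem_tauPair_lattice.2 ⟨1, 0, by simp⟩
  have h2 : (τ : ℂ) ∈ L.lattice := mem_tauPair_lattice.2 ⟨0, 1, by simp⟩
  have hhalf : (1 / 2 : ℂ) ∉ L.lattice := (hnot _).1 (half_ne_int_add hτ)
  have hq : QuasiElliptic τ (-2 * Real.pi * Complex.I * c) (fun z ↦ c ^ 2 * L.weierstrassP z)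
      (fun z ↦ c * cotSum τ z) := by
    refine ⟨hτ, fun z hz ↦ ?_, fun z hz ↦ ?_, fun z ↦ ?_, fun z ↦ ?_, fun z ↦ ?_, fun z ↦ ?_,
      ?_, ?_⟩
    · exact analyticAt_const.mul (L.analyticOnNhd_weierstrassP z ((hnot z).1 hz))
    · refine analyticAt_const.mul (DifferentiableOn.analyticAt (s := (L.lattice : Set ℂ)ᶜ) ?_
        (L.isOpen_compl_lattice.mem_nhds ((hnot z).1 hz)))
      exact fun w hw ↦ (differentiableAt_cotSum hw).differentiableWithinAt
    · simp only [L.weierstrassP_add_coe z ⟨1, h1⟩]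
    · simp only [L.weierstrassP_add_coe z ⟨τ, h2⟩]
    · simp only [cotSum_add_one]
    · simp only [cotSum_add_self hτ]
      ring
    · obtain ⟨g, hg, hg'⟩ := L.weierstrassP_pole
      refine ⟨fun z ↦ c ^ 2 * g z, analyticAt_const.mul hg, hg'.mono fun z hz ↦ ?_⟩
      simp only [mul_assoc, hz]
    · obtain ⟨g, hg, hg'⟩ := cotSum_pole hτ
      refine ⟨fun z ↦ c * g z, analyticAt_const.mul hg, hg'.mono fun z hz ↦ ?_⟩
      simp only [mul_assoc, hz]
  have hneg : (-(1 / 2) : ℂ) + 1 = 1 / 2 := by norm_num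
  refine hq.false_of_isIntegral (P₁ := fun z ↦ c ^ 3 * L.derivWeierstrassP z) (c := c) ?_ ?_ hc
    (L.lattice : Set ℂ)ᶜ L.isOpen_compl_lattice hhalf ?_ ?_ ?_ rfl ?_ ?_ hA hB he
  · simp [hc, Real.pi_ne_zero]
  · intro R
    obtain ⟨z, hz, hz'⟩ := L.exists_norm_weierstrassP_gt (R / ‖c ^ 2‖)
    refine ⟨z, (hnot z).2 hz, ?_⟩
    rw [div_lt_iff₀ (norm_pos_iff.2 (pow_ne_zero 2 hc))] at hz'
    simpa [mul_comm] using hz'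
  · intro z hz
    refine ((L.hasDerivAt_weierstrassP hz).const_mul (c ^ 2)).congr_deriv ?_
    field_simp
  · intro z hz
    refine ((L.hasDerivAt_derivWeierstrassP hz).const_mul (c ^ 3)).congr_deriv ?_
    field_simp
  · intro z hz
    refine ((hasDerivAt_cotSum hz).const_mul c).congr_deriv ?_
    field_simp
    rw [hL]
  · have h3 := L.derivWeierstrassP_neg (1 / 2)
    have h4 := L.derivWeierstrassP_add_coe (-(1 / 2)) ⟨1, h1⟩
    simp only [hneg] at h4
    rw [h3, self_eq_neg] at h4
    simp only [h4, mul_zero]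
  · have h3 := cotSum_neg (τ := τ) (1 / 2)
    have h4 := cotSum_add_one (τ := τ) (-(1 / 2))
    rw [hneg, h3, self_eq_neg] at h4
    simp only [h4, mul_zero]

theorem exists_int_smul_isIntegral {x : ℂ} (hx : IsAlgebraic ℚ x) :
    ∃ n : ℤ, n ≠ 0 ∧ IsIntegral ℤ ((n : ℂ) * x) := by
  have : IsAlgebraic ℤ x := (IsFractionRing.isAlgebraic_iff ℤ ℚ ℂ).2 hx
  obtain ⟨n, hn, h⟩ := this.exists_integral_multiple
  exact ⟨n, hn, by simpa using h⟩

theorem isAlgebraic_of_cubic {x p q : ℂ} (hp : IsAlgebraic ℚ p) (hq : IsAlgebraic ℚ q)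
    (h : x ^ 3 = p * x + q) : IsAlgebraic ℚ x := by
  let K := integralClosure ℚ ℂ
  let p' : K := ⟨p, hp.isIntegral⟩
  let q' : K := ⟨q, hq.isIntegral⟩
  have hx : IsIntegral K x := by
    refine ⟨Polynomial.X ^ 3 - (Polynomial.C p' * Polynomial.X + Polynomial.C q'), ?_, ?_⟩
    · refine Polynomial.monic_X_pow_sub (n := 3) ?_
      refine lt_of_le_of_lt Polynomial.degree_linear_le ?_
      norm_num
    · simp [h, p', q']
  exact (isIntegral_trans (R := ℚ) (A := K) x hx).isAlgebraic

/-- Schneider's theorem on Eisenstein series: the values of `E₂`, `E₄`, `E₆` at a point cannot be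
made simultaneously algebraic by a homogeneous rescaling. -/
theorem not_isAlgebraic_E2_E₄_E₆ {τ : ℍ} {l : ℂ} (hl : l ≠ 0)
    (h2 : IsAlgebraic ℚ (l ^ 2 * EisensteinSeries.E2 τ))
    (h4 : IsAlgebraic ℚ (l ^ 4 * ModularForm.E₄ τ))
    (h6 : IsAlgebraic ℚ (l ^ 6 * ModularForm.E₆ τ)) : False := by
  have hpi : (Real.pi : ℂ) ≠ 0 := by exact_mod_cast Real.pi_ne_zero
  have hrat : ∀ q : ℚ, IsAlgebraic ℚ (q : ℂ) := fun q ↦ isAlgebraic_algebraMap q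
  set c := l / Real.pi with hc
  have hc0 : c ≠ 0 := div_ne_zero hl hpi
  set A := c ^ 4 * ((tauPair τ).g₂ / 2) with hA
  set B := c ^ 2 * EisensteinSeries.G2 τ with hB
  set e := c ^ 2 * (tauPair τ).weierstrassP (1 / 2) with he
  have hA' : IsAlgebraic ℚ A := by
    convert! (hrat (2 / 3)).mul h4 using 1
    rw [hA, tauPair_g₂, hc]
    push_cast
    field_simp
    ring
  have hB' : IsAlgebraic ℚ B := by
    convert! (hrat (1 / 3)).mul h2 using 1
    rw [hB, G2_eq_E2, hc]
    push_cast
    field_simp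
  have he' : IsAlgebraic ℚ e := by
    refine isAlgebraic_of_cubic ((hrat (1 / 2)).mul hA') ((hrat (2 / 27)).mul h6) ?_
    have hhalf : (1 / 2 : ℂ) ∉ (tauPair τ).lattice := by
      simpa [tauPair] using (tauPair τ).ω₁_div_two_notMem_lattice
    have h1 : (1 : ℂ) ∈ (tauPair τ).lattice := mem_tauPair_lattice.2 ⟨1, 0, by simp⟩
    have h7 := (tauPair τ).derivWeierstrassP_sq _ hhalf
    have h8 := (tauPair τ).derivWeierstrassP_neg (1 / 2)
    have h9 := (tauPair τ).derivWeierstrassP_add_coe (-(1 / 2)) ⟨1, h1⟩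
    simp only [show (-(1 / 2) : ℂ) + 1 = 1 / 2 by norm_num] at h9
    rw [h8, self_eq_neg] at h9
    rw [h9, tauPair_g₃] at h7
    have hlc : l = c * Real.pi := by rw [hc]; field_simp
    rw [he, hA, hlc]
    push_cast
    linear_combination -c ^ 6 / 4 * h7
  obtain ⟨n₁, hn₁, hi₁⟩ := exists_int_smul_isIntegral hA'
  obtain ⟨n₂, hn₂, hi₂⟩ := exists_int_smul_isIntegral hB'
  obtain ⟨n₃, hn₃, hi₃⟩ := exists_int_smul_isIntegral he'
  have hInt : ∀ n : ℤ, IsIntegral ℤ (n : ℂ) := fun n ↦ isIntegral_algebraMap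
  refine false_of_isIntegral_invariants (τ := τ) (c := ((n₁ * n₂ * n₃ : ℤ) : ℂ) * c) ?_ ?_ ?_ ?_
  · refine mul_ne_zero ?_ hc0
    exact_mod_cast mul_ne_zero (mul_ne_zero hn₁ hn₂) hn₃
  · convert! (hInt (n₁ ^ 3 * n₂ ^ 4 * n₃ ^ 4)).mul hi₁ using 1
    rw [hA]
    push_cast
    ring
  · convert! (hInt (n₁ ^ 2 * n₂ * n₃ ^ 2)).mul hi₂ using 1
    rw [hB]
    push_cast
    ring
  · convert! (hInt (n₁ ^ 2 * n₂ ^ 2 * n₃)).mul hi₃ using 1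
    rw [he]
    push_cast
    ring

end

section

open Filter Topology UpperHalfPlane ModularForm MatrixGroups Derivative
open scoped Manifold

theorem tendsto_atImInfty_of_hasSum {F : ℍ → ℂ} {c : ℕ → ℂ}
    (hF : ∀ τ : ℍ, HasSum (fun m ↦ c m • Function.Periodic.qParam 1 τ ^ m) (F τ)) :
    Tendsto F atImInfty (𝓝 (c 0)) := by
  have hq0 : ∀ τ : ℍ, Function.Periodic.qParam 1 τ ≠ 0 := fun τ ↦ Complex.exp_ne_zero _
  have hb : IsBoundedAtImInfty (fun τ : ℍ ↦ (F τ - c 0) / Function.Periodic.qParam 1 τ) := by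
    refine isBoundedAtImInfty_of_hasSum_qExpansion (c := fun m ↦ c (m + 1)) one_pos fun τ ↦ ?_
    have h1 := (hasSum_nat_add_iff' 1).2 (hF τ)
    simp only [Finset.sum_range_one, pow_zero, smul_eq_mul, mul_one] at h1
    convert! h1.div_const (Function.Periodic.qParam 1 τ) using 1
    ext m
    simp only [smul_eq_mul]
    have := hq0 τ
    field_simp
    ring
  have h2 : Tendsto (fun τ : ℍ ↦ (F τ - c 0) / Function.Periodic.qParam 1 τ *
      Function.Periodic.qParam 1 τ) atImInfty (𝓝 0) := by
    have h3 := (Asymptotics.isLittleO_one_iff ℝ).2 (qParam_tendsto_atImInfty one_pos)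
    have h4 := Asymptotics.IsBigO.mul_isLittleO hb h3
    simp only [Pi.one_apply, mul_one] at h4
    exact (Asymptotics.isLittleO_one_iff ℝ).1 h4
  have h3 := h2.add_const (c 0)
  rw [zero_add] at h3
  refine h3.congr fun τ ↦ ?_
  rw [div_mul_cancel₀ _ (hq0 τ), sub_add_cancel]

theorem tendsto_E2_atImInfty : Tendsto EisensteinSeries.E2 atImInfty (𝓝 1) := by
  have := tendsto_atImInfty_of_hasSum (F := EisensteinSeries.E2) (fun τ ↦ by
    simpa only [Function.Periodic.qParam, Complex.ofReal_one, div_one] using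
      EisensteinSeries.hasSum_qExpansion_E2 (z := τ))
  simpa using this

theorem tendsto_E_atImInfty {k : ℕ} (hk : 3 ≤ k) (hk2 : Even k) :
    Tendsto (E hk) atImInfty (𝓝 1) := by
  have := tendsto_atImInfty_of_hasSum (F := E hk)
    (fun τ ↦ hasSum_qExpansion one_pos
      (SlashInvariantFormClass.periodic_comp_ofComplex (E hk) one_mem_strictPeriods_SL)
      (ModularFormClass.holo (E hk)) (ModularFormClass.bdd_at_infty (E hk)) τ)
  rwa [EisensteinSeries.E_qExpansion_coeff_zero hk hk2] at this

theorem tendsto_normalizedDeriv_atImInfty {F : ℍ → ℂ} (hF : MDiff F) {c : ℂ}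
    (h : Tendsto F atImInfty (𝓝 c)) :
    Tendsto (normalizedDerivOfComplex F) atImInfty (𝓝 0) := by
  have hd : DifferentiableOn ℂ (F ∘ ofComplex) {z | 0 < z.im} := mdifferentiable_iff.1 hF
  rw [Metric.tendsto_nhds] at h ⊢
  intro ε hε
  obtain ⟨A, hA⟩ := (atImInfty_mem _).1 (h ε hε)
  refine (atImInfty_mem _).2 ⟨max A 0 + 2, fun z hz ↦ ?_⟩
  have hA' : ∀ w : ℂ, 0 < w.im → A ≤ w.im → ‖(F ∘ ofComplex) w - c‖ ≤ ε := by
    intro w hw hwA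
    have := hA (ofComplex w) (by rwa [ofComplex_apply_of_im_pos hw])
    exact (dist_eq_norm (F (ofComplex w)) c).symm.trans_le this.le
  have him : ∀ w ∈ Metric.closedBall (z : ℂ) 1, max A 0 + 1 ≤ w.im := by
    intro w hw
    have h1 : |(w - z).im| ≤ 1 := (Complex.abs_im_le_norm _).trans (mem_closedBall_iff_norm.1 hw)
    have h2 := (abs_le.1 h1).1
    have h3 : max A 0 + 2 ≤ (z : ℂ).im := hz
    rw [Complex.sub_im] at h2
    linarith
  have hA0 : 0 ≤ max A 0 := le_max_right _ _
  have hA1 : A ≤ max A 0 := le_max_left _ _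
  have hdiff : DiffContOnCl ℂ (fun w ↦ (F ∘ ofComplex) w - c) (Metric.ball (z : ℂ) 1) := by
    refine DifferentiableOn.diffContOnCl ?_
    rw [closure_ball _ one_ne_zero]
    refine (hd.mono fun w hw ↦ ?_).sub_const c
    have := him w hw
    show 0 < w.im
    linarith
  have hb := Complex.norm_deriv_le_of_forall_mem_sphere_norm_le (c := (z : ℂ)) one_pos hdiff
    (C := ε) fun w hw ↦ by
      have := him w (Metric.sphere_subset_closedBall hw)
      exact hA' w (by linarith) (by linarith)
  rw [deriv_sub_const, div_one] at hb
  show dist (normalizedDerivOfComplex F z) 0 < ε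
  rw [dist_zero_right, normalizedDerivOfComplex, norm_mul]
  have hpi : ‖(2 * (Real.pi : ℂ) * Complex.I)⁻¹‖ < 1 := by
    simp only [norm_inv, norm_mul, Complex.norm_I, mul_one, Complex.norm_real, Complex.norm_ofNat]
    refine inv_lt_one_of_one_lt₀ ?_
    rw [Real.norm_of_nonneg Real.pi_pos.le]
    linarith [Real.pi_gt_three]
  calc _ ≤ ‖(2 * (Real.pi : ℂ) * Complex.I)⁻¹‖ * ε := by gcongr
    _ < 1 * ε := by gcongr
    _ = ε := one_mul ε

theorem eq_zero_of_slash_of_isZeroAtImInfty {k : ℤ} (hk : k < 12) {F : ℍ → ℂ} (hF : MDiff F)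
    (hs : ∀ γ : SL(2, ℤ), F ∣[k] γ = F) (h0 : IsZeroAtImInfty F) : F = 0 := by
  let f : CuspForm 𝒮ℒ k :=
    { toFun := F
      slash_action_eq' := fun _ ⟨γ, hγ⟩ ↦ hγ ▸ hs γ
      holo' := hF
      zero_at_cusps' := fun {c} hc ↦ by
        rw [OnePoint.isZeroAt_iff_forall_SL2Z hc]
        intro γ _
        rw [hs γ]
        exact h0 }
  have hf : f = 0 := rank_zero_iff_forall_zero.1 (CuspForm.rank_eq_zero_of_weight_lt_twelve hk) f
  exact congrArg DFunLike.coe hf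

end

section

open Filter Topology UpperHalfPlane ModularForm MatrixGroups Derivative EisensteinSeries
open scoped Manifold

theorem slash_eq_self_of_modularForm {k : ℤ} (f : ModularForm 𝒮ℒ k) (γ : SL(2, ℤ)) :
    (f : ℍ → ℂ) ∣[k] γ = f :=
  f.slash_action_eq' _ ⟨γ, rfl⟩

theorem tendsto_serreDerivative_atImInfty {F : ℍ → ℂ} (hF : MDiff F) (k c : ℂ)
    (h : Tendsto F atImInfty (𝓝 c)) :
    Tendsto (serreDerivative k F) atImInfty (𝓝 (-(k * 12⁻¹ * c))) := by
  have := (tendsto_normalizedDeriv_atImInfty hF h).sub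
    ((tendsto_E2_atImInfty.const_mul (k * 12⁻¹)).mul h)
  simpa using! this

theorem serreDerivative_E₄ : serreDerivative 4 E₄ = fun z ↦ -(1 / 3) * E₆ z := by
  have h4 := ModularFormClass.holo E₄
  have h6 := ModularFormClass.holo E₆
  have key : serreDerivative 4 E₄ + (1 / 3 : ℂ) • (E₆ : ℍ → ℂ) = 0 := by
    refine eq_zero_of_slash_of_isZeroAtImInfty (k := 6) (by norm_num)
      ((serreDerivative_mdifferentiable _ h4).add (h6.const_smul _)) (fun γ ↦ ?_) ?_
    · rw [SlashAction.add_slash, SL_smul_slash, slash_eq_self_of_modularForm E₆ γ]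
      congr 1
      exact_mod_cast serreDerivative_slash_invariant h4 (slash_eq_self_of_modularForm E₄ γ)
    · have := (tendsto_serreDerivative_atImInfty h4 4 1 (tendsto_E_atImInfty _ (by decide))).add
        ((tendsto_E_atImInfty (k := 6) (by norm_num) (by decide)).const_smul (1 / 3 : ℂ))
      refine (le_of_eq_of_le rfl this).trans (le_of_eq ?_)
      norm_num
  ext z
  have := congrFun key z
  simp only [Pi.add_apply, Pi.smul_apply, smul_eq_mul, Pi.zero_apply] at this
  linear_combination this

theorem serreDerivative_E₆ : serreDerivative 6 E₆ = fun z ↦ -(1 / 2) * E₄ z ^ 2 := by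
  have h4 := ModularFormClass.holo E₄
  have h6 := ModularFormClass.holo E₆
  have key : serreDerivative 6 E₆ + (1 / 2 : ℂ) • ((E₄ : ℍ → ℂ) * (E₄ : ℍ → ℂ)) = 0 := by
    refine eq_zero_of_slash_of_isZeroAtImInfty (k := 8) (by norm_num)
      ((serreDerivative_mdifferentiable _ h6).add ((h4.mul h4).const_smul _)) (fun γ ↦ ?_) ?_
    · rw [SlashAction.add_slash, SL_smul_slash, show (8 : ℤ) = 4 + 4 by norm_num, mul_slash_SL2,
        slash_eq_self_of_modularForm E₄ γ]
      congr 1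
      exact_mod_cast serreDerivative_slash_invariant h6 (slash_eq_self_of_modularForm E₆ γ)
    · have h := tendsto_E_atImInfty (k := 4) (by norm_num) (by decide)
      have := (tendsto_serreDerivative_atImInfty h6 6 1 (tendsto_E_atImInfty _ (by decide))).add
        ((h.mul h).const_smul (1 / 2 : ℂ))
      refine (le_of_eq_of_le rfl this).trans (le_of_eq ?_)
      norm_num
  ext z
  have := congrFun key z
  simp only [Pi.add_apply, Pi.smul_apply, Pi.mul_apply, smul_eq_mul, Pi.zero_apply] at this
  linear_combination this

theorem normalizedDeriv_inv_denom (γ : SL(2, ℤ)) (z : ℍ) :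
    normalizedDerivOfComplex (fun z ↦ (γ 1 0 : ℂ) / denom γ z) z =
      -(2 * Real.pi * Complex.I)⁻¹ * ((γ 1 0 : ℂ) / denom γ z) ^ 2 := by
  have hd := denom_ne_zero (γ : GL (Fin 2) ℝ) z
  have h1 : HasDerivAt (fun w : ℂ ↦ (γ 1 0 : ℂ) / ((γ 1 0 : ℂ) * w + γ 1 1))
      (-((γ 1 0 : ℂ) / denom γ z) ^ 2) z := by
    have h2 := (hasDerivAt_const (z : ℂ) (γ 1 0 : ℂ)).div
      (((hasDerivAt_id (z : ℂ)).const_mul (γ 1 0 : ℂ)).add_const (γ 1 1 : ℂ))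
      (by simpa [denom] using! hd)
    refine h2.congr_deriv ?_
    have : denom γ z = (γ 1 0 : ℂ) * z + γ 1 1 := by simp [denom]
    rw [this] at hd ⊢
    simp only [id]
    field_simp
    ring
  have h2 : (fun z : ℍ ↦ (γ 1 0 : ℂ) / denom γ z) ∘ ofComplex =ᶠ[𝓝 (z : ℂ)]
      (fun w : ℂ ↦ (γ 1 0 : ℂ) / ((γ 1 0 : ℂ) * w + γ 1 1)) := by
    filter_upwards [isOpen_upperHalfPlaneSet.mem_nhds z.2] with w hw
    simp [denom, ofComplex_apply_of_im_pos hw]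
  rw [normalizedDerivOfComplex, h2.deriv_eq, h1.deriv]
  ring

theorem E2_slash_eq (γ : SL(2, ℤ)) : E2 ∣[(2 : ℤ)] γ =
    E2 + (12 * (2 * (Real.pi : ℂ) * Complex.I)⁻¹) • fun z : ℍ ↦ (γ 1 0 : ℂ) / denom γ z := by
  rw [E2_slash_action]
  ext z
  have hpi : (Real.pi : ℂ) ≠ 0 := by exact_mod_cast Real.pi_ne_zero
  have := denom_ne_zero (γ : GL (Fin 2) ℝ) z
  simp only [D2, riemannZeta_two, Pi.sub_apply, Pi.add_apply, Pi.smul_apply, smul_eq_mul]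
  field_simp
  ring_nf
  simp

theorem normalizedDeriv_E2 :
    normalizedDerivOfComplex E2 = fun z ↦ (1 / 12) * (E2 z ^ 2 - E₄ z) := by
  have h4 := ModularFormClass.holo E₄
  have h2 := E2_mdifferentiable
  set ν := (2 * (Real.pi : ℂ) * Complex.I)⁻¹ with hν
  have hE2 : ∀ γ : SL(2, ℤ), E2 ∣[(2 : ℤ)] γ =
      E2 + (12 * ν) • fun z : ℍ ↦ (γ 1 0 : ℂ) / denom γ z := E2_slash_eq
  have hmd : ∀ γ : SL(2, ℤ), MDiff (fun z : ℍ ↦ (γ 1 0 : ℂ) / denom γ z) := by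
    intro γ
    rw [mdifferentiable_iff]
    intro w hw
    refine DifferentiableAt.differentiableWithinAt ?_
    have hd := denom_ne_zero (γ : GL (Fin 2) ℝ) ⟨w, hw⟩
    have h3 : (fun z : ℍ ↦ (γ 1 0 : ℂ) / denom γ z) ∘ ofComplex =ᶠ[𝓝 w]
        (fun w : ℂ ↦ (γ 1 0 : ℂ) / ((γ 1 0 : ℂ) * w + γ 1 1)) := by
      filter_upwards [isOpen_upperHalfPlaneSet.mem_nhds hw] with w hw
      simp [denom, ofComplex_apply_of_im_pos hw]
    refine DifferentiableAt.congr_of_eventuallyEq ?_ h3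
    refine DifferentiableAt.div (by fun_prop) (by fun_prop) ?_
    simpa [denom] using! hd
  have key : normalizedDerivOfComplex E2 - (1 / 12 : ℂ) • (E2 * E2) +
      (1 / 12 : ℂ) • (E₄ : ℍ → ℂ) = 0 := by
    refine eq_zero_of_slash_of_isZeroAtImInfty (k := 4) (by norm_num)
      (((normalizedDerivOfComplex_mdifferentiable h2).sub ((h2.mul h2).const_smul _)).add
        (h4.const_smul _)) (fun γ ↦ ?_) ?_
    · have hD := normalizedDerivOfComplex_SL_slash (k := 2) h2 (γ := γ)
      have hm := mul_slash_SL2 2 2 γ E2 E2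
      norm_num at hm
      rw [show (2 : ℤ) + 2 = 4 by norm_num, show ((2 : ℤ) : ℂ) = 2 by norm_num, ← hν] at hD
      rw [SlashAction.add_slash, sub_eq_add_neg, SlashAction.add_slash, SlashAction.neg_slash,
        SL_smul_slash, SL_smul_slash, slash_eq_self_of_modularForm E₄ γ, hm, hE2]
      rw [hE2, normalizedDerivOfComplex_add _ _ h2 ((hmd γ).const_smul _),
        normalizedDerivOfComplex_smul _ _ (hmd γ)] at hD
      ext z
      have hDz := congrFun hD z
      simp only [Pi.add_apply, Pi.smul_apply, Pi.mul_apply, Pi.sub_apply, Pi.neg_apply, smul_eq_mul,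
        normalizedDeriv_inv_denom, ← hν] at hDz ⊢
      linear_combination -hDz
    · have := ((tendsto_normalizedDeriv_atImInfty h2 tendsto_E2_atImInfty).sub
        ((tendsto_E2_atImInfty.mul tendsto_E2_atImInfty).const_smul (1 / 12 : ℂ))).add
        ((tendsto_E_atImInfty (k := 4) (by norm_num) (by decide)).const_smul (1 / 12 : ℂ))
      norm_num at this
      simpa [IsZeroAtImInfty, ZeroAtFilter] using! this
  ext z
  have := congrFun key z
  simp only [Pi.add_apply, Pi.sub_apply, Pi.smul_apply, Pi.mul_apply, smul_eq_mul, Pi.zero_apply]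
    at this
  linear_combination this

end

section

open MvPolynomial

noncomputable section

variable (K : Type*) [Field K]

/-- The derivation expressing Ramanujan's differential equations. -/
def ramanujanDer : Derivation K (MvPolynomial (Fin 3) K) (MvPolynomial (Fin 3) K) :=
  mkDerivation K ![C (1 / 12) * (X 0 ^ 2 - X 1), C (1 / 3) * (X 0 * X 1 - X 2),
    C (1 / 2) * (X 0 * X 2 - X 1 ^ 2)]

/-- The Euler derivation for the grading with weights `2, 4, 6`. -/
def weightDer : Derivation K (MvPolynomial (Fin 3) K) (MvPolynomial (Fin 3) K) :=
  mkDerivation K ![2 * X 0, 4 * X 1, 6 * X 2]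

variable {K}

theorem ramanujanDer_X0 : ramanujanDer K (X 0) = C (1 / 12) * (X 0 ^ 2 - X 1) := by
  simp [ramanujanDer, mkDerivation_X]

theorem ramanujanDer_X1 : ramanujanDer K (X 1) = C (1 / 3) * (X 0 * X 1 - X 2) := by
  simp [ramanujanDer, mkDerivation_X]

theorem ramanujanDer_X2 : ramanujanDer K (X 2) = C (1 / 2) * (X 0 * X 2 - X 1 ^ 2) := by
  simp [ramanujanDer, mkDerivation_X]

theorem weightDer_X0 : weightDer K (X 0) = 2 * X 0 := by
  simp [weightDer, mkDerivation_X]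

theorem weightDer_X1 : weightDer K (X 1) = 4 * X 1 := by
  simp [weightDer, mkDerivation_X]

theorem weightDer_X2 : weightDer K (X 2) = 6 * X 2 := by
  simp [weightDer, mkDerivation_X]

theorem der_ofNat (D : Derivation K (MvPolynomial (Fin 3) K) (MvPolynomial (Fin 3) K))
    (n : ℕ) [n.AtLeastTwo] :
    D (OfNat.ofNat n : MvPolynomial (Fin 3) K) = 0 :=
  D.map_natCast n

theorem weightDer_ramanujanDer (P : MvPolynomial (Fin 3) K) :
    weightDer K (ramanujanDer K P) = ramanujanDer K (weightDer K P) + 2 * ramanujanDer K P := by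
  have h : ⁅weightDer K, ramanujanDer K⁆ = (2 : MvPolynomial (Fin 3) K) • ramanujanDer K := by
    have h2 : ramanujanDer K 2 = 0 := der_ofNat _ 2
    have h4 : ramanujanDer K 4 = 0 := der_ofNat _ 4
    have h6 : ramanujanDer K 6 = 0 := der_ofNat _ 6
    refine derivation_ext fun i ↦ ?_
    fin_cases i <;>
      simp only [Fin.mk_zero, Fin.mk_one, Fin.reduceFinMk, Derivation.commutator_apply,
        ramanujanDer_X0, ramanujanDer_X1, ramanujanDer_X2, Derivation.smul_apply, weightDer_X0,
        weightDer_X1, weightDer_X2, Derivation.leibniz, map_sub, h2, h4, h6,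
        Derivation.leibniz_pow, smul_eq_mul, nsmul_eq_mul, derivation_C] <;>
      push_cast <;> ring
  have := congrArg (fun d ↦ d P) h
  simp only [Derivation.commutator_apply, Derivation.smul_apply, smul_eq_mul] at this
  linear_combination this

theorem weightDer_iterate {k : ℕ} {P : MvPolynomial (Fin 3) K}
    (hP : weightDer K P = (k : MvPolynomial (Fin 3) K) * P) (r : ℕ) :
    weightDer K ((ramanujanDer K)^[r] P) =
      ((k + 2 * r : ℕ) : MvPolynomial (Fin 3) K) * (ramanujanDer K)^[r] P := by
  induction r with
  | zero => simpa using hP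
  | succ r ih =>
    rw [Function.iterate_succ_apply', weightDer_ramanujanDer, ih, Derivation.leibniz,
      Derivation.map_natCast]
    push_cast
    simp only [smul_eq_mul]
    ring

variable [CharZero K]

theorem C_third : (C (1 / 3) : MvPolynomial (Fin 3) K) = 4 * C (1 / 12) := by
  rw [show (4 : MvPolynomial (Fin 3) K) = C 4 from (map_ofNat C _).symm, ← C_mul]; norm_num

theorem C_half : (C (1 / 2) : MvPolynomial (Fin 3) K) = 6 * C (1 / 12) := by
  rw [show (6 : MvPolynomial (Fin 3) K) = C 6 from (map_ofNat C _).symm, ← C_mul]; norm_num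

theorem pderiv_ramanujanDer (P : MvPolynomial (Fin 3) K) :
    pderiv 0 (ramanujanDer K P) = ramanujanDer K (pderiv 0 P) + C (1 / 12) * weightDer K P := by
  have h : ⁅(pderiv 0 : Derivation K (MvPolynomial (Fin 3) K) (MvPolynomial (Fin 3) K)),
      ramanujanDer K⁆ = (C (1 / 12) : MvPolynomial (Fin 3) K) • weightDer K := by
    have h4 : pderiv 0 (4 : MvPolynomial (Fin 3) K) = 0 := der_ofNat _ 4
    have h6 : pderiv 0 (6 : MvPolynomial (Fin 3) K) = 0 := der_ofNat _ 6
    refine derivation_ext fun i ↦ ?_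
    fin_cases i <;>
      simp only [Fin.mk_zero, Fin.mk_one, Fin.reduceFinMk, Derivation.commutator_apply,
        ramanujanDer_X0, ramanujanDer_X1, ramanujanDer_X2, Derivation.smul_apply, weightDer_X0,
        weightDer_X1, weightDer_X2, C_third, C_half, Derivation.leibniz, map_sub, h4, h6,
        Derivation.map_one_eq_zero, Derivation.leibniz_pow, pderiv_X_self, pderiv_C,
        smul_eq_mul, nsmul_eq_mul,
        pderiv_X_of_ne (show (1 : Fin 3) ≠ 0 by decide),
        pderiv_X_of_ne (show (2 : Fin 3) ≠ 0 by decide), map_zero] <;>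
      push_cast <;> ring
  have := congrArg (fun d ↦ d P) h
  simp only [Derivation.commutator_apply, Derivation.smul_apply, smul_eq_mul] at this
  linear_combination this

theorem pderiv_iterate {k : ℕ} {P : MvPolynomial (Fin 3) K}
    (hP : weightDer K P = (k : MvPolynomial (Fin 3) K) * P)
    (h0 : pderiv 0 P = 0) (r : ℕ) :
    pderiv 0 ((ramanujanDer K)^[r + 1] P) =
      C (1 / 12) * (((r + 1) * (k + r) : ℕ) : MvPolynomial (Fin 3) K) * (ramanujanDer K)^[r] P := by
  induction r with
  | zero =>
    rw [Function.iterate_succ_apply', pderiv_ramanujanDer]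
    simp [h0, hP]
    ring
  | succ r ih =>
    rw [Function.iterate_succ_apply', pderiv_ramanujanDer, ih, weightDer_iterate hP,
      Derivation.leibniz, Derivation.leibniz, Derivation.map_natCast, derivation_C,
      ← Function.iterate_succ_apply' (f := ramanujanDer K)]
    push_cast
    simp only [smul_eq_mul]
    ring

end

end

section

open Polynomial

/-- A prime of `A[X]` meeting `A` trivially is, up to denominators in `A`, generated by a polynomial
with nonvanishing derivative. -/
theorem Polynomial.exists_pseudo_generator_ker {A B : Type*} [CommRing A] [IsDomain A] [CharZero A]
    [CommRing B] [IsDomain B] (ψ : A[X] →+* B) (h : ∀ a, ψ (C a) = 0 → a = 0)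
    (hne : ∃ P ≠ 0, ψ P = 0) :
    ∃ m, ψ m = 0 ∧ ψ (derivative m) ≠ 0 ∧
      ∀ P, ψ P = 0 → ∃ a Q, a ≠ 0 ∧ C a * P = Q * m := by
  classical
  have hex : ∃ n, ∃ P, P ≠ 0 ∧ ψ P = 0 ∧ P.natDegree = n :=
    let ⟨P, h0, h1⟩ := hne; ⟨_, P, h0, h1, rfl⟩
  obtain ⟨m, hm0, hm, hmd⟩ := Nat.find_spec hex
  have hmin : ∀ P, ψ P = 0 → P.natDegree < m.natDegree → P = 0 := by
    intro P hP hd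
    by_contra h0
    exact Nat.find_min hex (hmd ▸ hd) ⟨P, h0, hP, rfl⟩
  have hpos : 0 < m.natDegree := by
    rw [Nat.pos_iff_ne_zero]
    intro hd
    rw [natDegree_eq_zero] at hd
    obtain ⟨a, rfl⟩ := hd
    exact hm0 (by rw [h a hm, C_0])
  refine ⟨m, hm, fun hdm ↦ ?_, ?_⟩
  · have := hmin _ hdm (natDegree_derivative_lt hpos.ne')
    exact hpos.ne' (derivative_eq_zero.1 this)
  · have key : ∀ n, ∀ P, ψ P = 0 → P.natDegree < n → ∃ a Q, a ≠ 0 ∧ C a * P = Q * m := by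
      intro n
      induction n with
      | zero => intro P _ hn; omega
      | succ n ih =>
        intro P hP hn
        rcases lt_or_ge P.natDegree m.natDegree with hlt | hge
        · exact ⟨1, 0, one_ne_zero, by simp [hmin P hP hlt]⟩
        · have hP0 : P ≠ 0 := by rintro rfl; simp at hge; omega
          set S := C P.leadingCoeff * X ^ (P.natDegree - m.natDegree) with hS
          have hl : m.leadingCoeff ≠ 0 := leadingCoeff_ne_zero.2 hm0
          have hlP : P.leadingCoeff ≠ 0 := leadingCoeff_ne_zero.2 hP0
          have hlt : (C m.leadingCoeff * P - S * m).natDegree < P.natDegree := by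
            have hdeg : (C m.leadingCoeff * P).degree = (S * m).degree := by
              rw [degree_mul, degree_mul, degree_C hl, hS, degree_C_mul_X_pow _ hlP,
                degree_eq_natDegree hP0, degree_eq_natDegree hm0]
              norm_cast; omega
            have h1 := degree_sub_lt_left hdeg (mul_ne_zero (C_ne_zero.2 hl) hP0)
              (by
                rw [leadingCoeff_mul, leadingCoeff_mul, leadingCoeff_C, hS,
                  leadingCoeff_mul_X_pow, leadingCoeff_C, mul_comm])
            rw [degree_mul, degree_C hl, zero_add] at h1
            rcases eq_or_ne (C m.leadingCoeff * P - S * m) 0 with h2 | h2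
            · rw [h2, natDegree_zero]
              exact hpos.trans_le hge
            · exact natDegree_lt_natDegree h2 h1
          obtain ⟨a, Q, ha, hQ⟩ := ih (C m.leadingCoeff * P - S * m)
            (by simp [hP, hm]) (by omega)
          refine ⟨a * m.leadingCoeff, Q + C a * S, mul_ne_zero ha hl, ?_⟩
          rw [C_mul]
          linear_combination hQ
    exact fun P hP ↦ key _ P hP (Nat.lt_succ_self _)

end

section

open MvPolynomial

theorem MvPolynomial.finSuccEquiv_pderiv_zero {K : Type*} [CommRing K] {n : ℕ}
    (P : MvPolynomial (Fin (n + 1)) K) :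
    finSuccEquiv K n (pderiv 0 P) = Polynomial.derivative (finSuccEquiv K n P) := by
  induction P using MvPolynomial.induction_on with
  | C a => simp [finSuccEquiv_apply]
  | add p q hp hq => simp [hp, hq]
  | mul_X p i hp =>
    rw [pderiv_mul, map_add, map_mul, map_mul, map_mul, hp, Polynomial.derivative_mul]
    have hX : finSuccEquiv K n (pderiv 0 (X i)) =
        Polynomial.derivative (finSuccEquiv K n (X i)) := by
      refine Fin.cases ?_ (fun j ↦ ?_) i
      · rw [pderiv_X_self, finSuccEquiv_X_zero, map_one, Polynomial.derivative_X]
      · rw [pderiv_X_of_ne (Fin.succ_ne_zero j), finSuccEquiv_X_succ, map_zero,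
          Polynomial.derivative_C]
    rw [hX]

/-- Version of `Polynomial.exists_pseudo_generator_ker` in terms of the first variable. -/
theorem MvPolynomial.exists_pseudo_generator_ker {K B : Type*} [Field K] [CharZero K]
    [CommRing B] [IsDomain B] {n : ℕ} (φ : MvPolynomial (Fin (n + 1)) K →+* B)
    (h : ∀ P, pderiv 0 P = 0 → φ P = 0 → P = 0) (hne : ∃ P ≠ 0, φ P = 0) :
    ∃ m, φ m = 0 ∧ φ (pderiv 0 m) ≠ 0 ∧
      ∀ P, φ P = 0 → ∃ c Q, pderiv 0 c = 0 ∧ φ c ≠ 0 ∧ c * P = Q * m := by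
  let E := finSuccEquiv K n
  have hder : ∀ P, pderiv 0 (E.symm P) = E.symm (Polynomial.derivative P) := by
    intro P
    rw [AlgEquiv.eq_symm_apply]
    exact (finSuccEquiv_pderiv_zero _).trans (by simp [E])
  have hC : ∀ a, pderiv 0 (E.symm (Polynomial.C a)) = 0 := fun a ↦ by simp [hder]
  obtain ⟨m, hm, hdm, hP⟩ := Polynomial.exists_pseudo_generator_ker
    (φ.comp E.symm.toRingEquiv.toRingHom)
    (fun a ha ↦ by
      have := h _ (hC a) ha
      simpa using this)
    (by
      obtain ⟨P, h0, h1⟩ := hne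
      exact ⟨E P, by simpa using h0, by simpa using h1⟩)
  refine ⟨E.symm m, hm, by rw [hder]; exact hdm, fun P h0 ↦ ?_⟩
  obtain ⟨a, Q, ha, hQ⟩ := hP (E P) (by simpa using h0)
  refine ⟨E.symm (Polynomial.C a), E.symm Q, hC a, fun h1 ↦ ?_, ?_⟩
  · exact ha (by simpa using h _ (hC a) h1)
  · have := congrArg E.symm hQ
    simpa using this

end

section

open MvPolynomial

variable {K L : Type*} [Field K] [Field L] [Algebra K L]

theorem MvPolynomial.exists_rename_of_pderiv_eq_zero [CharZero K] {n : ℕ}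
    {P : MvPolynomial (Fin (n + 1)) K} (hP : pderiv 0 P = 0) :
    ∃ p : MvPolynomial (Fin n) K, P = rename Fin.succ p := by
  have h := finSuccEquiv_pderiv_zero P
  rw [hP, map_zero] at h
  obtain ⟨p, hp⟩ := Polynomial.natDegree_eq_zero.1
    (Polynomial.derivative_eq_zero.1 h.symm)
  refine ⟨p, (finSuccEquiv K n).injective ?_⟩
  rw [← hp]
  have : (finSuccEquiv K n : _ →ₐ[K] _).comp (rename Fin.succ) =
      Algebra.algHom K (MvPolynomial (Fin n) K) (Polynomial (MvPolynomial (Fin n) K)) := by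
    refine algHom_ext fun i ↦ ?_
    simp [finSuccEquiv_X_succ, Algebra.algHom]
  exact (DFunLike.congr_fun this p).symm

/-- Evaluation along the orbit `t ↦ (t²x, t⁴y, t⁶z)`. -/
noncomputable def orbitEval (K : Type*) [Field K] [Algebra K L] (x y z : L) :
    MvPolynomial (Fin 3) K →ₐ[K] Polynomial L :=
  aeval ![Polynomial.C x * Polynomial.X ^ 2, Polynomial.C y * Polynomial.X ^ 4,
    Polynomial.C z * Polynomial.X ^ 6]

theorem eval_orbitEval (x y z t : L) (P : MvPolynomial (Fin 3) K) :
    (orbitEval K x y z P).eval t = aeval ![t ^ 2 * x, t ^ 4 * y, t ^ 6 * z] P := by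
  have : ((Polynomial.aeval t).restrictScalars K).comp (orbitEval K x y z) =
      aeval ![t ^ 2 * x, t ^ 4 * y, t ^ 6 * z] := by
    ext i
    fin_cases i <;> simp [orbitEval] <;> ring
  simpa using! DFunLike.congr_fun this P

theorem X_mul_derivative_orbitEval (x y z : L) (P : MvPolynomial (Fin 3) K) :
    Polynomial.X * Polynomial.derivative (orbitEval K x y z P) =
      orbitEval K x y z (weightDer K P) := by
  induction P using MvPolynomial.induction_on with
  | C a =>
    rw [derivation_C, map_zero, ← algebraMap_eq, AlgHom.commutes,
      IsScalarTower.algebraMap_apply K L (Polynomial L)]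
    simp
  | add p q hp hq => simp [mul_add, hp, hq]
  | mul_X p i hp =>
    have hX : Polynomial.X * Polynomial.derivative (orbitEval K x y z (X i)) =
        orbitEval K x y z (weightDer K (X i)) := by
      fin_cases i
      · simp [weightDer_X0, orbitEval]; ring
      · simp [weightDer_X1, orbitEval, Polynomial.C_ofNat]; ring
      · simp [weightDer_X2, orbitEval, Polynomial.C_ofNat]; ring
    rw [Derivation.leibniz, map_mul, Polynomial.derivative_mul, map_add, smul_eq_mul, smul_eq_mul,
      map_mul, map_mul, ← hp, ← hX]
    ring

theorem orbitEval_eq_of_weight [CharZero L] {w : ℕ} (x y z : L) {P : MvPolynomial (Fin 3) K}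
    (hP : weightDer K P = (w : MvPolynomial (Fin 3) K) * P) :
    orbitEval K x y z P = Polynomial.C (aeval ![x, y, z] P) * Polynomial.X ^ w := by
  have h := X_mul_derivative_orbitEval x y z P
  rw [hP, map_mul, map_natCast] at h
  have h1 := eval_orbitEval x y z 1 P
  simp only [one_pow, one_mul] at h1
  rw [← h1]
  set g := orbitEval K x y z P
  have hc : ∀ n, n ≠ w → g.coeff n = 0 := by
    intro n hn
    have := congrArg (fun q ↦ Polynomial.coeff q n) h
    simp only [Polynomial.coeff_natCast_mul] at this
    have h2 : (Polynomial.X * Polynomial.derivative g).coeff n = n * g.coeff n := by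
      cases n with
      | zero => simp
      | succ n => rw [Polynomial.coeff_X_mul, Polynomial.coeff_derivative]; push_cast; ring
    rw [h2] at this
    have h3 : ((n : L) - w) * g.coeff n = 0 := by linear_combination this
    exact (mul_eq_zero.1 h3).resolve_left (sub_ne_zero.2 (by exact_mod_cast hn))
  have hg : g = Polynomial.C (g.coeff w) * Polynomial.X ^ w := by
    ext n
    rw [Polynomial.coeff_C_mul_X_pow]
    split_ifs with hn
    · rw [hn]
    · exact hc n hn
  rw [hg]
  simp

/-- If the orbit map is injective on polynomials in the last two variables, then a common zero of
two consecutive derivatives forces the kernel to contain a differentially closed hypersurface. -/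
theorem exists_stable_of_orbitEval_eq_zero [CharZero K] [CharZero L] {x y z : L}
    (hA : ∀ P : MvPolynomial (Fin 3) K, pderiv 0 P = 0 → orbitEval K x y z P = 0 → P = 0)
    {k : ℕ} (hk : 0 < k) {Φ : MvPolynomial (Fin 3) K} (hΦ : Φ ≠ 0)
    (hw : weightDer K Φ = (k : MvPolynomial (Fin 3) K) * Φ) (hX : pderiv 0 Φ = 0) {r : ℕ}
    (h0 : orbitEval K x y z ((ramanujanDer K)^[r] Φ) = 0)
    (h1 : orbitEval K x y z ((ramanujanDer K)^[r + 1] Φ) = 0) :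
    ∃ m, orbitEval K x y z m = 0 ∧ orbitEval K x y z (pderiv 0 m) ≠ 0 ∧
      ∀ n, orbitEval K x y z ((ramanujanDer K)^[n] m) = 0 := by
  induction r with
  | zero => exact absurd (hA Φ hX h0) hΦ
  | succ r ih =>
    have hdown : orbitEval K x y z (pderiv 0 ((ramanujanDer K)^[r + 1] Φ)) = 0 →
        orbitEval K x y z ((ramanujanDer K)^[r] Φ) = 0 := by
      intro h
      rw [pderiv_iterate hw hX, map_mul, map_mul, map_natCast, ← algebraMap_eq,
        AlgHom.commutes] at h
      refine (mul_eq_zero.1 h).resolve_left (mul_ne_zero ?_ ?_)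
      · rw [Ne, FaithfulSMul.algebraMap_eq_zero_iff]
        norm_num
      · exact_mod_cast (by positivity : (r + 1) * (k + r) ≠ 0)
    rcases eq_or_ne ((ramanujanDer K)^[r + 1] Φ) 0 with hP | hP
    · exact ih (hdown (by rw [hP, map_zero, map_zero])) h0
    obtain ⟨m, hm, hdm, hgen⟩ := exists_pseudo_generator_ker
      (orbitEval K x y z : MvPolynomial (Fin 3) K →+* Polynomial L) hA ⟨_, hP, h0⟩
    simp only [RingHom.coe_coe] at hm hdm hgen
    by_cases hDm : orbitEval K x y z (ramanujanDer K m) = 0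
    · refine ⟨m, hm, hdm, fun n ↦ ?_⟩
      induction n with
      | zero => exact hm
      | succ n ihn =>
        obtain ⟨c, Q, -, hc, hQ⟩ := hgen _ ihn
        have := congrArg (fun p ↦ orbitEval K x y z (ramanujanDer K p)) hQ
        simp only [Derivation.leibniz, smul_eq_mul, map_add, map_mul, ihn, hm, hDm, mul_zero,
          zero_mul, add_zero] at this
        rw [Function.iterate_succ_apply']
        exact (mul_eq_zero.1 this).resolve_left hc
    · obtain ⟨c, Q, hc0, hc, hQ⟩ := hgen _ h0
      have hQ0 : orbitEval K x y z Q = 0 := by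
        have := congrArg (fun p ↦ orbitEval K x y z (ramanujanDer K p)) hQ
        simp only [Derivation.leibniz, smul_eq_mul, map_add, map_mul, h0, hm, mul_zero,
          zero_mul, add_zero, ← Function.iterate_succ_apply' (f := ramanujanDer K), h1] at this
        exact (mul_eq_zero.1 this.symm).resolve_right hDm
      have := congrArg (fun p ↦ orbitEval K x y z (pderiv 0 p)) hQ
      simp only [Derivation.leibniz, smul_eq_mul, map_add, map_mul, hc0, hm, hQ0, mul_zero,
        zero_mul, add_zero] at this
      exact ih (hdown ((mul_eq_zero.1 this).resolve_left hc)) h0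

end

section

open MvPolynomial

variable {K L : Type*} [Field K] [Field L] [Algebra K L]

theorem MvPolynomial.derivative_aeval_of_constant (G : MvPolynomial (Fin 3) K →ₐ[K] Polynomial L)
    (h1 : Polynomial.derivative (G (X 1)) = 0) (h2 : Polynomial.derivative (G (X 2)) = 0)
    (P : MvPolynomial (Fin 3) K) :
    Polynomial.derivative (G P) = Polynomial.derivative (G (X 0)) * G (pderiv 0 P) := by
  induction P using MvPolynomial.induction_on with
  | C a =>
    rw [pderiv_C, map_zero, mul_zero, ← algebraMap_eq, AlgHom.commutes,
      IsScalarTower.algebraMap_apply K L (Polynomial L), Polynomial.algebraMap_eq,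
      Polynomial.derivative_C]
  | add p q hp hq => rw [map_add, map_add, map_add, map_add, hp, hq, mul_add]
  | mul_X p i hp =>
    have hXi : Polynomial.derivative (G (X i)) =
        Polynomial.derivative (G (X 0)) * G (pderiv 0 (X i)) := by
      fin_cases i
      · simp
      · simpa [pderiv_X_of_ne (show (1 : Fin 3) ≠ 0 by decide)] using h1
      · simpa [pderiv_X_of_ne (show (2 : Fin 3) ≠ 0 by decide)] using h2
    rw [Derivation.leibniz, map_mul, Polynomial.derivative_mul, map_add, smul_eq_mul,
      smul_eq_mul, map_mul, map_mul, hp, hXi]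
    ring

theorem MvPolynomial.eq_zero_of_aeval_scaling [IsAlgClosed K] {p : MvPolynomial (Fin 2) K} {s : L}
    (hs : Transcendental K s)
    (h : ∀ μ : K, aeval ![algebraMap K L μ ^ 4 * s, algebraMap K L μ ^ 6 * s] p = 0) : p = 0 := by
  have h1 : ∀ μ σ : K, aeval ![μ ^ 4 * σ, μ ^ 6 * σ] p = 0 := by
    intro μ σ
    let G : MvPolynomial (Fin 2) K →ₐ[K] Polynomial K :=
      aeval ![Polynomial.C (μ ^ 4) * Polynomial.X, Polynomial.C (μ ^ 6) * Polynomial.X]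
    have hG : Polynomial.aeval s (G p) = 0 := by
      rw [← h μ]
      have : (Polynomial.aeval s).comp G =
          aeval ![algebraMap K L μ ^ 4 * s, algebraMap K L μ ^ 6 * s] := by
        refine algHom_ext fun i ↦ ?_
        fin_cases i <;> simp [G]
      exact DFunLike.congr_fun this p
    have hG0 : G p = 0 := by
      by_contra h0
      exact hs ⟨G p, h0, hG⟩
    have : (Polynomial.aeval σ).comp G = aeval ![μ ^ 4 * σ, μ ^ 6 * σ] := by
      refine algHom_ext fun i ↦ ?_
      fin_cases i <;> simp [G]
    rw [← this, AlgHom.comp_apply, hG0, map_zero]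
  have h2 : p * (X 0 * X 1) = 0 := by
    refine MvPolynomial.funext fun v ↦ ?_
    rw [map_zero, map_mul, map_mul, eval_X, eval_X]
    rcases eq_or_ne (v 0) 0 with h0 | h0
    · simp [h0]
    rcases eq_or_ne (v 1) 0 with h3 | h3
    · simp [h3]
    obtain ⟨μ, hμ⟩ := IsAlgClosed.exists_pow_nat_eq (v 1 / v 0) (n := 2) (by norm_num)
    have := h1 μ (v 0 / μ ^ 4)
    have hμ0 : μ ≠ 0 := by
      rintro rfl
      have : v 1 / v 0 ≠ 0 := div_ne_zero h3 h0
      exact this (by rw [← hμ]; norm_num)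
    have hv : ![μ ^ 4 * (v 0 / μ ^ 4), μ ^ 6 * (v 0 / μ ^ 4)] = v := by
      ext i
      fin_cases i
      · simp; field_simp
      · simp
        rw [show μ ^ 6 * (v 0 / μ ^ 4) = μ ^ 2 * v 0 by field_simp, hμ]
        field_simp
    rw [hv, aeval_def] at this
    simp only [Algebra.algebraMap_self, eval₂_id] at this
    rw [this, zero_mul]
  exact (mul_eq_zero.1 h2).resolve_right (mul_ne_zero (X_ne_zero _) (X_ne_zero _))

variable [CharZero K]

/-- An algebraic relation along the orbit makes some representative have algebraic coordinates. -/
theorem exists_isAlgebraic_of_orbitEval_eq_zero [IsAlgClosed K] [IsAlgClosed L] {x y z : L}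
    (hyz : y ^ 3 ≠ z ^ 2) {P : MvPolynomial (Fin 3) K} (hP0 : P ≠ 0) (hX : pderiv 0 P = 0)
    (hP : orbitEval K x y z P = 0) :
    ∃ t : L, t ≠ 0 ∧ IsAlgebraic K (t ^ 4 * y) ∧ IsAlgebraic K (t ^ 6 * z) := by
  rcases eq_or_ne y 0 with rfl | hy
  · have hz : z ≠ 0 := by rintro rfl; norm_num at hyz
    obtain ⟨t, ht⟩ := IsAlgClosed.exists_pow_nat_eq z⁻¹ (n := 6) (by norm_num)
    refine ⟨t, ?_, ?_, ?_⟩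
    · rintro rfl
      exact inv_ne_zero hz (by rw [← ht]; norm_num)
    · rw [mul_zero]; exact isAlgebraic_zero
    · rw [ht, inv_mul_cancel₀ hz]; exact isAlgebraic_one
  rcases eq_or_ne z 0 with rfl | hz
  · obtain ⟨t, ht⟩ := IsAlgClosed.exists_pow_nat_eq y⁻¹ (n := 4) (by norm_num)
    refine ⟨t, ?_, ?_, ?_⟩
    · rintro rfl
      exact inv_ne_zero hy (by rw [← ht]; norm_num)
    · rw [ht, inv_mul_cancel₀ hy]; exact isAlgebraic_one
    · rw [mul_zero]; exact isAlgebraic_zero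
  obtain ⟨t, ht⟩ := IsAlgClosed.exists_pow_nat_eq (y / z) (n := 2) (by norm_num)
  have ht0 : t ≠ 0 := by
    rintro rfl
    exact div_ne_zero hy hz (by rw [← ht]; norm_num)
  have h4 : t ^ 4 * y = y ^ 3 / z ^ 2 := by
    rw [show t ^ 4 = (t ^ 2) ^ 2 by ring, ht]; field_simp
  have h6 : t ^ 6 * z = y ^ 3 / z ^ 2 := by
    rw [show t ^ 6 = (t ^ 2) ^ 3 by ring, ht]; field_simp
  have hs : IsAlgebraic K (y ^ 3 / z ^ 2) := by
    by_contra hs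
    obtain ⟨p, rfl⟩ := exists_rename_of_pderiv_eq_zero hX
    refine hP0 ?_
    rw [eq_zero_of_aeval_scaling (p := p) hs fun μ ↦ ?_, map_zero]
    have := eval_orbitEval x y z (t * algebraMap K L μ) (rename Fin.succ p)
    rw [hP, Polynomial.eval_zero, aeval_rename] at this
    rw [this]
    congr 2
    ext i
    fin_cases i
    · simp [← h4]; ring
    · simp [← h6]; ring
  exact ⟨t, ht0, h4 ▸ hs, h6 ▸ hs⟩

variable [CharZero L]

/-- If the last two coordinates are algebraic and the first is not, then a zero of an iterated
derivative is a zero of all lower ones. -/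
theorem aeval_iterate_eq_zero_of_transcendental [IsAlgClosed K] {x y z t : L} (ht : t ≠ 0)
    (hx : Transcendental K (t ^ 2 * x)) (hy : IsAlgebraic K (t ^ 4 * y))
    (hz : IsAlgebraic K (t ^ 6 * z)) {k : ℕ} (hk : 0 < k) {Φ : MvPolynomial (Fin 3) K}
    (hw : weightDer K Φ = (k : MvPolynomial (Fin 3) K) * Φ) (hX : pderiv 0 Φ = 0) {r : ℕ}
    (h : aeval ![x, y, z] ((ramanujanDer K)^[r] Φ) = 0) {j : ℕ} (hj : j ≤ r) :
    aeval ![x, y, z] ((ramanujanDer K)^[j] Φ) = 0 := by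
  obtain ⟨u, hu⟩ := minpoly.mem_range_of_degree_eq_one K _
    (IsAlgClosed.degree_eq_one_of_irreducible K (minpoly.irreducible hy.isIntegral))
  obtain ⟨v, hv⟩ := minpoly.mem_range_of_degree_eq_one K _
    (IsAlgClosed.degree_eq_one_of_irreducible K (minpoly.irreducible hz.isIntegral))
  let G : MvPolynomial (Fin 3) K →ₐ[K] Polynomial K :=
    aeval ![Polynomial.X, Polynomial.C u, Polynomial.C v]
  have hG : ∀ P, Polynomial.aeval (t ^ 2 * x) (G P) = (orbitEval K x y z P).eval t := by
    intro P
    rw [eval_orbitEval]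
    have : (Polynomial.aeval (t ^ 2 * x)).comp G = aeval ![t ^ 2 * x, t ^ 4 * y, t ^ 6 * z] := by
      refine algHom_ext fun i ↦ ?_
      fin_cases i <;> simp [G, hu, hv]
    exact DFunLike.congr_fun this P
  have hder : ∀ P, Polynomial.derivative (G P) = G (pderiv 0 P) := by
    intro P
    have := derivative_aeval_of_constant G (by simp [G]) (by simp [G]) P
    simpa [G] using this
  have hGr : G ((ramanujanDer K)^[r] Φ) = 0 := by
    by_contra h0
    refine hx ⟨_, h0, ?_⟩
    rw [hG, orbitEval_eq_of_weight x y z (weightDer_iterate hw r), h]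
    simp
  have hall : ∀ i, i ≤ r → G ((ramanujanDer K)^[r - i] Φ) = 0 := by
    intro i
    induction i with
    | zero => exact fun _ ↦ hGr
    | succ i ih =>
      intro hi
      have h1 := hder ((ramanujanDer K)^[r - i] Φ)
      rw [ih (by omega), show r - i = (r - (i + 1)) + 1 by omega, pderiv_iterate hw hX,
        map_mul, map_mul, map_natCast, ← algebraMap_eq, AlgHom.commutes, map_zero] at h1
      refine (mul_eq_zero.1 h1.symm).resolve_left (mul_ne_zero ?_ ?_)
      · rw [Ne, FaithfulSMul.algebraMap_eq_zero_iff]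
        norm_num
      · exact_mod_cast (by positivity : (r - (i + 1) + 1) * (k + (r - (i + 1))) ≠ 0)
  have h1 := hG ((ramanujanDer K)^[j] Φ)
  have h2 := hall (r - j) (by omega)
  rw [show r - (r - j) = j by omega] at h2
  rw [h2, map_zero, orbitEval_eq_of_weight x y z (weightDer_iterate hw j)] at h1
  rw [Polynomial.eval_mul, Polynomial.eval_C, Polynomial.eval_pow, Polynomial.eval_X] at h1
  exact (mul_eq_zero.1 h1.symm).resolve_right (pow_ne_zero _ ht)

end

section

open UpperHalfPlane ModularForm MatrixGroups Derivative EisensteinSeries MvPolynomial Filter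
open scoped Manifold Topology

theorem hasDerivAt_comp_ofComplex {F : ℍ → ℂ} (hF : MDiff F) (z : ℍ) :
    HasDerivAt (F ∘ ofComplex) (2 * Real.pi * Complex.I * normalizedDerivOfComplex F z) z := by
  have h := (UpperHalfPlane.mdifferentiableAt_iff.mp (hF z)).hasDerivAt
  refine h.congr_deriv ?_
  rw [normalizedDerivOfComplex, mul_inv_cancel_left₀ Complex.two_pi_I_ne_zero]

variable {K : Type*} [Field K] [Algebra K ℂ]

/-- The value of a polynomial at the Eisenstein series `E₂, E₄, E₆`. -/
noncomputable def eisEval (P : MvPolynomial (Fin 3) K) (z : ℍ) : ℂ :=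
  aeval ![E2 z, E₄ z, E₆ z] P

theorem hasDerivAt_eisEval (P : MvPolynomial (Fin 3) K) (z : ℍ) :
    HasDerivAt (eisEval P ∘ ofComplex)
      (2 * Real.pi * Complex.I * eisEval (ramanujanDer K P) z) z := by
  have hz : ofComplex (z : ℂ) = z := ofComplex_apply z
  induction P using MvPolynomial.induction_on with
  | C a =>
    have h1 : eisEval (C a : MvPolynomial (Fin 3) K) ∘ ofComplex = fun _ ↦ algebraMap K ℂ a := by
      ext w; simp [eisEval]
    rw [h1, derivation_C]
    simpa [eisEval] using hasDerivAt_const (z : ℂ) (algebraMap K ℂ a)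
  | add p q hp hq =>
    have h1 : eisEval (p + q) ∘ ofComplex =
        (eisEval p ∘ ofComplex) + (eisEval q ∘ ofComplex) := by
      ext w; simp [eisEval]
    rw [h1]
    refine (hp.add hq).congr_deriv ?_
    simp [eisEval]
    ring
  | mul_X p i hp =>
    have hX : HasDerivAt (eisEval (X i : MvPolynomial (Fin 3) K) ∘ ofComplex)
        (2 * Real.pi * Complex.I * eisEval (ramanujanDer K (X i)) z) z := by
      have h4 := congrFun serreDerivative_E₄ z
      have h6 := congrFun serreDerivative_E₆ z
      rw [serreDerivative_apply] at h4 h6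
      have c12 : algebraMap K ℂ (1 / 12) = 1 / 12 := by rw [map_div₀, map_one, map_ofNat]
      have c3 : algebraMap K ℂ (1 / 3) = 1 / 3 := by rw [map_div₀, map_one, map_ofNat]
      have c2 : algebraMap K ℂ (1 / 2) = 1 / 2 := by rw [map_div₀, map_one, map_ofNat]
      fin_cases i
      · have h1 : eisEval (X 0 : MvPolynomial (Fin 3) K) = E2 := by ext w; simp [eisEval]
        refine HasDerivAt.congr_deriv (h1 ▸ hasDerivAt_comp_ofComplex E2_mdifferentiable z) ?_
        rw [h1]
        congr 1
        rw [normalizedDeriv_E2]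
        simp only [Fin.mk_zero, ramanujanDer_X0, eisEval, map_mul, map_sub, map_pow, aeval_X,
          aeval_C, c12]
        simp
      · have h1 : eisEval (X 1 : MvPolynomial (Fin 3) K) = E₄ := by ext w; simp [eisEval]
        refine HasDerivAt.congr_deriv
          (h1 ▸ hasDerivAt_comp_ofComplex (ModularFormClass.holo E₄) z) ?_
        rw [h1]
        congr 1
        simp only [Fin.mk_one, ramanujanDer_X1, eisEval, map_mul, map_sub, aeval_X,
          aeval_C, c3]
        simp
        linear_combination h4
      · have h1 : eisEval (X 2 : MvPolynomial (Fin 3) K) = E₆ := by ext w; simp [eisEval]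
        refine HasDerivAt.congr_deriv
          (h1 ▸ hasDerivAt_comp_ofComplex (ModularFormClass.holo E₆) z) ?_
        rw [h1]
        congr 1
        simp only [Fin.reduceFinMk, ramanujanDer_X2, eisEval, map_mul, map_sub, map_pow, aeval_X,
          aeval_C, c2]
        simp
        linear_combination h6
    have h1 : eisEval (p * X i) ∘ ofComplex =
        (eisEval p ∘ ofComplex) * (eisEval (X i : MvPolynomial (Fin 3) K) ∘ ofComplex) := by
      ext w; simp [eisEval]
    rw [h1]
    refine (hp.mul hX).congr_deriv ?_
    simp only [Function.comp_apply, hz, eisEval, Derivation.leibniz, map_add, smul_eq_mul, map_mul]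
    ring

theorem iteratedDeriv_eisEval (P : MvPolynomial (Fin 3) K) (n : ℕ) (z : ℍ) :
    iteratedDeriv n (eisEval P ∘ ofComplex) z =
      (2 * Real.pi * Complex.I) ^ n * eisEval ((ramanujanDer K)^[n] P) z := by
  induction n generalizing z with
  | zero => simp
  | succ n ih =>
    have h1 : iteratedDeriv n (eisEval P ∘ ofComplex) =ᶠ[𝓝 (z : ℂ)] fun w ↦
        (2 * Real.pi * Complex.I) ^ n * (eisEval ((ramanujanDer K)^[n] P) ∘ ofComplex) w := by
      filter_upwards [isOpen_upperHalfPlaneSet.mem_nhds z.2] with w hw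
      have := ih ⟨w, hw⟩
      simpa [ofComplex_apply_of_im_pos hw] using! this
    rw [iteratedDeriv_succ, h1.deriv_eq,
      ((hasDerivAt_eisEval ((ramanujanDer K)^[n] P) z).const_mul _).deriv,
      Function.iterate_succ_apply']
    ring

theorem eisEval_eq_zero_of_iterate (P : MvPolynomial (Fin 3) K) (a : ℍ)
    (h : ∀ n, eisEval ((ramanujanDer K)^[n] P) a = 0) (z : ℍ) : eisEval P z = 0 := by
  have hd : DifferentiableOn ℂ (eisEval P ∘ ofComplex) upperHalfPlaneSet := fun w hw ↦
    (hasDerivAt_eisEval P ⟨w, hw⟩).differentiableAt.differentiableWithinAt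
  have han : AnalyticOnNhd ℂ (eisEval P ∘ ofComplex) upperHalfPlaneSet :=
    hd.analyticOnNhd isOpen_upperHalfPlaneSet
  have htop : analyticOrderAt (eisEval P ∘ ofComplex) (a : ℂ) = ⊤ := by
    refine ENat.eq_top_iff_forall_ge.2 fun n ↦ ?_
    rw [natCast_le_analyticOrderAt_iff_iteratedDeriv_eq_zero (han a a.2)]
    intro i _
    rw [iteratedDeriv_eisEval, h, mul_zero]
  have hz := han.eqOn_zero_of_preconnected_of_eventuallyEq_zero
    (convex_halfSpace_im_gt 0).isPreconnected a.2 (analyticOrderAt_eq_top.1 htop) z.2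
  simpa using hz

end

section

open UpperHalfPlane ModularForm MatrixGroups EisensteinSeries

theorem E2_smul (γ : SL(2, ℤ)) (z : ℍ) : E2 (γ • z) =
    denom γ z ^ 2 * E2 z + 12 * (2 * (Real.pi : ℂ) * Complex.I)⁻¹ * γ 1 0 * denom γ z := by
  have h := congrFun (E2_slash_eq γ) z
  have hd := denom_ne_zero (γ : GL (Fin 2) ℝ) z
  rw [SL_slash_apply] at h
  simp only [Pi.add_apply, Pi.smul_apply, smul_eq_mul] at h
  rw [zpow_neg, ← div_eq_mul_inv, div_eq_iff (zpow_ne_zero _ hd), zpow_ofNat] at h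
  rw [h]
  field_simp

theorem modularForm_smul {k : ℕ} (f : ModularForm 𝒮ℒ k) (γ : SL(2, ℤ)) (z : ℍ) : f (γ • z) =
    denom γ z ^ k * f z := by
  have h := congrFun (slash_eq_self_of_modularForm f γ) z
  have hd := denom_ne_zero (γ : GL (Fin 2) ℝ) z
  rw [SL_slash_apply, zpow_neg, ← div_eq_mul_inv, div_eq_iff (zpow_ne_zero _ hd), zpow_natCast] at h
  rw [h, mul_comm]

end

section

open UpperHalfPlane ModularForm MatrixGroups EisensteinSeries MvPolynomial

variable {K : Type*} [Field K] [Algebra K ℂ]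

/-- A polynomial relation between `E₂, E₄, E₆` remains one after moving the first coordinate along
an orbit. -/
theorem orbitEval_pderiv_eq_zero_of_eisEval {m : MvPolynomial (Fin 3) K} (a : ℍ)
    (h : ∀ z, eisEval m z = 0) : orbitEval K (E2 a) (E₄ a) (E₆ a) (pderiv 0 m) = 0 := by
  set κ : ℂ := 12 * (2 * (Real.pi : ℂ) * Complex.I)⁻¹ with hκ
  have hκ0 : κ ≠ 0 := mul_ne_zero (by norm_num) (inv_ne_zero Complex.two_pi_I_ne_zero)
  have h1 : ∀ c n : ℕ, aeval ![((c : ℂ) * a + (1 + c * n)) ^ 2 * E2 a +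
      κ * c * ((c : ℂ) * a + (1 + c * n)), ((c : ℂ) * a + (1 + c * n)) ^ 4 * E₄ a,
      ((c : ℂ) * a + (1 + c * n)) ^ 6 * E₆ a] m = 0 := by
    intro c n
    let γ : SL(2, ℤ) := ⟨!![1, n; c, 1 + c * n], by simp [Matrix.det_fin_two]; ring⟩
    have hd : denom γ a = (c : ℂ) * a + (1 + c * n) := by
      have : denom γ a = (γ 1 0 : ℂ) * a + γ 1 1 := by simp [denom]
      rw [this]
      simp [γ]
    have hc : (γ 1 0 : ℂ) = c := by simp [γ]
    have h2 := E2_smul γ a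
    have h4 := modularForm_smul (k := 4) E₄ γ a
    have h6 := modularForm_smul (k := 6) E₆ γ a
    rw [hd] at h2 h4 h6
    rw [hc] at h2
    have := h (γ • a)
    rw [eisEval, h2, h4, h6] at this
    exact this
  have h2 : ∀ c : ℕ, c ≠ 0 → ∀ t : ℂ,
      aeval ![t ^ 2 * E2 a + κ * c * t, t ^ 4 * E₄ a, t ^ 6 * E₆ a] m = 0 := by
    intro c hc t
    let G : MvPolynomial (Fin 3) K →ₐ[K] Polynomial ℂ :=
      aeval ![Polynomial.X ^ 2 * Polynomial.C (E2 a) + Polynomial.C (κ * c) * Polynomial.X,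
        Polynomial.X ^ 4 * Polynomial.C (E₄ a), Polynomial.X ^ 6 * Polynomial.C (E₆ a)]
    have hG : ∀ t : ℂ, (G m).eval t =
        aeval ![t ^ 2 * E2 a + κ * c * t, t ^ 4 * E₄ a, t ^ 6 * E₆ a] m := by
      intro t
      have : ((Polynomial.aeval t).restrictScalars K).comp G =
          aeval ![t ^ 2 * E2 a + κ * c * t, t ^ 4 * E₄ a, t ^ 6 * E₆ a] := by
        refine algHom_ext fun i ↦ ?_
        fin_cases i <;> simp [G] <;> ring
      simpa using! DFunLike.congr_fun this m
    rw [← hG, Polynomial.eq_zero_of_infinite_isRoot (G m) ?_, Polynomial.eval_zero]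
    refine Set.infinite_of_injective_forall_mem (f := fun n : ℕ ↦ (c : ℂ) * a + (1 + c * n))
      (fun n n' hn ↦ ?_) (fun n ↦ ?_)
    · have hc' : (c : ℂ) ≠ 0 := by exact_mod_cast hc
      simpa [hc'] using hn
    · exact (hG _).trans (h1 c n)
  have h3 : ∀ t : ℂ, t ≠ 0 →
      (orbitEval K (E2 a) (E₄ a) (E₆ a) (pderiv 0 m)).eval t = 0 := by
    intro t ht
    let G : MvPolynomial (Fin 3) K →ₐ[K] Polynomial ℂ :=
      aeval ![Polynomial.C (t ^ 2 * E2 a) + Polynomial.C (κ * t) * Polynomial.X,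
        Polynomial.C (t ^ 4 * E₄ a), Polynomial.C (t ^ 6 * E₆ a)]
    have hG : ∀ (P : MvPolynomial (Fin 3) K) (s : ℂ), (G P).eval s =
        aeval ![t ^ 2 * E2 a + κ * s * t, t ^ 4 * E₄ a, t ^ 6 * E₆ a] P := by
      intro P s
      have : ((Polynomial.aeval s).restrictScalars K).comp G =
          aeval ![t ^ 2 * E2 a + κ * s * t, t ^ 4 * E₄ a, t ^ 6 * E₆ a] := by
        refine algHom_ext fun i ↦ ?_
        fin_cases i
        · simp [G]; ring
        · simp [G]
        · simp [G]
      simpa using! DFunLike.congr_fun this P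
    have hGm : G m = 0 := by
      refine Polynomial.eq_zero_of_infinite_isRoot (G m) ?_
      refine Set.infinite_of_injective_forall_mem (f := fun n : ℕ ↦ ((n + 1 : ℕ) : ℂ))
        (fun n n' hn ↦ ?_) (fun n ↦ ?_)
      · simpa using hn
      · exact (hG _ _).trans (h2 (n + 1) (by omega) t)
    have hder := derivative_aeval_of_constant G (by simp [G]) (by simp [G]) m
    have hX : Polynomial.derivative (G (X 0)) = Polynomial.C (κ * t) := by simp [G]
    rw [hGm, hX, map_zero] at hder
    have hG0 := (mul_eq_zero.1 hder.symm).resolve_left (Polynomial.C_ne_zero.2 (mul_ne_zero hκ0 ht))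
    have := hG (pderiv 0 m) 0
    rw [hG0, Polynomial.eval_zero] at this
    rw [eval_orbitEval, this]
    simp
  refine Polynomial.eq_zero_of_infinite_isRoot _ ?_
  refine Set.infinite_of_injective_forall_mem (f := fun n : ℕ ↦ ((n + 1 : ℕ) : ℂ))
    (fun n n' hn ↦ ?_) (fun n ↦ ?_)
  · simpa using hn
  · exact h3 _ (by exact_mod_cast n.succ_ne_zero)

end

section

open UpperHalfPlane ModularForm MatrixGroups EisensteinSeries MvPolynomial

variable (K : Type*) [Field K] [Algebra K ℂ]

/-- `F` is an isobaric polynomial of weight `k` over `K` in the Eisenstein series `E₄`, `E₆`. -/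
def IsIsobaric (k : ℤ) (F : ℍ → ℂ) : Prop :=
  ∃ Φ : MvPolynomial (Fin 3) K, weightDer K Φ = (k : MvPolynomial (Fin 3) K) * Φ ∧
    pderiv 0 Φ = 0 ∧ ∀ z, eisEval Φ z = F z

variable {K}

theorem IsIsobaric.add {k : ℤ} {F G : ℍ → ℂ} (hF : IsIsobaric K k F) (hG : IsIsobaric K k G) :
    IsIsobaric K k (F + G) := by
  obtain ⟨P, h1, h2, h3⟩ := hF
  obtain ⟨Q, h4, h5, h6⟩ := hG
  refine ⟨P + Q, ?_, ?_, fun z ↦ ?_⟩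
  · rw [map_add, h1, h4]; ring
  · rw [map_add, h2, h5, add_zero]
  · rw [Pi.add_apply, ← h3, ← h6]; simp [eisEval]

theorem IsIsobaric.mul {k l : ℤ} {F G : ℍ → ℂ} (hF : IsIsobaric K k F) (hG : IsIsobaric K l G) :
    IsIsobaric K (k + l) (F * G) := by
  obtain ⟨P, h1, h2, h3⟩ := hF
  obtain ⟨Q, h4, h5, h6⟩ := hG
  refine ⟨P * Q, ?_, ?_, fun z ↦ ?_⟩
  · rw [Derivation.leibniz, h1, h4, smul_eq_mul, smul_eq_mul]; push_cast; ring
  · rw [Derivation.leibniz, h2, h5, smul_zero, smul_zero, add_zero]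
  · rw [Pi.mul_apply, ← h3, ← h6]; simp [eisEval]

theorem IsIsobaric.smul {k : ℤ} {F : ℍ → ℂ} (c : K) (hF : IsIsobaric K k F) :
    IsIsobaric K k (algebraMap K ℂ c • F) := by
  obtain ⟨P, h1, h2, h3⟩ := hF
  refine ⟨c • P, ?_, ?_, fun z ↦ ?_⟩
  · rw [Derivation.map_smul, h1, mul_smul_comm]
  · rw [Derivation.map_smul, h2, smul_zero]
  · rw [Pi.smul_apply, ← h3]; simp [eisEval, Algebra.smul_def]

theorem isIsobaric_zero (k : ℤ) : IsIsobaric K k 0 :=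
  ⟨0, by simp, by simp, fun z ↦ by simp [eisEval]⟩

theorem isIsobaric_one : IsIsobaric K 0 1 :=
  ⟨1, by simp, by simp, fun z ↦ by simp [eisEval]⟩

theorem isIsobaric_E₄ : IsIsobaric K 4 E₄ :=
  ⟨X 1, by rw [weightDer_X1]; norm_num, by rw [pderiv_X_of_ne (by decide)],
    fun z ↦ by simp [eisEval]⟩

theorem isIsobaric_E₆ : IsIsobaric K 6 E₆ :=
  ⟨X 2, by rw [weightDer_X2]; norm_num, by rw [pderiv_X_of_ne (by decide)],
    fun z ↦ by simp [eisEval]⟩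

variable [CharZero K]

theorem isIsobaric_discriminant : IsIsobaric K 12 discriminant := by
  have h4 := isIsobaric_E₄.mul (isIsobaric_E₄.mul (isIsobaric_E₄ (K := K)))
  have h6 := isIsobaric_E₆.mul (isIsobaric_E₆ (K := K))
  norm_num only at h4 h6
  convert! (h4.add (h6.smul (-1))).smul (1728⁻¹) using 1
  ext z
  rw [discriminant_eq_E₄_cube_sub_E₆_sq]
  simp [map_ofNat (algebraMap K ℂ) 1728]
  ring

/-- The `q`-expansion of `F` has coefficients in `K`. -/
def HasCoeffsIn (K : Type*) [Field K] [Algebra K ℂ] (F : ℍ → ℂ) : Prop :=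
  qExpansion 1 F ∈ (PowerSeries.map (algebraMap K ℂ)).range

theorem hasCoeffsIn_E {k : ℕ} (hk : 3 ≤ k) (hk2 : Even k) : HasCoeffsIn K (E hk) := by
  refine ⟨PowerSeries.mk fun m ↦ if m = 0 then 1 else
    -(2 * (k : K) / ((bernoulli k : ℚ) : K)) * ((ArithmeticFunction.sigma (k - 1) m : ℕ) : K), ?_⟩
  ext m
  rw [PowerSeries.coeff_map, PowerSeries.coeff_mk, E_qExpansion_coeff hk hk2]
  split_ifs <;> simp [map_ofNat (algebraMap K ℂ) 2]

theorem hasCoeffsIn_discriminant : ∃ U : PowerSeries K, PowerSeries.constantCoeff U = 1 ∧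
    qExpansion 1 discriminant = PowerSeries.X * PowerSeries.map (algebraMap K ℂ) U := by
  obtain ⟨P, hP⟩ := hasCoeffsIn_E (K := K) (k := 4) (by norm_num) ⟨2, rfl⟩
  obtain ⟨Q, hQ⟩ := hasCoeffsIn_E (K := K) (k := 6) (by norm_num) ⟨3, rfl⟩
  have hD : qExpansion 1 discriminant = PowerSeries.map (algebraMap K ℂ)
      ((1728⁻¹ : K) • (P ^ 3 - Q ^ 2)) := by
    have h : (discriminant : ℍ → ℂ) = ((1728⁻¹ : ℂ) •
        ((ModularForm.mcast (by decide) (E₄.pow 3) : ModularForm 𝒮ℒ 12) -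
          ModularForm.mcast (by decide) (E₆.pow 2)) : ModularForm 𝒮ℒ 12) := by
      ext z
      rw [discriminant_eq_E₄_cube_sub_E₆_sq]
      simp only [coe_mcast, ModularForm.coe_pow, sub_apply, Pi.pow_apply, smul_apply, smul_eq_mul]
      ring
    rw [h, FunLike.coe_smul, ModularForm.qExpansion_smul one_pos one_mem_strictPeriods_SL,
      FunLike.coe_sub, ModularForm.qExpansion_sub one_pos one_mem_strictPeriods_SL]
    simp only [coe_mcast, ModularForm.qExpansion_pow one_pos one_mem_strictPeriods_SL]
    rw [← hP, ← hQ, PowerSeries.smul_eq_C_mul, PowerSeries.smul_eq_C_mul]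
    simp [map_ofNat (algebraMap K ℂ) 1728]
  set V : PowerSeries K := (1728⁻¹ : K) • (P ^ 3 - Q ^ 2)
  have h0 : PowerSeries.constantCoeff V = 0 := by
    have h := congrArg (PowerSeries.coeff 0) hD
    rw [PowerSeries.coeff_map, PowerSeries.coeff_of_lt_order 0
      (by rw [discriminant_qExpansion_order]; norm_num)] at h
    simpa using h.symm
  obtain ⟨U, hU⟩ := PowerSeries.X_dvd_iff.mpr h0
  refine ⟨U, ?_, by rw [hD, hU, map_mul, PowerSeries.map_X]⟩
  have h := congrArg (PowerSeries.coeff 1) hD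
  rw [discriminant_qExpansion_coeff_one, hU, map_mul, PowerSeries.map_X,
    PowerSeries.coeff_succ_X_mul, PowerSeries.coeff_map] at h
  apply (algebraMap K ℂ).injective
  rw [map_one, h, PowerSeries.coeff_zero_eq_constantCoeff_apply]

theorem HasCoeffsIn.of_discriminant_mul {F G : ℍ → ℂ} (hF : HasCoeffsIn K F)
    (h : qExpansion 1 F = qExpansion 1 discriminant * qExpansion 1 G) : HasCoeffsIn K G := by
  obtain ⟨U, hU1, hU⟩ := hasCoeffsIn_discriminant (K := K)
  obtain ⟨P, hP⟩ := hF
  have h0 : PowerSeries.constantCoeff P = 0 := by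
    apply (algebraMap K ℂ).injective
    have h2 := congrArg (PowerSeries.coeff 0) (hP.trans h)
    rw [hU] at h2
    simpa using h2
  obtain ⟨Q, rfl⟩ := PowerSeries.X_dvd_iff.mpr h0
  rw [← hP, hU, map_mul, PowerSeries.map_X, mul_assoc] at h
  have h3 := mul_left_cancel₀ PowerSeries.X_ne_zero h
  refine ⟨U⁻¹ * Q, ?_⟩
  rw [map_mul, h3, ← mul_assoc, ← map_mul, PowerSeries.inv_mul_cancel _ (by simp [hU1]), map_one,
    one_mul]

theorem exists_modularForm_coeff_zero_eq_one (n : ℕ) (hn : n ≠ 1) :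
    ∃ g : ModularForm 𝒮ℒ (2 * n : ℤ), (qExpansion 1 g).coeff 0 = 1 ∧ HasCoeffsIn K g ∧
      IsIsobaric K (2 * n) g := by
  induction n using Nat.strong_induction_on with
  | _ n ih =>
    obtain rfl | h0 := eq_or_ne n 0
    · refine ⟨ModularForm.mcast (by simp) (1 : ModularForm 𝒮ℒ 0), ?_, ?_, ?_⟩
      · rw [ModularForm.qExpansion_mcast, ModularForm.qExpansion_one]; simp
      · rw [HasCoeffsIn, ModularForm.qExpansion_mcast, ModularForm.qExpansion_one]
        exact one_mem _
      · exact isIsobaric_one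
    obtain rfl | h3 := eq_or_ne n 3
    · exact ⟨ModularForm.mcast (by norm_num) E₆,
        E_qExpansion_coeff_zero (k := 6) (by norm_num) ⟨3, rfl⟩,
        hasCoeffsIn_E (k := 6) (by norm_num) ⟨3, rfl⟩, isIsobaric_E₆⟩
    obtain ⟨g, hg0, hg, hi⟩ := ih (n - 2) (by lia) (by lia)
    have hw : 2 * ((n - 2 : ℕ) : ℤ) + 4 = 2 * n := by lia
    have hq : qExpansion 1 (ModularForm.mcast hw (g.mul E₄) : ModularForm 𝒮ℒ (2 * n)) =
        qExpansion 1 g * qExpansion 1 E₄ := by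
      rw [ModularForm.qExpansion_mcast, ModularForm.qExpansion_mul one_pos one_mem_strictPeriods_SL]
    refine ⟨ModularForm.mcast hw (g.mul E₄), ?_, ?_, ?_⟩
    · rw [hq, PowerSeries.coeff_mul, Finset.Nat.antidiagonal_zero, Finset.sum_singleton, hg0,
        E_qExpansion_coeff_zero _ ⟨2, rfl⟩, one_mul]
    · rw [HasCoeffsIn, hq]
      exact mul_mem hg (hasCoeffsIn_E (k := 4) (by norm_num) ⟨2, rfl⟩)
    · have h := hi.mul isIsobaric_E₄
      rw [hw] at h
      exact h

/-- A modular form of level one with Fourier coefficients in `K` is a polynomial in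
`E₄` and `E₆` over `K`. -/
theorem isIsobaric_of_hasCoeffsIn (N : ℕ) : ∀ (k : ℤ) (_ : k < N) (f : ModularForm 𝒮ℒ k)
    (_ : HasCoeffsIn K f), IsIsobaric K k f := by
  induction N with
  | zero =>
    intro k hk f _
    rw [ModularFormClass.levelOne_neg_weight_eq_zero (by simpa using hk) f]
    exact isIsobaric_zero k
  | succ N ih =>
    intro k hk f hf
    rcases lt_or_ge k 0 with hneg | hpos
    · rw [ModularFormClass.levelOne_neg_weight_eq_zero hneg f]
      exact isIsobaric_zero k
    rcases Int.even_or_odd k with heven | hodd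
    swap
    · rw [ModularForm.levelOne_odd_weight_eq_zero hodd f, FunLike.coe_zero]
      exact isIsobaric_zero k
    obtain ⟨n, rfl⟩ : ∃ n : ℕ, k = 2 * n := by
      obtain ⟨m, rfl⟩ := heven
      exact ⟨m.toNat, by lia⟩
    obtain rfl | hn := eq_or_ne n 1
    · have h : f = 0 := rank_zero_iff_forall_zero.mp levelOne_weight_two_rank_zero f
      rw [h, FunLike.coe_zero]
      exact isIsobaric_zero _
    obtain ⟨g, hg0, hg, hi⟩ := exists_modularForm_coeff_zero_eq_one (K := K) n hn
    obtain ⟨P, hP⟩ := id hf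
    set c : K := PowerSeries.coeff 0 P
    have hc : (qExpansion 1 f).coeff 0 = algebraMap K ℂ c := by
      rw [← hP, PowerSeries.coeff_map]
    set f' : ModularForm 𝒮ℒ (2 * n : ℤ) := f - algebraMap K ℂ c • g with hf'
    have hq : qExpansion 1 f' = qExpansion 1 f - algebraMap K ℂ c • qExpansion 1 g := by
      rw [hf', FunLike.coe_sub, ModularForm.qExpansion_sub one_pos one_mem_strictPeriods_SL,
        FunLike.coe_smul, ModularForm.qExpansion_smul one_pos one_mem_strictPeriods_SL]
    have hcusp : (qExpansion 1 f').coeff 0 = 0 := by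
      rw [hq, map_sub, hc, PowerSeries.coeff_smul, hg0, smul_eq_mul, mul_one, sub_self]
    have hf'K : HasCoeffsIn K f' := by
      rw [HasCoeffsIn, hq, PowerSeries.smul_eq_C_mul]
      refine sub_mem hf (mul_mem ⟨PowerSeries.C c, ?_⟩ hg)
      rw [PowerSeries.map_C]
    have hh := ih (2 * n - 12) (by push_cast at hk; lia) _
      (hf'K.of_discriminant_mul (qExpansion_eq_qExpansion_discriminant_mul f' hcusp))
    have hD := isIsobaric_discriminant.mul hh
    rw [discriminant_mul_discriminantEquiv, add_sub_cancel] at hD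
    convert! hD.add (hi.smul c) using 1
    ext z
    simp [hf', Algebra.smul_def]

end

section

open UpperHalfPlane ModularForm MatrixGroups EisensteinSeries MvPolynomial

theorem summable_mul_pow_of_norm_lt {c : ℕ → ℂ} {p q : ℂ} (hp : Summable fun n ↦ c n * p ^ n)
    (h : ‖q‖ < ‖p‖) : Summable fun n ↦ c n * q ^ n := by
  obtain ⟨C, hC⟩ := hp.tendsto_atTop_zero.norm.bddAbove_range
  have hp0 : 0 < ‖p‖ := (norm_nonneg q).trans_lt h
  refine Summable.of_norm_bounded (g := fun n ↦ C * (‖q‖ / ‖p‖) ^ n)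
    ((summable_geometric_of_lt_one (by positivity) ((div_lt_one hp0).mpr h)).mul_left C) fun n ↦ ?_
  have h1 : ‖c n * p ^ n‖ ≤ C := hC ⟨n, rfl⟩
  calc ‖c n * q ^ n‖ = ‖c n * p ^ n‖ * (‖q‖ / ‖p‖) ^ n := by
        rw [norm_mul, norm_mul, norm_pow, norm_pow, div_pow]
        field_simp
    _ ≤ C * (‖q‖ / ‖p‖) ^ n := by gcongr

theorem summable_fourier_of_ne_zero {f : ℂ → ℂ} (hf : DifferentiableOn ℂ f {z | 0 < z.im})
    {c : ℕ → ℂ} (h : ∀ z : ℂ, 0 < z.im →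
      f z = ∑' n : ℕ, c n * Complex.exp (2 * Real.pi * Complex.I * z) ^ n)
    (hne : ∃ z : ℂ, 0 < z.im ∧ f z ≠ 0) {z : ℂ} (hz : 0 < z.im) :
    Summable fun n : ℕ ↦ c n * Complex.exp (2 * Real.pi * Complex.I * z) ^ n := by
  by_contra hns
  obtain ⟨w, hw, hfw⟩ := hne
  have hopen : IsOpen {z : ℂ | 0 < z.im} := isOpen_lt continuous_const Complex.continuous_im
  have hconv : IsPreconnected {z : ℂ | 0 < z.im} := (convex_halfSpace_im_gt 0).isPreconnected
  have han : AnalyticOnNhd ℂ f {z : ℂ | 0 < z.im} := hf.analyticOnNhd hopen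
  have hz2 : 0 < (z / 2).im := by simpa using hz
  refine hfw (han.eqOn_zero_of_preconnected_of_eventuallyEq_zero hconv (z₀ := z / 2) hz2 ?_ hw)
  have hlt : (z / 2).im < z.im := by simpa using hz
  filter_upwards [hopen.mem_nhds hz2,
    (isOpen_lt Complex.continuous_im continuous_const).mem_nhds hlt] with u hu hu2
  rw [h u hu, Pi.zero_apply]
  refine tsum_eq_zero_of_not_summable fun hs ↦ hns (summable_mul_pow_of_norm_lt hs ?_)
  rw [Complex.norm_exp, Complex.norm_exp, Real.exp_lt_exp]
  simp
  nlinarith [Real.pi_pos]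

/-- A holomorphic function on the upper half-plane with the modular transformation law and a
convergent Fourier expansion, as a modular form of level one. -/
theorem exists_modularForm_of_fourier {f : ℂ → ℂ} {k : ℕ}
    (hf : DifferentiableOn ℂ f {z | 0 < z.im})
    (hmod : ∀ a b c d : ℤ, a * d - b * c = 1 → ∀ z : ℂ, 0 < z.im →
      f (((a : ℂ) * z + (b : ℂ)) / ((c : ℂ) * z + (d : ℂ))) = ((c : ℂ) * z + (d : ℂ)) ^ k * f z)
    {c : ℕ → ℂ} (h : ∀ z : ℍ,
      HasSum (fun n : ℕ ↦ c n * Complex.exp (2 * Real.pi * Complex.I * z) ^ n) (f z)) :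
    ∃ F : ModularForm 𝒮ℒ k, (∀ z : ℍ, F z = f z) ∧ ∀ n, (qExpansion 1 F).coeff n = c n := by
  have hsum : ∀ τ : ℍ, HasSum (fun m ↦ c m • Function.Periodic.qParam 1 τ ^ m) (f τ) := by
    intro τ
    simpa [Function.Periodic.qParam] using h τ
  have hslash : ∀ γ : SL(2, ℤ), (fun z : ℍ ↦ f z) ∣[(k : ℤ)] γ = fun z : ℍ ↦ f z := by
    intro γ
    ext z
    have hd := denom_ne_zero (γ : GL (Fin 2) ℝ) z
    have hdet : γ 0 0 * γ 1 1 - γ 0 1 * γ 1 0 = 1 := by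
      rw [← Matrix.det_fin_two, γ.det_coe]
    rw [SL_slash_apply, zpow_neg, ← div_eq_mul_inv, div_eq_iff (zpow_ne_zero _ hd), zpow_natCast,
      coe_specialLinearGroup_apply]
    have := hmod _ _ _ _ hdet z z.im_pos
    simpa [denom, mul_comm] using this
  have hbdd := isBoundedAtImInfty_of_hasSum_qExpansion one_pos (f := fun z : ℍ ↦ f z) hsum
  let F : ModularForm 𝒮ℒ k :=
    { toFun := fun z : ℍ ↦ f z
      slash_action_eq' := by
        rintro _ ⟨γ, rfl⟩
        exact hslash γ
      holo' := by
        refine UpperHalfPlane.mdifferentiable_iff.mpr (hf.congr fun z hz ↦ ?_)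
        simp [ofComplex_apply_of_im_pos hz]
      bdd_at_cusps' := by
        intro c hc
        rw [OnePoint.isBoundedAt_iff_forall_SL2Z hc]
        intro γ _
        rw [hslash γ]
        exact hbdd }
  refine ⟨F, fun z ↦ rfl, fun n ↦ ?_⟩
  exact (ModularFormClass.qExpansion_coeff_unique (F := ModularForm 𝒮ℒ k) one_pos
    one_mem_strictPeriods_SL (f := F) hsum n).symm

end

section

open UpperHalfPlane ModularForm MatrixGroups EisensteinSeries MvPolynomial

variable {K : Type*} [Field K] [Algebra K ℂ]

theorem orbitEval_iterate_eq_zero {k : ℕ} {Φ : MvPolynomial (Fin 3) K}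
    (hw : weightDer K Φ = (k : MvPolynomial (Fin 3) K) * Φ) {a : ℍ} {n : ℕ}
    (h : eisEval ((ramanujanDer K)^[n] Φ) a = 0) :
    orbitEval K (E2 a) (E₄ a) (E₆ a) ((ramanujanDer K)^[n] Φ) = 0 := by
  rw [eisEval] at h
  rw [orbitEval_eq_of_weight _ _ _ (weightDer_iterate hw n), h, Polynomial.C_0, zero_mul]

variable [CharZero K] [IsAlgClosed K]

theorem eisEval_iterate_eq_zero (hK : ∀ x : ℂ, IsAlgebraic K x → IsAlgebraic ℚ x) {k : ℕ}
    (hk : 0 < k) {Φ : MvPolynomial (Fin 3) K} (hΦ : Φ ≠ 0)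
    (hw : weightDer K Φ = (k : MvPolynomial (Fin 3) K) * Φ) (hX : pderiv 0 Φ = 0) {a : ℍ} {r : ℕ}
    (h0 : eisEval ((ramanujanDer K)^[r] Φ) a = 0)
    (h1 : eisEval ((ramanujanDer K)^[r + 1] Φ) a = 0) {j : ℕ} (hj : j ≤ r) :
    eisEval ((ramanujanDer K)^[j] Φ) a = 0 := by
  by_cases hA : ∀ P : MvPolynomial (Fin 3) K, pderiv 0 P = 0 →
      orbitEval K (E2 a) (E₄ a) (E₆ a) P = 0 → P = 0
  · obtain ⟨m, -, hm, hmn⟩ := exists_stable_of_orbitEval_eq_zero hA hk hΦ hw hX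
      (orbitEval_iterate_eq_zero hw h0) (orbitEval_iterate_eq_zero hw h1)
    refine absurd (orbitEval_pderiv_eq_zero_of_eisEval a
      (eisEval_eq_zero_of_iterate m a fun n ↦ ?_)) hm
    simpa [hmn n, eisEval] using (eval_orbitEval (E2 a) (E₄ a) (E₆ a) 1
      ((ramanujanDer K)^[n] m)).symm
  · push Not at hA
    obtain ⟨P, hPX, hP, hP0⟩ := hA
    have hyz : E₄ a ^ 3 ≠ E₆ a ^ 2 := by
      intro h
      apply discriminant_ne_zero a
      rw [discriminant_eq_E₄_cube_sub_E₆_sq, h, sub_self, zero_div]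
    obtain ⟨t, ht, hy, hz⟩ := exists_isAlgebraic_of_orbitEval_eq_zero hyz hP0 hPX hP
    exact aeval_iterate_eq_zero_of_transcendental ht
      (fun hx ↦ not_isAlgebraic_E2_E₄_E₆ ht (hK _ hx) (hK _ hy) (hK _ hz)) hy hz hk hw hX h0 hj

theorem iteratedDeriv_modularForm_eq_zero (hK : ∀ x : ℂ, IsAlgebraic K x → IsAlgebraic ℚ x)
    {k : ℕ} (hk : 0 < k) {F : ModularForm 𝒮ℒ k} (hF : F ≠ 0) (hFK : HasCoeffsIn K F) {a : ℍ}
    {r : ℕ} (h0 : iteratedDeriv r (F ∘ ofComplex) a = 0)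
    (h1 : iteratedDeriv (r + 1) (F ∘ ofComplex) a = 0) {j : ℕ} (hj : j ≤ r) :
    iteratedDeriv j (F ∘ ofComplex) a = 0 := by
  obtain ⟨Φ, hw, hX, hΦ⟩ := isIsobaric_of_hasCoeffsIn (K := K) (k + 1) k (by norm_num) F hFK
  obtain rfl | hΦ0 := eq_or_ne Φ 0
  · exact absurd (ModularForm.ext fun z ↦ by simp [← hΦ z, eisEval]) hF
  have hFΦ : (F : ℍ → ℂ) = eisEval Φ := funext fun z ↦ (hΦ z).symm
  rw [Int.cast_natCast] at hw
  have hpi (n : ℕ) : (2 * Real.pi * Complex.I : ℂ) ^ n ≠ 0 := pow_ne_zero _ Complex.two_pi_I_ne_zero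
  rw [hFΦ, iteratedDeriv_eisEval] at h0 h1 ⊢
  rw [eisEval_iterate_eq_zero hK hk hΦ0 hw hX ((mul_eq_zero_iff_left (hpi _)).mp h0)
    ((mul_eq_zero_iff_left (hpi _)).mp h1) hj, mul_zero]

end

theorem IsAlgebraic.of_algebraicClosure {F E : Type*} [Field F] [Field E] [Algebra F E] {x : E}
    (hx : IsAlgebraic (algebraicClosure F E) x) : IsAlgebraic F x :=
  hx.restrictScalars F

open UpperHalfPlane ModularForm MatrixGroups in
theorem hasCoeffsIn_algebraicClosure {F : ℍ → ℂ}
    (h : ∀ n, IsAlgebraic ℚ ((qExpansion 1 F).coeff n)) :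
    HasCoeffsIn (algebraicClosure ℚ ℂ) F :=
  ⟨PowerSeries.mk fun n ↦ ⟨(qExpansion 1 F).coeff n, mem_algebraicClosure_iff.mpr (h n)⟩, by
    ext n
    rw [PowerSeries.coeff_map, PowerSeries.coeff_mk]
    rfl⟩

theorem stmt15 (k : ℕ) (hk : 0 < k) (f : ℂ → ℂ)
    (hf_hol : DifferentiableOn ℂ f UpperHalf)
    (hf_mod : ∀ a b c d : ℤ, a * d - b * c = 1 → ∀ z ∈ UpperHalf,
      f (((a : ℂ) * z + (b : ℂ)) / ((c : ℂ) * z + (d : ℂ))) = ((c : ℂ) * z + (d : ℂ)) ^ k * f z)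
    (coeffs : ℕ → ℂ) (h_alg : ∀ n, IsAlgebraic ℚ (coeffs n))
    (h_exp : ∀ z ∈ UpperHalf,
      f z = ∑' n : ℕ, coeffs n * Complex.exp (2 * Real.pi * Complex.I * z) ^ n)
    (hf_ne : ∃ z ∈ UpperHalf, f z ≠ 0)
    (r : ℕ) (hr : 1 ≤ r) (a : ℂ) (ha : a ∈ UpperHalf)
    (e : ℕ) (he : 2 ≤ e)
    (h_zero : ∀ j < e, iteratedDeriv j (iteratedDeriv r f) a = 0)
    (h_ne : iteratedDeriv e (iteratedDeriv r f) a ≠ 0) :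
    (∀ j < e + r, iteratedDeriv j f a = 0) ∧ iteratedDeriv (e + r) f a ≠ 0 := by
  have hcomp (j : ℕ) : iteratedDeriv j (iteratedDeriv r f) = iteratedDeriv (j + r) f := by
    simp only [iteratedDeriv_eq_iterate, Function.iterate_add_apply]
  simp only [hcomp] at h_zero h_ne
  refine ⟨fun j hj ↦ ?_, h_ne⟩
  rcases le_or_gt r j with hrj | hjr
  · simpa [Nat.sub_add_cancel hrj] using h_zero (j - r) (by lia)
  obtain ⟨F, hF, hFc⟩ := exists_modularForm_of_fourier hf_hol hf_mod (c := coeffs) fun z ↦ by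
    rw [h_exp z z.im_pos]
    exact (summable_fourier_of_ne_zero hf_hol h_exp hf_ne z.im_pos).hasSum
  have heq : f =ᶠ[nhds a] F ∘ UpperHalfPlane.ofComplex := by
    filter_upwards [(isOpen_lt continuous_const Complex.continuous_im).mem_nhds ha] with z hz
    rw [Function.comp_apply, UpperHalfPlane.ofComplex_apply_of_im_pos hz, hF]
  have hF0 : F ≠ 0 := by
    rintro rfl
    obtain ⟨z, hz, hfz⟩ := hf_ne
    exact hfz (hF ⟨z, hz⟩).symm
  have h0 := h_zero 0 (by lia)
  have h1 := h_zero 1 (by lia)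
  rw [zero_add] at h0
  rw [add_comm] at h1
  rw [heq.iteratedDeriv_eq] at h0 h1 ⊢
  have : IsAlgClosed (algebraicClosure ℚ ℂ) := (algebraicClosure.isAlgClosure ℚ ℂ).isAlgClosed
  exact iteratedDeriv_modularForm_eq_zero (K := algebraicClosure ℚ ℂ)
    (fun _ hx ↦ hx.of_algebraicClosure) hk hF0
    (hasCoeffsIn_algebraicClosure fun n ↦ hFc n ▸ h_alg n) (a := ⟨a, ha⟩) h0 h1 hjr.le
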